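/- Let M be an o-minimal structure, let S be a definable family of nonempty subsets of M^k, and let n > dim(∪S), where ∪S is the union of the members of S. The following are equivalent: (1) there exists some m ≥ n such that S has the (m,n)-property; (2) S has a finite tame transversal, i.e., S can be covered by finitely many subfamilies, each of which extends to a definable type. -/

import Mathlib

open FirstOrder Set

/-- `M` is an o-minimal `L`-structure: a densely linearly ordered structure without endpoints,
whose order is `∅`-definable, and in which every definable (with parameters) subset of `M`
is a finite union of points and open intervals with endpoints in `M ∪ {±∞}`. -/
def IsOMinimal (L : FirstOrder.Language) (M : Type*) [L.Structure M] [LinearOrder M] : Prop :=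
  Nonempty M ∧ DenselyOrdered M ∧ NoMinOrder M ∧ NoMaxOrder M ∧
  Set.Definable (∅ : Set M) L {v : Fin 2 → M | v 0 < v 1} ∧
  ∀ s : Set M, Set.Definable₁ (Set.univ : Set M) L s →
    ∃ F : Finset (Set M), s = ⋃₀ (F : Set (Set M)) ∧
      ∀ t ∈ F, (∃ a : M, t = {a}) ∨ (∃ a b : M, t = Set.Ioo a b) ∨
        (∃ a : M, t = Set.Ioi a) ∨ (∃ a : M, t = Set.Iio a) ∨ t = Set.univ

/-- The fiber over `u` of a set `D ⊆ M^{m+n}`, i.e. the set `φ(u, M^n)`. -/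
def famFiber {M : Type*} {m n : ℕ} (D : Set (Fin m ⊕ Fin n → M)) (u : Fin m → M) :
    Set (Fin n → M) :=
  {v | Sum.elim u v ∈ D}

/-- An `A`-definable family of subsets of `M^n`: the family of fibers `φ(u, M^n)` for `u`
ranging over an `A`-definable index set `Ω`, where `φ` is `A`-definable. -/
def IsDefFamily (L : FirstOrder.Language) {M : Type*} [L.Structure M] (A : Set M) (n : ℕ)
    (S : Set (Set (Fin n → M))) : Prop :=
  ∃ (m : ℕ) (Ω : Set (Fin m → M)) (D : Set (Fin m ⊕ Fin n → M)),
    Set.Definable A L Ω ∧ Set.Definable A L D ∧ S = famFiber D '' Ω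

/-- A family of sets is downward directed: it does not contain `∅` and any two members
contain a common member. -/
def DirectedFam {α : Type*} (S : Set (Set α)) : Prop :=
  ∅ ∉ S ∧ ∀ X ∈ S, ∀ Y ∈ S, ∃ Z ∈ S, Z ⊆ X ∩ Y

/-- `S` is finer than `F`: every member of `F` contains a member of `S`. -/
def FinerThan {α : Type*} (S F : Set (Set α)) : Prop :=
  ∀ X ∈ F, ∃ Y ∈ S, Y ⊆ X

/-- A (complete) `n`-type over `M`: an ultrafilter on the Boolean algebra of definable
subsets of `M^n`. -/
def IsTypeOn (L : FirstOrder.Language) {M : Type*} [L.Structure M] (n : ℕ)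
    (p : Set (Set (Fin n → M))) : Prop :=
  (∀ X ∈ p, Set.Definable (Set.univ : Set M) L X) ∧
  ∅ ∉ p ∧
  (∀ X ∈ p, ∀ Y ∈ p, X ∩ Y ∈ p) ∧
  (∀ X ∈ p, ∀ Y : Set (Fin n → M), Set.Definable (Set.univ : Set M) L Y → X ⊆ Y → Y ∈ p) ∧
  (∀ X : Set (Fin n → M), Set.Definable (Set.univ : Set M) L X → X ∈ p ∨ Xᶜ ∈ p)

/-- A type `p` is `A`-definable if for every `∅`-definable `D ⊆ M^{m+n}` the set of
parameters `u` with `φ(u, M^n) ∈ p` is `A`-definable. -/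
def IsDefTypeOver (L : FirstOrder.Language) {M : Type*} [L.Structure M] (A : Set M) (n : ℕ)
    (p : Set (Set (Fin n → M))) : Prop :=
  ∀ (m : ℕ) (D : Set (Fin m ⊕ Fin n → M)), Set.Definable (∅ : Set M) L D →
    Set.Definable A L {u : Fin m → M | famFiber D u ∈ p}

/-- A family `F` is complete for a family `X` if each member of `X` either contains a member
of `F` or is disjoint from one. -/
def CompleteFor {α : Type*} (F X : Set (Set α)) : Prop :=
  ∀ Y ∈ X, ∃ Z ∈ F, Z ⊆ Y ∨ Z ∩ Y = ∅

/-- A family of subsets of `M^n` is complete if it decides every definable set. -/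
def IsCompleteFam (L : FirstOrder.Language) {M : Type*} [L.Structure M] (n : ℕ)
    (S : Set (Set (Fin n → M))) : Prop :=
  ∀ X : Set (Fin n → M), Set.Definable (Set.univ : Set M) L X → ∃ Z ∈ S, Z ⊆ X ∨ Z ∩ X = ∅

/-- `B` is a basis for the type `p`: a downward directed subfamily generating `p`. -/
def IsBasisOfType {α : Type*} (B p : Set (Set α)) : Prop :=
  B ⊆ p ∧ DirectedFam B ∧ ∀ Y ∈ p, ∃ Z ∈ B, Z ⊆ Y

/-- `p` has an `A`-definable basis. -/
def HasDefBasis (L : FirstOrder.Language) {M : Type*} [L.Structure M] (A : Set M) (n : ℕ)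
    (p : Set (Set (Fin n → M))) : Prop :=
  ∃ B, IsDefFamily L A n B ∧ IsBasisOfType B p

/-- `S` has a finite tame transversal: it is covered by finitely many subfamilies, each of
which extends to a definable type. -/
def HasFTT (L : FirstOrder.Language) {M : Type*} [L.Structure M] (n : ℕ)
    (S : Set (Set (Fin n → M))) : Prop :=
  ∃ (N : ℕ) (p : Fin N → Set (Set (Fin n → M))),
    (∀ i, IsTypeOn L n (p i) ∧ IsDefTypeOver L (Set.univ : Set M) n (p i)) ∧
    ∀ X ∈ S, ∃ i, X ∈ p i

/-- The `(m,n)`-property: among any `m` members of the family, some `n` have nonempty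
intersection. -/
def HasMNProperty {α : Type*} (S : Set (Set α)) (m n : ℕ) : Prop :=
  ∀ F : Finset (Set α), ↑F ⊆ S → F.card = m →
    ∃ G ⊆ F, G.card = n ∧ (⋂₀ (G : Set (Set α))).Nonempty

/-- The o-minimal dimension of `X ⊆ M^k`: the largest `d` such that the image of `X` under some
coordinate projection `M^k → M^d` has nonempty interior in the product of the order topology. -/
noncomputable def oDim {M : Type*} [LinearOrder M] {k : ℕ} (X : Set (Fin k → M)) : ℕ :=
  letI : TopologicalSpace M := Preorder.topology M
  sSup {d : ℕ | ∃ ι : Fin d → Fin k, Function.Injective ι ∧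
    (interior ((fun v : Fin k → M => v ∘ ι) '' X)).Nonempty}

universe u

set_option linter.unusedSectionVars false
set_option linter.unusedVariables false



/-- Abstract o-minimal structure on `M`: a system of definable sets. -/
class OM (M : Type u) [LinearOrder M] where
  Df : ∀ {ι : Type} [Finite ι], Set (ι → M) → Prop
  inter' : ∀ {ι : Type} [Finite ι] {s t : Set (ι → M)}, Df s → Df t → Df (s ∩ t)
  compl' : ∀ {ι : Type} [Finite ι] {s : Set (ι → M)}, Df s → Df sᶜ
  pre' : ∀ {ι κ : Type} [Finite ι] [Finite κ] (f : ι → κ) {s : Set (ι → M)}, Df s →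
    Df ((fun g : κ → M => g ∘ f) ⁻¹' s)
  ex' : ∀ {ι κ : Type} [Finite ι] [Finite κ] {s : Set (ι ⊕ κ → M)}, Df s →
    Df {v : ι → M | ∃ w : κ → M, Sum.elim v w ∈ s}
  const' : ∀ c : M, Df {v : Fin 1 → M | v 0 = c}
  diag' : Df {v : Fin 2 → M | v 0 = v 1}
  lt' : Df {v : Fin 2 → M | v 0 < v 1}
  ne' : Nonempty M
  dense' : DenselyOrdered M
  nomin' : NoMinOrder M
  nomax' : NoMaxOrder M
  omin' : ∀ s : Set M, Df {v : Fin 1 → M | v 0 ∈ s} →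
    ∃ F : Finset (Set M), s = ⋃₀ (F : Set (Set M)) ∧
      ∀ t ∈ F, (∃ a : M, t = {a}) ∨ (∃ a b : M, t = Set.Ioo a b) ∨
        (∃ a : M, t = Set.Ioi a) ∨ (∃ a : M, t = Set.Iio a) ∨ t = Set.univ

/-- `X` is (identified with) a finite power of `M`. -/
class Sp (M : Type u) (X : Type u) where
  ι : Type
  fin : Finite ι
  e : X ≃ (ι → M)

namespace OM

variable {M : Type u} [LinearOrder M] [OM M]

instance : Nonempty M := OM.ne'
instance : DenselyOrdered M := OM.dense'
instance : NoMinOrder M := OM.nomin'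
instance : NoMaxOrder M := OM.nomax'

end OM

attribute [instance] Sp.fin

instance Sp.self (M : Type u) : Sp M M where
  ι := Fin 1
  fin := inferInstance
  e := (Equiv.funUnique (Fin 1) M).symm

instance Sp.dual (M P : Type u) [Sp M P] : Sp M Pᵒᵈ where
  ι := Sp.ι M P
  fin := inferInstance
  e := OrderDual.ofDual.trans Sp.e

instance Sp.punit (M : Type u) : Sp M PUnit.{u+1} where
  ι := Empty
  fin := inferInstance
  e := (Equiv.ofUnique PUnit (Empty → M))

instance Sp.prod (M : Type u) (X Y : Type u) [Sp M X] [Sp M Y] : Sp M (X × Y) where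
  ι := Sp.ι M X ⊕ Sp.ι M Y
  fin := inferInstance
  e := (Equiv.prodCongr Sp.e Sp.e).trans (Equiv.sumArrowEquivProdArrow _ _ _).symm

instance Sp.pi (M : Type u) (n : ℕ) (X : Type u) [Sp M X] : Sp M (Fin n → X) where
  ι := Fin n × Sp.ι M X
  fin := inferInstance
  e := (Equiv.piCongrRight (fun _ => Sp.e (M := M))).trans (Equiv.curry (Fin n) (Sp.ι M X) M).symm

section
variable (M : Type u) [LinearOrder M] [OM M]
variable {X Y Z W : Type u} [Sp M X] [Sp M Y] [Sp M Z] [Sp M W]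

/-- A definable predicate. -/
def DP (P : X → Prop) : Prop := OM.Df {v : Sp.ι M X → M | P (Sp.e.symm v)}

/-- A definable map. -/
def DM (f : X → Y) : Prop := DP M (fun p : X × Y => f p.1 = p.2)

variable {M}

theorem DP.and {P Q : X → Prop} (hP : DP M P) (hQ : DP M Q) : DP M (fun x => P x ∧ Q x) :=
  OM.inter' hP hQ
theorem DP.not {P : X → Prop} (hP : DP M P) : DP M (fun x => ¬ P x) := OM.compl' hP
theorem DP.or {P Q : X → Prop} (hP : DP M P) (hQ : DP M Q) : DP M (fun x => P x ∨ Q x) := by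
  have := (hP.not.and hQ.not).not
  simpa only [← not_or, not_not] using this
theorem DP.imp {P Q : X → Prop} (hP : DP M P) (hQ : DP M Q) : DP M (fun x => P x → Q x) := by
  have := hP.not.or hQ
  simpa only [← imp_iff_not_or] using this
theorem DP.iff {P Q : X → Prop} (hP : DP M P) (hQ : DP M Q) : DP M (fun x => P x ↔ Q x) := by
  have := (hP.imp hQ).and (hQ.imp hP)
  simpa only [← iff_iff_implies_and_implies] using this
theorem DP.ex {P : X × Y → Prop} (hP : DP M P) : DP M (fun x => ∃ y, P (x, y)) := by
  have := OM.ex' hP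
  unfold DP
  convert this using 1
  ext v
  constructor
  · rintro ⟨y, hy⟩
    refine ⟨Sp.e y, ?_⟩
    refine (congrArg P ?_).mp hy
    refine Prod.ext rfl ?_
    exact ((Sp.e (M := M)).symm_apply_apply y).symm
  · rintro ⟨w, hw⟩
    refine ⟨Sp.e.symm w, ?_⟩
    exact hw
theorem DP.ex2 {P : X → Y → Prop} (hP : DP M (fun p : X × Y => P p.1 p.2)) :
    DP M (fun x => ∃ y, P x y) := DP.ex hP
theorem DP.all2 {P : X → Y → Prop} (hP : DP M (fun p : X × Y => P p.1 p.2)) :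
    DP M (fun x => ∀ y, P x y) := by
  have := (DP.ex2 (P := fun x y => ¬ P x y) hP.not).not
  simpa only [not_exists, not_not] using this
theorem DP.true : DP M (fun _ : X => True) := by
  have : DP M (fun p : X => True) := by
    have h0 := OM.pre' (M := M) (ι := Fin 2) (κ := Fin 1) (fun _ => 0) OM.diag'
    have h1 := OM.ex' (OM.pre' (M := M) (ι := Fin 1) (κ := Sp.ι M X ⊕ Fin 1) (Sum.inr) h0)
    unfold DP
    convert h1 using 1
    ext v
    simp
  exact this
theorem DP.false : DP M (fun _ : X => False) := by
  simpa using (DP.true (M := M) (X := X)).not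
theorem DP.const (p : Prop) : DP M (fun _ : X => p) := by
  by_cases h : p
  · simpa [h] using DP.true
  · simpa [h] using DP.false
theorem DP.congr {P Q : X → Prop} (hP : DP M P) (h : ∀ x, Q x ↔ P x) : DP M Q := by
  have : Q = P := funext fun x => propext (h x)
  rwa [this]
theorem DP.finAll {κ : Type*} [Finite κ] {P : κ → X → Prop} (h : ∀ i, DP M (P i)) :
    DP M (fun x => ∀ i, P i x) := by
  classical
  have := Fintype.ofFinite κ
  have key : ∀ s : Finset κ, DP M (fun x => ∀ i ∈ s, P i x) := by
    intro s
    induction s using Finset.induction_on with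
    | empty => simpa using DP.true
    | insert a s _ ih =>
      simpa only [Finset.forall_mem_insert] using (h a).and ih
  simpa using key Finset.univ
theorem DP.finEx {κ : Type*} [Finite κ] {P : κ → X → Prop} (h : ∀ i, DP M (P i)) :
    DP M (fun x => ∃ i, P i x) := by
  have := (DP.finAll (fun i => (h i).not)).not
  simpa using this

theorem DP.fst {P : X → Prop} (hP : DP M P) : DP M (fun p : X × Y => P p.1) := by
  have := OM.pre' (κ := Sp.ι M X ⊕ Sp.ι M Y) Sum.inl hP
  exact this
theorem DP.snd {P : Y → Prop} (hP : DP M P) : DP M (fun p : X × Y => P p.2) := by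
  have := OM.pre' (κ := Sp.ι M X ⊕ Sp.ι M Y) Sum.inr hP
  exact this
theorem DP.eq' : DP M (fun p : X × X => p.1 = p.2) := by
  have : ∀ i : Sp.ι M X, DP M (fun p : X × X => Sp.e p.1 i = Sp.e (M := M) p.2 i) := by
    intro i
    have := OM.pre' (M := M) (κ := Sp.ι M X ⊕ Sp.ι M X)
      (fun j : Fin 2 => if j = 0 then Sum.inl i else Sum.inr i) OM.diag'
    have h2 : ∀ v : Sp.ι M X ⊕ Sp.ι M X → M,
        (Sp.e (M := M) ((Sp.e (M := M) (X := X)).symm (v ∘ Sum.inl)) i =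
        Sp.e (M := M) ((Sp.e (M := M) (X := X)).symm (v ∘ Sum.inr)) i) =
        (v (Sum.inl i) = v (Sum.inr i)) := by
      intro v; simp
    refine (congrArg (OM.Df (M := M)) ?_).mp this
    exact congrArg Set.ofPred (funext fun v => (h2 v).symm)
  refine (DP.finAll this).congr ?_
  rintro ⟨x, y⟩
  rw [← funext_iff]
  simp
/-- map along coordinate maps. -/
theorem DP.comp {P : Y → Prop} (hP : DP M P) {f : X → Y} (hf : DM M f) :
    DP M (fun x => P (f x)) := by
  have : DP M (fun x => ∃ y, f x = y ∧ P y) :=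
    DP.ex2 (P := fun x y => f x = y ∧ P y) (hf.and hP.snd)
  exact this.congr fun x => by simp
theorem DP.pre {P : X → Prop} (hP : DP M P) {f : Y → X} (g : Sp.ι M X → Sp.ι M Y)
    (hg : ∀ y i, Sp.e (M := M) (f y) i = Sp.e y (g i)) : DP M (fun y => P (f y)) := by
  have := OM.pre' g hP
  unfold DP
  convert this using 1
  ext v
  simp only [mem_ofPred_eq, mem_preimage]
  have : f (Sp.e.symm v) = Sp.e.symm (v ∘ g) := by
    apply (Sp.e (M := M)).injective
    ext i
    simp [hg]
  rw [this]
theorem DM.id : DM M (fun x : X => x) := DP.eq'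
theorem DM.fst' : DM M (fun p : X × Y => p.1) := by
  refine DP.pre (X := X × X) (P := fun p => p.1 = p.2) (f := fun p : (X × Y) × X => (p.1.1, p.2))
    DP.eq' (Sum.elim (fun i => Sum.inl (Sum.inl i)) Sum.inr) ?_
  rintro ⟨⟨x, y⟩, z⟩ (i | i) <;> simp [Sp.e, Equiv.sumArrowEquivProdArrow]
theorem DM.snd' : DM M (fun p : X × Y => p.2) := by
  refine DP.pre (X := Y × Y) (P := fun p => p.1 = p.2) (f := fun p : (X × Y) × Y => (p.1.2, p.2))
    DP.eq' (Sum.elim (fun i => Sum.inl (Sum.inr i)) Sum.inr) ?_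
  rintro ⟨⟨x, y⟩, z⟩ (i | i) <;> simp [Sp.e, Equiv.sumArrowEquivProdArrow]
theorem DM.const (c : Y) : DM M (fun _ : X => c) := by
  have : ∀ i : Sp.ι M Y, DP M (fun p : X × Y => Sp.e (M := M) p.2 i = Sp.e c i) := by
    intro i
    have := OM.pre' (M := M) (κ := Sp.ι M X ⊕ Sp.ι M Y)
      (fun j : Fin 1 => Sum.inr i) (OM.const' (Sp.e c i))
    have h2 : ∀ v : Sp.ι M X ⊕ Sp.ι M Y → M,
        (Sp.e (M := M) ((Sp.e (M := M) (X := Y)).symm (v ∘ Sum.inr)) i = Sp.e c i) =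
        (v (Sum.inr i) = Sp.e c i) := by
      intro v; simp
    refine (congrArg (OM.Df (M := M)) ?_).mp this
    exact congrArg Set.ofPred (funext fun v => (h2 v).symm)
  refine (DP.finAll this).congr ?_
  rintro ⟨x, y⟩
  rw [← funext_iff]
  simp [eq_comm]
theorem DM.comp {f : Y → Z} {g : X → Y} (hf : DM M f) (hg : DM M g) : DM M (fun x => f (g x)) := by
  have h1 : DP M (fun q : (X × Z) × Y => g q.1.1 = q.2) := by
    refine DP.pre (X := X × Y) (P := fun p => g p.1 = p.2)
      (f := fun p : (X × Z) × Y => (p.1.1, p.2))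
      hg (Sum.elim (fun i => Sum.inl (Sum.inl i)) Sum.inr) ?_
    rintro ⟨⟨x, y⟩, z⟩ (i | i) <;> simp [Sp.e, Equiv.sumArrowEquivProdArrow]
  have h2 : DP M (fun q : (X × Z) × Y => f q.2 = q.1.2) := by
    refine DP.pre (X := Y × Z) (P := fun p => f p.1 = p.2)
      (f := fun p : (X × Z) × Y => (p.2, p.1.2))
      hf (Sum.elim Sum.inr (fun i => Sum.inl (Sum.inr i))) ?_
    rintro ⟨⟨x, y⟩, z⟩ (i | i) <;> simp [Sp.e, Equiv.sumArrowEquivProdArrow]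
  refine (DP.ex (h1.and h2)).congr ?_
  rintro ⟨x, y⟩
  simp
theorem DM.fst {f : X → Y × Z} (hf : DM M f) : DM M (fun x => (f x).1) := DM.comp DM.fst' hf
theorem DM.snd {f : X → Y × Z} (hf : DM M f) : DM M (fun x => (f x).2) := DM.comp DM.snd' hf
theorem DM.pair {f : X → Y} {g : X → Z} (hf : DM M f) (hg : DM M g) :
    DM M (fun x => (f x, g x)) := by
  have h1 : DP M (fun q : X × (Y × Z) => f q.1 = q.2.1) := by
    refine DP.pre (X := X × Y) (P := fun p => f p.1 = p.2)
      (f := fun p : X × (Y × Z) => (p.1, p.2.1))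
      hf (Sum.elim (fun i => Sum.inl i) (fun i => Sum.inr (Sum.inl i))) ?_
    rintro ⟨x, ⟨y, z⟩⟩ (i | i) <;> simp [Sp.e, Equiv.sumArrowEquivProdArrow]
  have h2 : DP M (fun q : X × (Y × Z) => g q.1 = q.2.2) := by
    refine DP.pre (X := X × Z) (P := fun p => g p.1 = p.2)
      (f := fun p : X × (Y × Z) => (p.1, p.2.2))
      hg (Sum.elim (fun i => Sum.inl i) (fun i => Sum.inr (Sum.inr i))) ?_
    rintro ⟨x, ⟨y, z⟩⟩ (i | i) <;> simp [Sp.e, Equiv.sumArrowEquivProdArrow]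
  refine (h1.and h2).congr ?_
  rintro ⟨x, ⟨y, z⟩⟩
  simp
theorem DP.eq {f g : X → Y} (hf : DM M f) (hg : DM M g) : DP M (fun x => f x = g x) :=
  DP.comp (P := fun p : Y × Y => p.1 = p.2) DP.eq' (DM.pair hf hg)
theorem DP.lt {f g : X → M} (hf : DM M f) (hg : DM M g) : DP M (fun x => f x < g x) := by
  refine DP.comp (P := fun p : M × M => p.1 < p.2) ?_ (DM.pair hf hg)
  have := OM.pre' (M := M) (κ := Sp.ι M M ⊕ Sp.ι M M)
      (fun j : Fin 2 => if j = 0 then Sum.inl (0 : Fin 1) else Sum.inr (0 : Fin 1)) OM.lt'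
  exact this
theorem DP.le {f g : X → M} (hf : DM M f) (hg : DM M g) : DP M (fun x => f x ≤ g x) :=
  (DP.lt hg hf).not.congr fun x => by simp
theorem DM.ofDual {f : X → Yᵒᵈ} (hf : DM M f) : DM M (fun x => OrderDual.ofDual (f x)) := hf
theorem DM.toDual {f : X → Y} (hf : DM M f) : DM M (fun x => OrderDual.toDual (f x)) := hf
theorem DM.app {n : ℕ} {f : X → Fin n → Y} (hf : DM M f) (i : Fin n) : DM M (fun x => f x i) := by
  refine DM.comp (f := fun g : Fin n → Y => g i) ?_ hf
  refine DP.pre (X := Y × Y) (P := fun p => p.1 = p.2)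
    (f := fun p : (Fin n → Y) × Y => (p.1 i, p.2))
    DP.eq' (Sum.elim (fun j => Sum.inl (i, j)) Sum.inr) ?_
  rintro ⟨x, z⟩ (i | i) <;> simp [Sp.e, Equiv.sumArrowEquivProdArrow]
theorem DM.lam {n : ℕ} {f : Fin n → X → Y} (hf : ∀ i, DM M (f i)) :
    DM M (fun x => fun i => f i x) := by
  have : ∀ i, DP M (fun p : X × (Fin n → Y) => f i p.1 = p.2 i) := fun i =>
    DP.eq (DM.comp (hf i) DM.fst') (DM.app DM.snd' i)
  refine (DP.finAll this).congr ?_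
  rintro ⟨x, y⟩
  simp [funext_iff]
theorem DM.choose [Nonempty Y] {R : X × Y → Prop} (hR : DP M R)
    (hu : ∀ x y y', R (x, y) → R (x, y') → y = y') :
    ∃ f : X → Y, DM M f ∧ ∀ x y, R (x, y) → f x = y := by
  classical
  refine ⟨fun x => if h : ∃ y, R (x, y) then h.choose else Classical.arbitrary Y, ?_, ?_⟩
  · have h1 : DP M (fun p : X × Y => ∃ y, R (p.1, y)) :=
      DP.ex2 (DP.comp hR (DM.pair (DM.fst DM.fst') DM.snd'))
    have h2 : DP M (fun p : X × Y => R (p.1, p.2) ∨ (¬ (∃ y, R (p.1, y)) ∧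
      p.2 = Classical.arbitrary Y)) :=
      hR.or (h1.not.and (DP.eq DM.snd' (DM.const _)))
    refine h2.congr ?_
    rintro ⟨x, y⟩
    dsimp only
    split_ifs with h
    · have := h.choose_spec
      simp only [h, not_true_eq_false, false_and, or_false]
      exact ⟨fun h' => h' ▸ this, fun h' => hu _ _ _ this h'⟩
    · have : ¬ R (x, y) := fun h' => h ⟨y, h'⟩
      simp [h, this, eq_comm]
  · intro x y hxy
    have h : ∃ y, R (x, y) := ⟨y, hxy⟩
    simp only [h, dite_true]
    exact hu _ _ _ h.choose_spec hxy
end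
attribute [irreducible] DP DM

section tame
variable {P : Type u} [LinearOrder P]

/-- `S` holds just to the right of `x`. -/
def EvR (S : P → Prop) (x : P) : Prop := ∃ b, x < b ∧ ∀ y, x < y → y < b → S y
/-- `S` holds just to the left of `x`. -/
def EvL (S : P → Prop) (x : P) : Prop := ∃ b, b < x ∧ ∀ y, b < y → y < x → S y

theorem EvR.and {S T : P → Prop} {x : P} (h : EvR S x) (h' : EvR T x) :
    EvR (fun y => S y ∧ T y) x := by
  obtain ⟨b, hb, hS⟩ := h
  obtain ⟨c, hc, hT⟩ := h'
  exact ⟨min b c, lt_min hb hc, fun y h1 h2 => ⟨hS y h1 (h2.trans_le (min_le_left _ _)),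
    hT y h1 (h2.trans_le (min_le_right _ _))⟩⟩
theorem EvL.and {S T : P → Prop} {x : P} (h : EvL S x) (h' : EvL T x) :
    EvL (fun y => S y ∧ T y) x := by
  obtain ⟨b, hb, hS⟩ := h
  obtain ⟨c, hc, hT⟩ := h'
  exact ⟨max b c, max_lt hb hc, fun y h1 h2 => ⟨hS y ((le_max_left _ _).trans_lt h1) h2,
    hT y ((le_max_right _ _).trans_lt h1) h2⟩⟩
theorem EvR.mono {S T : P → Prop} {x : P} (h : EvR S x) (h' : ∀ y, x < y → S y → T y) : EvR T x := by
  obtain ⟨b, hb, hS⟩ := h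
  exact ⟨b, hb, fun y h1 h2 => h' y h1 (hS y h1 h2)⟩
theorem EvL.mono {S T : P → Prop} {x : P} (h : EvL S x) (h' : ∀ y, y < x → S y → T y) : EvL T x := by
  obtain ⟨b, hb, hS⟩ := h
  exact ⟨b, hb, fun y h1 h2 => h' y h2 (hS y h1 h2)⟩
theorem EvR.lt {x b : P} (h : x < b) : EvR (fun y => y < b) x := ⟨b, h, fun _ _ h => h⟩
theorem EvL.gt {x b : P} (h : b < x) : EvL (fun y => b < y) x := ⟨b, h, fun _ h _ => h⟩
theorem EvR.of_forall [NoMaxOrder P] {S : P → Prop} {x : P} (h : ∀ y, x < y → S y) : EvR S x := by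
  obtain ⟨b, hb⟩ := exists_gt x
  exact ⟨b, hb, fun y h1 _ => h y h1⟩
theorem EvL.of_forall [NoMinOrder P] {S : P → Prop} {x : P} (h : ∀ y, y < x → S y) : EvL S x := by
  obtain ⟨b, hb⟩ := exists_lt x
  exact ⟨b, hb, fun y _ h1 => h y h1⟩
theorem EvR.ex [DenselyOrdered P] {S : P → Prop} {x : P} (h : EvR S x) : ∃ y, x < y ∧ S y := by
  obtain ⟨b, hb, hS⟩ := h
  obtain ⟨c, h1, h2⟩ := exists_between hb
  exact ⟨c, h1, hS c h1 h2⟩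
theorem EvL.ex [DenselyOrdered P] {S : P → Prop} {x : P} (h : EvL S x) : ∃ y, y < x ∧ S y := by
  obtain ⟨b, hb, hS⟩ := h
  obtain ⟨c, h1, h2⟩ := exists_between hb
  exact ⟨c, h2, hS c h1 h2⟩

/-- Tame subsets of a line. -/
structure Tame (S : P → Prop) : Prop where
  inf : {x | S x}.Infinite → ∃ a b, a < b ∧ ∀ x, a < x → x < b → S x
  right : ∀ x, EvR S x ∨ EvR (fun y => ¬ S y) x
  left : ∀ x, EvL S x ∨ EvL (fun y => ¬ S y) x
  top : ∃ b, (∀ y, b < y → S y) ∨ (∀ y, b < y → ¬ S y)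
  bot : ∃ b, (∀ y, y < b → S y) ∨ (∀ y, y < b → ¬ S y)
  lub : ∀ x, S x → ∀ b, (∀ y, S y → y ≤ b) → ∃ c, (∀ y, S y → y ≤ c) ∧ ∀ d, d < c → ∃ y, S y ∧ d < y
  glb : ∀ x, S x → ∀ b, (∀ y, S y → b ≤ y) → ∃ c, (∀ y, S y → c ≤ y) ∧ ∀ d, c < d → ∃ y, S y ∧ y < d

theorem Tame.dual {S : P → Prop} (h : Tame S) : Tame (P := Pᵒᵈ) (fun x => S (OrderDual.ofDual x)) where
  inf hi := by
    obtain ⟨a, b, hab, h⟩ := h.inf hi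
    exact ⟨OrderDual.toDual b, OrderDual.toDual a, hab, fun x h1 h2 => h _ h2 h1⟩
  right x := by
    rcases h.left (OrderDual.ofDual x) with ⟨b, hb, h⟩ | ⟨b, hb, h⟩
    · exact Or.inl ⟨b, hb, fun y h1 h2 => h _ h2 h1⟩
    · exact Or.inr ⟨b, hb, fun y h1 h2 => h _ h2 h1⟩
  left x := by
    rcases h.right (OrderDual.ofDual x) with ⟨b, hb, h⟩ | ⟨b, hb, h⟩
    · exact Or.inl ⟨b, hb, fun y h1 h2 => h _ h2 h1⟩
    · exact Or.inr ⟨b, hb, fun y h1 h2 => h _ h2 h1⟩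
  top := h.bot
  bot := h.top
  lub x hx b hb := h.glb x hx b hb
  glb x hx b hb := h.lub x hx b hb

theorem Tame.union [Nonempty P] {S T : P → Prop} (h : Tame S) (h' : Tame T) : Tame (fun x => S x ∨ T x) where
  inf hi := by
    have : {x | S x ∨ T x} = {x | S x} ∪ {x | T x} := rfl
    rw [this, Set.infinite_union] at hi
    rcases hi with hi | hi
    · obtain ⟨a, b, hab, h⟩ := h.inf hi
      exact ⟨a, b, hab, fun x h1 h2 => Or.inl (h x h1 h2)⟩
    · obtain ⟨a, b, hab, h⟩ := h'.inf hi
      exact ⟨a, b, hab, fun x h1 h2 => Or.inr (h x h1 h2)⟩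
  right x := by
    rcases h.right x with h1 | h1
    · exact Or.inl (h1.mono fun _ _ h => Or.inl h)
    · rcases h'.right x with h2 | h2
      · exact Or.inl (h2.mono fun _ _ h => Or.inr h)
      · exact Or.inr ((h1.and h2).mono fun _ _ h => by tauto)
  left x := by
    rcases h.left x with h1 | h1
    · exact Or.inl (h1.mono fun _ _ h => Or.inl h)
    · rcases h'.left x with h2 | h2
      · exact Or.inl (h2.mono fun _ _ h => Or.inr h)
      · exact Or.inr ((h1.and h2).mono fun _ _ h => by tauto)
  top := by
    obtain ⟨b, hb⟩ := h.top
    obtain ⟨c, hc⟩ := h'.top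
    refine ⟨max b c, ?_⟩
    rcases hb with hb | hb
    · exact Or.inl fun y hy => Or.inl (hb y ((le_max_left _ _).trans_lt hy))
    · rcases hc with hc | hc
      · exact Or.inl fun y hy => Or.inr (hc y ((le_max_right _ _).trans_lt hy))
      · refine Or.inr fun y hy => ?_
        have := hb y ((le_max_left _ _).trans_lt hy)
        have := hc y ((le_max_right _ _).trans_lt hy)
        tauto
  bot := by
    obtain ⟨b, hb⟩ := h.bot
    obtain ⟨c, hc⟩ := h'.bot
    refine ⟨min b c, ?_⟩
    rcases hb with hb | hb
    · exact Or.inl fun y hy => Or.inl (hb y (hy.trans_le (min_le_left _ _)))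
    · rcases hc with hc | hc
      · exact Or.inl fun y hy => Or.inr (hc y (hy.trans_le (min_le_right _ _)))
      · refine Or.inr fun y hy => ?_
        have := hb y (hy.trans_le (min_le_left _ _))
        have := hc y (hy.trans_le (min_le_right _ _))
        tauto
  lub x hx b hb := by
    by_cases hS : ∃ x, S x
    · by_cases hT : ∃ x, T x
      · obtain ⟨x, hx⟩ := hS
        obtain ⟨z, hz⟩ := hT
        obtain ⟨c, hc, hc'⟩ := h.lub x hx b (fun y hy => hb y (Or.inl hy))
        obtain ⟨d, hd, hd'⟩ := h'.lub z hz b (fun y hy => hb y (Or.inr hy))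
        rcases le_total c d with hcd | hcd
        · refine ⟨d, ?_, ?_⟩
          · rintro y (hy | hy)
            · exact (hc y hy).trans hcd
            · exact hd y hy
          · intro e he
            obtain ⟨y, hy, h⟩ := hd' e he
            exact ⟨y, Or.inr hy, h⟩
        · refine ⟨c, ?_, ?_⟩
          · rintro y (hy | hy)
            · exact hc y hy
            · exact (hd y hy).trans hcd
          · intro e he
            obtain ⟨y, hy, h⟩ := hc' e he
            exact ⟨y, Or.inl hy, h⟩
      · have hT : ∀ x, T x ↔ False := by simpa using hT
        simp only [hT, or_false] at *
        exact h.lub x hx b hb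
    · have hS : ∀ x, S x ↔ False := by simpa using hS
      simp only [hS, false_or] at *
      exact h'.lub x hx b hb
  glb x hx b hb := by
    by_cases hS : ∃ x, S x
    · by_cases hT : ∃ x, T x
      · obtain ⟨x, hx⟩ := hS
        obtain ⟨z, hz⟩ := hT
        obtain ⟨c, hc, hc'⟩ := h.glb x hx b (fun y hy => hb y (Or.inl hy))
        obtain ⟨d, hd, hd'⟩ := h'.glb z hz b (fun y hy => hb y (Or.inr hy))
        rcases le_total d c with hcd | hcd
        · refine ⟨d, ?_, ?_⟩
          · rintro y (hy | hy)
            · exact hcd.trans (hc y hy)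
            · exact hd y hy
          · intro e he
            obtain ⟨y, hy, h⟩ := hd' e he
            exact ⟨y, Or.inr hy, h⟩
        · refine ⟨c, ?_, ?_⟩
          · rintro y (hy | hy)
            · exact hc y hy
            · exact hcd.trans (hd y hy)
          · intro e he
            obtain ⟨y, hy, h⟩ := hc' e he
            exact ⟨y, Or.inl hy, h⟩
      · have hT : ∀ x, T x ↔ False := by simpa using hT
        simp only [hT, or_false] at *
        exact h.glb x hx b hb
    · have hS : ∀ x, S x ↔ False := by simpa using hS
      simp only [hS, false_or] at *
      exact h'.glb x hx b hb

variable [DenselyOrdered P] [NoMaxOrder P] [NoMinOrder P] [Nonempty P]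

theorem Tame.empty : Tame (fun _ : P => False) where
  inf h := by simp at h
  right x := Or.inr (EvR.of_forall (by simp))
  left x := Or.inr (EvL.of_forall (by simp))
  top := ⟨Classical.arbitrary P, by simp⟩
  bot := ⟨Classical.arbitrary P, by simp⟩
  lub x hx := hx.elim
  glb x hx := hx.elim
theorem Tame.univ : Tame (fun _ : P => True) where
  inf h := by
    obtain ⟨b, hb⟩ := exists_gt (Classical.arbitrary P)
    exact ⟨_, b, hb, by simp⟩
  right x := Or.inl (EvR.of_forall (by simp))
  left x := Or.inl (EvL.of_forall (by simp))
  top := ⟨Classical.arbitrary P, by simp⟩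
  bot := ⟨Classical.arbitrary P, by simp⟩
  lub x _ b hb := by
    obtain ⟨c, hc⟩ := exists_gt b
    exact absurd (hb c trivial) (not_le.2 hc)
  glb x _ b hb := by
    obtain ⟨c, hc⟩ := exists_lt b
    exact absurd (hb c trivial) (not_le.2 hc)
theorem Tame.point (a : P) : Tame (fun x => x = a) where
  inf h := by simp at h
  right x := by
    right
    rcases lt_or_ge x a with h | h
    · exact ⟨a, h, fun y _ h => h.ne⟩
    · exact EvR.of_forall fun y hy => (h.trans_lt hy).ne'
  left x := by
    right
    rcases lt_or_ge a x with h | h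
    · exact ⟨a, h, fun y h _ => h.ne'⟩
    · exact EvL.of_forall fun y hy => (hy.trans_le h).ne
  top := ⟨a, Or.inr fun y h => h.ne'⟩
  bot := ⟨a, Or.inr fun y h => h.ne⟩
  lub x _ b _ := ⟨a, fun y h => h.le, fun d hd => ⟨a, rfl, hd⟩⟩
  glb x _ b _ := ⟨a, fun y h => h.ge, fun d hd => ⟨a, rfl, hd⟩⟩
theorem Tame.Ioi (a : P) : Tame (fun x => a < x) where
  inf h := by
    obtain ⟨b, hb⟩ := exists_gt a
    exact ⟨a, b, hb, fun x h _ => h⟩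
  right x := by
    rcases lt_or_ge x a with h | h
    · exact Or.inr ⟨a, h, fun y _ h => h.le.not_gt⟩
    · exact Or.inl (EvR.of_forall fun y hy => (h.trans_lt hy))
  left x := by
    rcases lt_or_ge a x with h | h
    · exact Or.inl ⟨a, h, fun y h _ => h⟩
    · exact Or.inr (EvL.of_forall fun y hy => (hy.trans_le h).le.not_gt)
  top := ⟨a, Or.inl fun y h => h⟩
  bot := ⟨a, Or.inr fun y h => h.le.not_gt⟩
  lub x hx b hb := by
    obtain ⟨c, hc⟩ := exists_gt (max a b)
    exact absurd (hb c ((le_max_left _ _).trans_lt hc)) (not_le.2 ((le_max_right _ _).trans_lt hc))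
  glb x hx b hb := ⟨a, fun y h => h.le, fun d hd => by
    obtain ⟨c, h1, h2⟩ := exists_between hd
    exact ⟨c, h1, h2⟩⟩
theorem Tame.Iio (a : P) : Tame (fun x => x < a) := (Tame.Ioi (P := Pᵒᵈ) (OrderDual.toDual a)).dual
theorem Tame.Ioo (a b : P) : Tame (fun x => a < x ∧ x < b) := by
  by_cases hab : a < b
  swap
  · convert Tame.empty (P := P) using 2
    simp only [iff_false, not_and]
    exact fun h h' => hab (h.trans h')
  have h1 := Tame.Ioi a
  have h2 := Tame.Iio b
  refine ⟨fun _ => ⟨a, b, hab, fun x h h' => ⟨h, h'⟩⟩, fun x => ?_, fun x => ?_, ?_, ?_, ?_, ?_⟩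
  · rcases h1.right x with h | h
    · rcases h2.right x with h' | h'
      · exact Or.inl (h.and h')
      · exact Or.inr (h'.mono fun _ _ h => by tauto)
    · exact Or.inr (h.mono fun _ _ h => by tauto)
  · rcases h1.left x with h | h
    · rcases h2.left x with h' | h'
      · exact Or.inl (h.and h')
      · exact Or.inr (h'.mono fun _ _ h => by tauto)
    · exact Or.inr (h.mono fun _ _ h => by tauto)
  · exact ⟨b, Or.inr fun y h h' => h.not_gt h'.2⟩
  · exact ⟨a, Or.inr fun y h h' => h.not_gt h'.1⟩
  · intro x hx _ _
    refine ⟨b, fun y h => h.2.le, fun d hd => ?_⟩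
    obtain ⟨c, h1, h2⟩ := exists_between (max_lt hd hab)
    exact ⟨c, ⟨(le_max_right _ _).trans_lt h1, h2⟩, (le_max_left _ _).trans_lt h1⟩
  · intro x hx _ _
    refine ⟨a, fun y h => h.1.le, fun d hd => ?_⟩
    obtain ⟨c, h1, h2⟩ := exists_between (lt_min hd hab)
    exact ⟨c, ⟨h1, h2.trans_le (min_le_right _ _)⟩, h2.trans_le (min_le_left _ _)⟩

end tame

/-- A definable o-minimal line. -/
class OLine (M : Type u) [LinearOrder M] [OM M] (P : Type u) [LinearOrder P] [Sp M P] : Prop where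
  lt : DP M (fun p : P × P => p.1 < p.2)
  ne : Nonempty P
  dense : DenselyOrdered P
  nomin : NoMinOrder P
  nomax : NoMaxOrder P
  tame : ∀ S : P → Prop, DP M S → Tame S

section
variable {M : Type u} [LinearOrder M] [OM M]
variable {X P : Type u} [Sp M X] [LinearOrder P] [Sp M P] [OLine M P]
theorem DP.olt {f g : X → P} (hf : DM M f) (hg : DM M g) :
    DP M (fun x => f x < g x) := DP.comp (P := fun p : P × P => p.1 < p.2) OLine.lt (DM.pair hf hg)
theorem DP.ole {f g : X → P} (hf : DM M f) (hg : DM M g) :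
    DP M (fun x => f x ≤ g x) := (DP.olt hg hf).not.congr fun x => by simp
end

theorem dfb {p : Prop} (h : p := by
  repeat' first
    | assumption
    | exact DM.id
    | with_reducible exact DP.const _
    | with_reducible exact DM.const _
    | with_reducible apply DM.fst
    | with_reducible apply DM.snd
    | with_reducible apply DM.pair
    | with_reducible apply DP.and
    | with_reducible apply DP.or
    | with_reducible apply DP.not
    | with_reducible apply DP.imp
    | with_reducible apply DP.iff
    | with_reducible apply DP.lt
    | with_reducible apply DP.le
    | with_reducible apply DP.olt
    | with_reducible apply DP.ole
    | with_reducible apply DP.eq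
    | with_reducible apply DP.ex2
    | with_reducible apply DP.all2
    | with_reducible apply DP.finAll
    | with_reducible apply DP.finEx
    | with_reducible apply DM.ofDual
    | with_reducible apply DM.toDual
    | (with_reducible apply DP.comp (by assumption))
    | (with_reducible apply DM.comp (by assumption))
    | with_reducible apply DM.app
    | with_reducible apply DM.lam
    | intro _) : p := h


section
variable {M : Type u} [LinearOrder M] [OM M]

theorem DP.df1 {S : M → Prop} (h : DP M S) : OM.Df {v : Fin 1 → M | v 0 ∈ {x | S x}} := by
  unfold DP at h
  exact h

instance OLine.self : OLine M M where
  lt := DP.lt DM.fst' DM.snd'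
  ne := inferInstance
  dense := inferInstance
  nomin := inferInstance
  nomax := inferInstance
  tame S hS := by
    obtain ⟨F, h1, h2⟩ := OM.omin' {x | S x} hS.df1
    have : S = fun x => ∃ t ∈ F, x ∈ t := by
      ext x
      have : x ∈ {x | S x} ↔ x ∈ ⋃₀ (F : Set (Set M)) := by rw [← h1]
      simpa using this
    rw [this]
    clear this h1
    classical
    induction F using Finset.induction_on with
    | empty => simpa using Tame.empty
    | insert t F ht ih =>
      simp only [Finset.exists_mem_insert]
      refine Tame.union ?_ (ih fun t h => h2 t (Finset.mem_insert_of_mem h))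
      rcases h2 t (Finset.mem_insert_self _ _) with ⟨a, rfl⟩ | ⟨a, b, rfl⟩ | ⟨a, rfl⟩ | ⟨a, rfl⟩ | rfl
      · exact Tame.point a
      · exact Tame.Ioo a b
      · exact Tame.Ioi a
      · exact Tame.Iio a
      · exact Tame.univ

instance OLine.dual {P : Type u} [LinearOrder P] [Sp M P] [OLine M P] : OLine M Pᵒᵈ where
  lt := by
    have : DP M (fun p : Pᵒᵈ × Pᵒᵈ => OrderDual.ofDual p.2 < OrderDual.ofDual p.1) := dfb
    exact this
  ne := (OLine.ne M (P := P) : Nonempty P)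
  dense := have := OLine.dense M (P := P); inferInstance
  nomin := have := OLine.nomax M (P := P); inferInstance
  nomax := have := OLine.nomin M (P := P); inferInstance
  tame S hS := by
    have : DP M (fun x : P => S (OrderDual.toDual x)) := dfb
    exact (OLine.tame (M := M) _ this).dual
end

section
variable {M : Type u} [LinearOrder M] [OM M]
variable {X Y : Type u} [Sp M X] [Sp M Y]
variable {P N : Type u} [LinearOrder P] [Sp M P] [OLine M P] [LinearOrder N] [Sp M N] [OLine M N]

theorem strictLocalMax_half {f : P → N} (hf : DM M f) {a b : P} (hab : a < b)
    (h : ∀ x, a < x → x < b → EvL (fun y => f y < f x) x ∧ EvR (fun y => f y < f x) x) :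
    ∃ c, a ≤ c ∧ c < b ∧ ∀ z, c < z → z < b → ∃ x,
      EvL (fun y => f y < f x) z ∧ EvR (fun y => f x ≤ f y) z := by
  have := OLine.dense M (P := P)
  have := OLine.nomax M (P := P)
  have := OLine.nomin M (P := P)
  -- first shrink
  obtain ⟨a, haa, hab, hB⟩ : ∃ a', a ≤ a' ∧ a' < b ∧ ∀ x, a' < x → x < b → ∃ y, x < y ∧ y < b ∧ f x ≤ f y := by
    have hB : DP M (fun x => ∀ y, x < y → y < b → f y < f x) := dfb
    rcases (OLine.tame _ hB).left b with h1 | h1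
    · exfalso
      obtain ⟨x, hx, hx1, hx2⟩ := ((h1.and (EvL.gt hab)).and h1).ex
      obtain ⟨c, hc, h1⟩ := h1
      obtain ⟨x, hx1, hx2⟩ := exists_between (max_lt hab hc)
      obtain ⟨y, hy, hy1, hy2⟩ := ((h x ((le_max_left _ _).trans_lt hx1) hx2).1.and
        (EvL.gt hx1)).ex
      exact absurd (h1 y ((le_max_right _ _).trans_lt hy2) (hy.trans hx2) x hy hx2) (not_lt.2 hy1.le)
    · obtain ⟨c, hc, h1⟩ := h1
      refine ⟨max a c, le_max_left _ _, max_lt hab hc, fun x hx hx' => ?_⟩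
      have := h1 x ((le_max_right _ _).trans_lt hx) hx'
      push Not at this
      exact this
  replace h : ∀ x, a < x → x < b → EvL (fun y => f y < f x) x ∧ EvR (fun y => f y < f x) x :=
    fun x hx hx' => h x (haa.trans_lt hx) hx'
  have hS : ∀ x, a < x → x < b → EvL (fun y => f x ≤ f y) b := by
    intro x hax hxb
    have hd : DP M (fun y => f x ≤ f y) := dfb
    rcases (OLine.tame _ hd).left b with h1 | h1
    · exact h1
    exfalso
    obtain ⟨d, hd, h1⟩ := h1
    have hT : DP M (fun y => x ≤ y ∧ y < b ∧ f x ≤ f y) := dfb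
    obtain ⟨c, hc1, hc2⟩ := (OLine.tame _ hT).lub x ⟨le_rfl, hxb, le_rfl⟩ (max d x) (by
      rintro y ⟨h2, h3, h4⟩
      by_contra h5
      push Not at h5
      exact h1 y ((le_max_left _ _).trans_lt h5) h3 h4)
    have hxc : x ≤ c := hc1 x ⟨le_rfl, hxb, le_rfl⟩
    have hcb : c < b := by
      by_contra h5
      push Not at h5
      obtain ⟨y, ⟨hy1, hy2, hy3⟩, hy4⟩ := hc2 (max d x) ((max_lt hd hxb).trans_le h5)
      exact h1 y ((le_max_left _ _).trans_lt hy4) hy2 hy3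
    by_cases hfc : f x ≤ f c
    · obtain ⟨y, hy1, hy2, hy3⟩ := hB c (hax.trans_le hxc) hcb
      exact absurd (hc1 y ⟨hxc.trans hy1.le, hy2, hfc.trans hy3⟩) (not_le.2 hy1)
    · push Not at hfc
      obtain ⟨e, he, h2⟩ := (h c (hax.trans_le hxc) hcb).1
      obtain ⟨y, ⟨hy1, hy2, hy3⟩, hy4⟩ := hc2 e he
      rcases (hc1 y ⟨hy1, hy2, hy3⟩).lt_or_eq with h6 | h6
      · exact absurd (h2 y hy4 h6) (not_lt.2 (hfc.le.trans hy3))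
      · subst h6
        exact absurd hfc (not_lt.2 hy3)
  have hΨ : ∀ x, a < x → x < b → ∃ c, x < c ∧ c < b ∧ EvL (fun y => f y < f x) c ∧ EvR (fun y => f x ≤ f y) c := by
    intro x hax hxb
    obtain ⟨d, hd, hS⟩ := hS x hax hxb
    have hT : DP M (fun y => x < y ∧ y < b ∧ f y < f x) := dfb
    obtain ⟨x1, hx1, hx2, hx3⟩ := ((h x hax hxb).2.and (EvR.lt hxb)).ex
    obtain ⟨c, hc1, hc2⟩ := (OLine.tame _ hT).lub x1 ⟨hx1, hx3, hx2⟩ d (by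
      rintro y ⟨h2, h3, h4⟩
      by_contra h5
      push Not at h5
      exact absurd (hS y h5 h3) (not_le.2 h4))
    have hcx : x < c := hx1.trans_le (hc1 x1 ⟨hx1, hx3, hx2⟩)
    have hcb : c < b := by
      by_contra h5
      push Not at h5
      obtain ⟨y, ⟨hy1, hy2, hy3⟩, hy4⟩ := hc2 d (hd.trans_le h5)
      exact absurd (hS y hy4 hy2) (not_le.2 hy3)
    have hR : EvR (fun y => f x ≤ f y) c := by
      refine ⟨b, hcb, fun y h1 h2 => ?_⟩
      by_contra h3
      push Not at h3
      exact absurd (hc1 y ⟨hcx.trans h1, h2, h3⟩) (not_le.2 h1)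
    refine ⟨c, hcx, hcb, ?_, hR⟩
    have hd : DP M (fun y => f y < f x) := dfb
    rcases (OLine.tame _ hd).left c with h1 | ⟨e, he, h1⟩
    · exact h1
    exfalso
    obtain ⟨y, ⟨hy1, hy2, hy3⟩, hy4⟩ := hc2 e he
    rcases (hc1 y ⟨hy1, hy2, hy3⟩).lt_or_eq with h6 | h6
    · exact h1 y hy4 h6 hy3
    · subst h6
      obtain ⟨z, _, hz1, hz2⟩ := ((h y (hax.trans hcx) hcb).2.and hR).ex
      exact absurd (hz1.trans hy3) (not_lt.2 hz2)
  have hd : DP M (fun z => ∃ x, EvL (fun y => f y < f x) z ∧ EvR (fun y => f x ≤ f y) z) := by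
    unfold EvL EvR; exact dfb
  rcases (OLine.tame _ hd).left b with ⟨c, hc, h1⟩ | ⟨c, hc, h1⟩
  · exact ⟨max a c, haa.trans (le_max_left _ _), max_lt hab hc, fun z hz hz' => h1 z ((le_max_right _ _).trans_lt hz) hz'⟩
  · exfalso
    obtain ⟨x, hx1, hx2⟩ := exists_between (max_lt hab hc)
    obtain ⟨z, hz1, hz2, hz3⟩ := hΨ x ((le_max_left _ _).trans_lt hx1) hx2
    exact h1 z (((le_max_right _ _).trans_lt hx1).trans hz1) hz2 ⟨x, hz3⟩

theorem no_strictLocalMax {f : P → N} (hf : DM M f) {a b : P} (hab : a < b)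
    (h : ∀ x, a < x → x < b → EvL (fun y => f y < f x) x ∧ EvR (fun y => f y < f x) x) : False := by
  have := OLine.dense M (P := P)
  obtain ⟨c, hac, hcb, hc⟩ := strictLocalMax_half hf hab h
  have hd : DM M (fun x : Pᵒᵈ => f (OrderDual.ofDual x)) := dfb
  obtain ⟨d, hd1, hd2, hd⟩ := strictLocalMax_half hd (a := OrderDual.toDual b) (b := OrderDual.toDual c) hcb
    (by
      intro x hx1 hx2
      obtain ⟨⟨p, hp1, hp2⟩, ⟨q, hq1, hq2⟩⟩ := h (OrderDual.ofDual x) (hac.trans_lt hx2) hx1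
      exact ⟨⟨OrderDual.toDual q, hq1, fun y h1 h2 => hq2 (OrderDual.ofDual y) h2 h1⟩,
        ⟨OrderDual.toDual p, hp1, fun y h1 h2 => hp2 (OrderDual.ofDual y) h2 h1⟩⟩)
  have hcd : c < OrderDual.ofDual d := hd2
  have hdb : OrderDual.ofDual d ≤ b := hd1
  obtain ⟨z, hz1, hz2⟩ := exists_between hcd
  obtain ⟨x, hxL, hxR⟩ := hc z hz1 (hz2.trans_le hdb)
  obtain ⟨x', ⟨p, hp1, hp2⟩, ⟨q, hq1, hq2⟩⟩ := hd (OrderDual.toDual z) hz2 hz1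
  have hL' : EvL (fun y => f (OrderDual.ofDual x') ≤ f y) z := ⟨q, hq1, fun y h1 h2 => hq2 y h2 h1⟩
  have hR' : EvR (fun y => f y < f (OrderDual.ofDual x')) z := ⟨p, hp1, fun y h1 h2 => hp2 y h2 h1⟩
  obtain ⟨y, _, h1, h2⟩ := (hxL.and hL').ex
  obtain ⟨w, _, h3, h4⟩ := (hxR.and hR').ex
  exact absurd (h2.trans_lt h1) (not_lt.2 (h3.trans h4.le))

/-- contains an interval -/
def Big (S : P → Prop) : Prop := ∃ a b, a < b ∧ ∀ x, a < x → x < b → S x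

theorem Big.mono {S T : P → Prop} (h : Big S) (h' : ∀ x, S x → T x) : Big T := by
  obtain ⟨a, b, hab, h⟩ := h
  exact ⟨a, b, hab, fun x h1 h2 => h' x (h x h1 h2)⟩
theorem EvR.big {S : P → Prop} {x : P} (h : EvR S x) : Big S := by
  obtain ⟨b, hb, h⟩ := h
  exact ⟨x, b, hb, h⟩
theorem Big.or' {S T : P → Prop} (hS : DP M S) {a b : P} (hab : a < b)
    (h : ∀ x, a < x → x < b → S x ∨ T x) :
    ∃ a' b', a ≤ a' ∧ b' ≤ b ∧ a' < b' ∧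
      ((∀ x, a' < x → x < b' → S x) ∨ (∀ x, a' < x → x < b' → T x)) := by
  have := OLine.dense M (P := P)
  obtain ⟨x, hx1, hx2⟩ := exists_between hab
  rcases (OLine.tame S hS).right x with ⟨d, hd, h1⟩ | ⟨d, hd, h1⟩
  · exact ⟨x, min d b, hx1.le, min_le_right _ _, lt_min hd hx2, Or.inl fun y h2 h3 =>
      h1 y h2 (h3.trans_le (min_le_left _ _))⟩
  · exact ⟨x, min d b, hx1.le, min_le_right _ _, lt_min hd hx2, Or.inr fun y h2 h3 =>
      (h y (hx1.trans h2) (h3.trans_le (min_le_right _ _))).resolve_left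
      (h1 y h2 (h3.trans_le (min_le_left _ _)))⟩
theorem Big.or {S T : P → Prop} (hS : DP M S) (h : Big (fun x => S x ∨ T x)) : Big S ∨ Big T := by
  obtain ⟨a, b, hab, h⟩ := h
  obtain ⟨a', b', _, _, h1, h2⟩ := Big.or' hS hab h
  rcases h2 with h2 | h2
  · exact Or.inl ⟨a', b', h1, h2⟩
  · exact Or.inr ⟨a', b', h1, h2⟩
theorem Big.infinite [DenselyOrdered P] {S : P → Prop} (h : Big S) : {x | S x}.Infinite := by
  obtain ⟨a, b, hab, h⟩ := h
  exact (Set.Ioo_infinite hab).mono fun x hx => h x hx.1 hx.2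
theorem big_iff {S : P → Prop} (hS : DP M S) : Big S ↔ {x | S x}.Infinite :=
  have := OLine.dense M (P := P)
  ⟨fun h => h.infinite, fun h => (OLine.tame S hS).inf h⟩
theorem not_big {S : P → Prop} (hS : DP M S) : ¬ Big S ↔ {x | S x}.Finite := by
  rw [big_iff hS, Set.not_infinite]
theorem DP.big {R : X × P → Prop} (hR : DP M R) : DP M (fun x => Big (fun y => R (x, y))) := by
  unfold Big; exact dfb
theorem DP.big2 {R : X → P → Prop} (hR : DP M (fun p : X × P => R p.1 p.2)) :
    DP M (fun x => Big (fun y => R x y)) := DP.big hR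

theorem no_jump {f : P → N} (hf : DM M f) {a b : P} (hab : a < b)
    (h : ∀ x, a < x → x < b → ∃ y, y < f x ∧ EvR (fun z => f z < y) x) : False := by
  have := OLine.dense M (P := P)
  have := OLine.dense M (P := N)
  have htri : ∀ x, EvL (fun y => f y = f x) x ∨ EvL (fun y => f y < f x) x ∨
      EvL (fun y => f x < f y) x := by
    intro x
    have h1 : DP M (fun y => f y = f x) := dfb
    have h2 : DP M (fun y => f y < f x) := dfb
    rcases (OLine.tame _ h1).left x with h1 | h1
    · exact Or.inl h1
    rcases (OLine.tame _ h2).left x with h2 | h2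
    · exact Or.inr (Or.inl h2)
    · exact Or.inr (Or.inr ((h1.and h2).mono fun y _ h => lt_of_le_of_ne (not_lt.1 h.2) (Ne.symm h.1)))
  have hd1 : DP M (fun x => EvL (fun y => f y = f x) x) := by unfold EvL; exact dfb
  have hd2 : DP M (fun x => EvL (fun y => f y < f x) x) := by unfold EvL; exact dfb
  obtain ⟨a1, b1, ha1, hb1, hab1, h1 | h1⟩ := Big.or' hd1 hab (fun x _ _ => htri x)
  · obtain ⟨x, hx1, hx2⟩ := exists_between hab1
    obtain ⟨y, hy, hy'⟩ := h1 x hx1 hx2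
    obtain ⟨x1, hx3, hx4⟩ := exists_between (max_lt hy hx1)
    obtain ⟨w, hw, hw'⟩ := h x1 (ha1.trans_lt ((le_max_right _ _).trans_lt hx3)) (hx4.trans (hx2.trans_le hb1))
    obtain ⟨z, hz1, hz2, hz3⟩ := (hw'.and (EvR.lt hx4)).ex
    have e1 := hy' x1 ((le_max_left _ _).trans_lt hx3) hx4
    have e2 := hy' z (((le_max_left _ _).trans_lt hx3).trans hz1) hz3
    rw [e1] at hw
    rw [e2] at hz2
    exact absurd hw (not_lt.2 hz2.le)
  obtain ⟨a2, b2, ha2, hb2, hab2, h2 | h2⟩ := Big.or' hd2 hab1 h1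
  · refine no_strictLocalMax hf hab2 fun x hx1 hx2 => ⟨h2 x hx1 hx2, ?_⟩
    obtain ⟨y, hy, hy'⟩ := h x ((ha1.trans ha2).trans_lt hx1) (hx2.trans_le (hb2.trans hb1))
    exact hy'.mono fun z _ hz => hz.trans hy
  · have hr : ∀ x, a2 < x → x < b2 → EvR (fun y => f y < f x) x := fun x hx1 hx2 => by
      obtain ⟨y, hy, hy'⟩ := h x ((ha1.trans ha2).trans_lt hx1) (hx2.trans_le (hb2.trans hb1))
      exact hy'.mono fun z _ hz => hz.trans hy
    have hdec : ∀ x z, a2 < x → x < z → z < b2 → f z < f x := by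
      intro x z hx hxz hz
      by_contra hfz
      push Not at hfz
      have hd : DP M (fun z => x < z ∧ z < b2 ∧ f x ≤ f z) := dfb
      obtain ⟨e, he1, he2⟩ := (OLine.tame _ hd).glb z ⟨hxz, hz, hfz⟩ x (fun y hy => hy.1.le)
      obtain ⟨r, hr1, hr2⟩ := hr x hx (hxz.trans hz)
      have hxe : x < e := by
        refine lt_of_not_ge fun hex => ?_
        obtain ⟨y, ⟨hy1, hy2, hy3⟩, hy4⟩ := he2 r (hex.trans_lt hr1)
        exact absurd (hr2 y hy1 hy4) (not_lt.2 hy3)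
      have hez : e ≤ z := he1 z ⟨hxz, hz, hfz⟩
      have heb : e < b2 := hez.trans_lt hz
      by_cases hfe : f x ≤ f e
      · obtain ⟨y, hy1, hy2, hy3⟩ := ((h2 e (hx.trans hxe) heb).and (EvL.gt hxe)).ex
        exact absurd (he1 y ⟨hy3, hy1.trans heb, hfe.trans hy2.le⟩) (not_le.2 hy1)
      · push Not at hfe
        obtain ⟨r, hr1, hr2⟩ := hr e (hx.trans hxe) heb
        obtain ⟨y, ⟨hy1, hy2, hy3⟩, hy4⟩ := he2 r hr1
        rcases (he1 y ⟨hy1, hy2, hy3⟩).lt_or_eq with h6 | h6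
        · exact absurd ((hr2 y h6 hy4).trans hfe) (not_lt.2 hy3)
        · subst h6
          exact absurd hfe (not_lt.2 hy3)
    have hd : DP M (fun y => ∃ x, a2 < x ∧ x < b2 ∧ f x = y) := dfb
    have hinf : {y | ∃ x, a2 < x ∧ x < b2 ∧ f x = y}.Infinite := by
      have : Set.InjOn f (Set.Ioo a2 b2) := by
        intro x hx y hy hxy
        rcases lt_trichotomy x y with h | h | h
        · exact absurd hxy (hdec x y hx.1 h hy.2).ne'
        · exact h
        · exact absurd hxy (hdec y x hy.1 h hx.2).ne
      refine ((Set.Ioo_infinite hab2).image this).mono ?_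
      rintro _ ⟨x, hx, rfl⟩
      exact ⟨x, hx.1, hx.2, rfl⟩
    obtain ⟨p, q, hpq, hi⟩ := (OLine.tame _ hd).inf hinf
    obtain ⟨r, hr1, hr2⟩ := exists_between hpq
    obtain ⟨x0, hx1, hx2, rfl⟩ := hi r hr1 hr2
    obtain ⟨y, hy, hy'⟩ := h x0 ((ha1.trans ha2).trans_lt hx1) (hx2.trans_le (hb2.trans hb1))
    obtain ⟨w, hw1, hw2⟩ := exists_between (max_lt hr1 hy)
    obtain ⟨x', hx'1, hx'2, rfl⟩ := hi w ((le_max_left _ _).trans_lt hw1) (hw2.trans hr2)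
    have hx0 : x0 < x' := by
      rcases lt_trichotomy x0 x' with h | h | h
      · exact h
      · subst h; exact absurd hw2 (lt_irrefl _)
      · exact absurd hw2 (not_lt.2 (hdec x' x0 hx'1 h hx2).le)
    obtain ⟨z, hz1, hz2, hz3⟩ := (hy'.and (EvR.lt hx0)).ex
    have := hdec z x' (hx1.trans hz1) hz3 hx'2
    exact absurd ((le_max_right _ _).trans_lt hw1) (not_lt.2 (this.trans hz2).le)


theorem fubini0 {R : P × N → Prop} (hR : DP M R) {w : N} (hw : ∀ x y, R (x, y) → y < w)
    {a b : P} (hab : a < b) (h : ∀ x, a < x → x < b → Big (fun y => R (x, y)))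
    (hf : ∀ y, ¬ Big (fun x => R (x, y))) : False := by
  have := OLine.dense M (P := P)
  have := OLine.dense M (P := N)
  have := OLine.ne M (P := N)
  have hmax : DP M (fun p : P × N => EvL (fun y => R (p.1, y)) p.2 ∧
      ∀ z, EvL (fun y => R (p.1, y)) z → z ≤ p.2) := by unfold EvL; exact dfb
  obtain ⟨β, hβ, hβ'⟩ := DM.choose hmax (by
    rintro x y y' ⟨h1, h2⟩ ⟨h3, h4⟩
    exact le_antisymm (h4 _ h1) (h2 _ h3))
  have hβ2 : ∀ x, a < x → x < b → EvL (fun y => R (x, y)) (β x) ∧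
      ∀ z, EvL (fun y => R (x, y)) z → z ≤ β x := by
    intro x hx1 hx2
    obtain ⟨p, q, hpq, hR'⟩ := h x hx1 hx2
    have hd : DP M (fun z => EvL (fun y => R (x, y)) z) := by unfold EvL; exact dfb
    obtain ⟨c, hc1, hc2⟩ := (OLine.tame _ hd).lub q ⟨p, hpq, hR'⟩ w (by
      intro z hz
      by_contra hzw
      push Not at hzw
      obtain ⟨y, hy1, hy2, hy3⟩ := (hz.and (EvL.gt hzw)).ex
      exact absurd (hw x y hy2) (not_lt.2 hy3.le))
    have hc : EvL (fun y => R (x, y)) c := by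
      have hd : DP M (fun y => R (x, y)) := dfb
      rcases (OLine.tame _ hd).left c with h1 | ⟨e, he, h1⟩
      · exact h1
      exfalso
      obtain ⟨y, hy, hey⟩ := hc2 e he
      obtain ⟨z, hz1, hz2, hz3⟩ := (hy.and (EvL.gt hey)).ex
      exact h1 z hz3 (hz1.trans_le (hc1 y hy)) hz2
    have := hβ' x c ⟨hc, hc1⟩
    rw [this]
    exact ⟨hc, hc1⟩
  -- points of the top interval
  let E : P × N → Prop := fun p => p.2 < β p.1 ∧ ∃ y₀, y₀ < p.2 ∧ ∀ t, y₀ < t → t < β p.1 → R (p.1, t)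
  have hE : DP M E := by unfold E; exact dfb
  have hER : ∀ x y, E (x, y) → R (x, y) := by
    rintro x y ⟨h1, y0, h2, h3⟩
    exact h3 y h2 h1
  have hEex : ∀ x, a < x → x < b → ∃ y, E (x, y) := by
    intro x hx1 hx2
    obtain ⟨⟨y0, h1, h2⟩, h3⟩ := hβ2 x hx1 hx2
    obtain ⟨y, h4, h5⟩ := exists_between h1
    exact ⟨y, h5, y0, h4, h2⟩
  have hP : ∀ x, a < x → x < b → (∃ y, E (x, y) ∧ EvR (fun z => β z ≤ y) x) ∨
      (∃ y, E (x, y) ∧ EvR (fun z => y < β z) x) := by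
    intro x hx1 hx2
    obtain ⟨y, hy⟩ := hEex x hx1 hx2
    have hd : DP M (fun z => β z ≤ y) := dfb
    rcases (OLine.tame _ hd).right x with h1 | h1
    · exact Or.inl ⟨y, hy, h1⟩
    · exact Or.inr ⟨y, hy, h1.mono fun _ _ h => not_le.1 h⟩
  have hd1 : DP M (fun x => ∃ y, E (x, y) ∧ EvR (fun z => β z ≤ y) x) := by
    unfold EvR; exact dfb
  obtain ⟨a1, b1, ha1, hb1, hab1, h1 | h1⟩ := Big.or' hd1 hab hP
  · refine no_jump hβ hab1 fun x hx1 hx2 => ?_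
    obtain ⟨y, hy, h2⟩ := h1 x hx1 hx2
    obtain ⟨y', h3, h4⟩ := exists_between hy.1
    exact ⟨y', h4, h2.mono fun z _ hz => hz.trans_lt h3⟩
  · have key : ∀ x, a1 < x → x < b1 → ∃ y, E (x, y) ∧ EvR (fun z => ∀ y', E (z, y') → y < y') x := by
      intro x hx1 hx2
      obtain ⟨y, hy, h2⟩ := h1 x hx1 hx2
      refine ⟨y, hy, ?_⟩
      have hd : DP M (fun x => R (x, y)) := dfb
      rcases (OLine.tame _ hd).right x with h3 | h3
      · exact absurd h3.big (hf y)
      · refine (h2.and h3).mono ?_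
        rintro z _ ⟨h4, h5⟩ y' ⟨h6, y0, h7, h8⟩
        by_contra h9
        push Not at h9
        exact h5 (h8 y (h7.trans_le h9) h4)
    obtain ⟨x0, hx1, hx2⟩ := exists_between hab1
    obtain ⟨y, hy, b2, hb2, hbd⟩ := key x0 hx1 hx2
    have hinf : DP M (fun p : P × N => (∀ z, E (p.1, z) → p.2 ≤ z) ∧
      ∀ d, p.2 < d → ∃ z, E (p.1, z) ∧ z < d) := dfb
    obtain ⟨α, hα, hα'⟩ := DM.choose hinf (by
      rintro x y y' ⟨h1, h2⟩ ⟨h3, h4⟩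
      by_contra hne
      rcases lt_or_gt_of_ne hne with h | h
      · obtain ⟨z, hz1, hz2⟩ := h2 _ h
        exact absurd (h3 z hz1) (not_le.2 hz2)
      · obtain ⟨z, hz1, hz2⟩ := h4 _ h
        exact absurd (h1 z hz1) (not_le.2 hz2))
    have hα2 : ∀ x, x0 < x → x < min b1 b2 → (∀ z, E (x, z) → α x ≤ z) ∧
      ∀ d, α x < d → ∃ z, E (x, z) ∧ z < d := by
      intro x h2 h3
      have hxb := h3.trans_le (min_le_left _ _)
      obtain ⟨y1, hy1⟩ := hEex x (ha1.trans_lt (hx1.trans h2)) (hxb.trans_le hb1)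
      have hd : DP M (fun y => E (x, y)) := dfb
      obtain ⟨c, hc1, hc2⟩ := (OLine.tame _ hd).glb y1 hy1 y
        (fun z hz => (hbd x h2 (h3.trans_le (min_le_right _ _)) z hz).le)
      rw [hα' x c ⟨hc1, hc2⟩]
      exact ⟨hc1, hc2⟩
    have hα3 : DM M (fun x => OrderDual.toDual (α x)) := dfb
    refine no_jump hα3 (lt_min hx2 hb2) fun x h2 h3 => ?_
    obtain ⟨y2, hy2, hy3⟩ := key x (hx1.trans h2) (h3.trans_le (min_le_left _ _))
    obtain ⟨h4, y0, h5, h6⟩ := hy2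
    obtain ⟨y3, h7, h8⟩ := exists_between h5
    have hE3 : E (x, y3) := ⟨h8.trans h4, y0, h7, h6⟩
    obtain ⟨y4, h9, h10⟩ := exists_between h8
    refine ⟨OrderDual.toDual y4, ((hα2 x h2 h3).1 _ hE3).trans_lt h9, ?_⟩
    refine (hy3.and (EvR.lt h3)).mono ?_
    rintro z hz ⟨h11, h12⟩
    refine OrderDual.toDual_lt_toDual.2 (h10.trans_le ?_)
    by_contra h13
    push Not at h13
    obtain ⟨t, ht1, ht2⟩ := (hα2 z (h2.trans hz) h12).2 _ h13
    exact absurd (h11 t ht1) (not_lt.2 ht2.le)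

theorem fubini1 {R : P × N → Prop} (hR : DP M R) {w : N} (hw : ∀ x y, R (x, y) → y < w)
    (h : Big (fun x => Big (fun y => R (x, y)))) : Big (fun y => Big (fun x => R (x, y))) := by
  by_contra hcon
  have hR' : DP M (fun p : N × P => R (p.2, p.1)) := dfb
  have hd0 := DP.big hR'
  have hfin := (not_big hd0).1 hcon
  have hd : DP M (fun p : P × N => R p ∧ ¬ Big (fun x => R (x, p.2))) := by
    unfold Big; exact dfb
  obtain ⟨a, b, hab, h⟩ := h
  refine fubini0 hd (w := w) (fun x y h => hw x y h.1) hab (fun x hx1 hx2 => ?_) ?_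
  · have h1 := h x hx1 hx2
    have hd1 : DP M (fun y => R (x, y)) := dfb
    have hd2 : DP M (fun y => R (x, y) ∧ ¬ Big (fun x => R (x, y))) := by
      unfold Big; exact dfb
    rw [big_iff hd2]
    replace h1 := (big_iff hd1).1 h1
    exact (h1.sdiff hfin).mono fun y hy => ⟨hy.1, hy.2⟩
  · intro y hy
    have := OLine.dense M (P := P)
    have h2 := hy
    obtain ⟨a, b, hab, h⟩ := hy
    obtain ⟨x, hx1, hx2⟩ := exists_between hab
    exact (h x hx1 hx2).2 (h2.mono fun _ h => h.1)

theorem Big.ofDual {S : P → Prop} (h : Big (P := Pᵒᵈ) (fun x => S (OrderDual.ofDual x))) : Big S := by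
  obtain ⟨a, b, hab, h⟩ := h
  exact ⟨OrderDual.ofDual b, OrderDual.ofDual a, hab, fun x h1 h2 => h (OrderDual.toDual x) h2 h1⟩
theorem Big.toDual {S : P → Prop} (h : Big S) : Big (P := Pᵒᵈ) (fun x => S (OrderDual.ofDual x)) := by
  obtain ⟨a, b, hab, h⟩ := h
  exact ⟨OrderDual.toDual b, OrderDual.toDual a, hab, fun x h1 h2 => h (OrderDual.ofDual x) h2 h1⟩
theorem not_big_eq (w : P) [DenselyOrdered P] : ¬ Big (fun x => x = w) := fun h => by
  have := h.infinite
  simp at this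

theorem fubini {R : P × N → Prop} (hR : DP M R)
    (h : Big (fun x => Big (fun y => R (x, y)))) : Big (fun y => Big (fun x => R (x, y))) := by
  have := OLine.dense M (P := N)
  obtain ⟨w⟩ := OLine.ne M (P := N)
  have hd1 : DP M (fun p : P × N => R p ∧ p.2 < w) := dfb
  have hd2 : DP M (fun p : P × Nᵒᵈ => R (p.1, OrderDual.ofDual p.2) ∧ p.2 < OrderDual.toDual w) := dfb
  have hb : DP M (fun x => Big (fun y => R (x, y) ∧ y < w)) := DP.big hd1
  have hs : Big (fun x => Big (fun y => R (x, y) ∧ y < w) ∨ Big (fun y => R (x, y) ∧ w < y)) := by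
    refine h.mono fun x hx => ?_
    have hd3 : DP M (fun y => R (x, y) ∧ y < w) := dfb
    have hd4 : DP M (fun y => R (x, y) ∧ w < y) := dfb
    have h5 : Big (fun y => (R (x, y) ∧ y < w) ∨ (R (x, y) ∧ w < y) ∨ y = w) := hx.mono fun y hy => by
      rcases lt_trichotomy y w with h | h | h
      · exact Or.inl ⟨hy, h⟩
      · exact Or.inr (Or.inr h)
      · exact Or.inr (Or.inl ⟨hy, h⟩)
    rcases Big.or hd3 h5 with h | h
    · exact Or.inl h
    rcases Big.or hd4 h with h | h
    · exact Or.inr h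
    · exact absurd h (not_big_eq w)
  rcases Big.or hb hs with h | h
  · exact (fubini1 hd1 (w := w) (fun x y h => h.2) h).mono fun y hy => hy.mono fun x hx => hx.1
  · have := fubini1 hd2 (w := OrderDual.toDual w) (fun x y h => h.2) (h.mono fun x hx => hx.toDual)
    exact Big.ofDual (S := fun y => Big fun x => R (x, y)) (this.mono fun y hy => hy.mono fun x hx => hx.1)

end

/-- iterated powers -/
def Pw (M : Type u) : ℕ → Type u
  | 0 => PUnit
  | n + 1 => Pw M n × M

instance Pw.sp (M : Type u) : ∀ n, Sp M (Pw M n)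
  | 0 => Sp.punit M
  | n + 1 => @Sp.prod M (Pw M n) M (Pw.sp M n) _

section
variable {M : Type u} [LinearOrder M] [OM M]
variable {X Y : Type u} [Sp M X] [Sp M Y]

/-- contains a box -/
def Thick : ∀ d, (Pw M d → Prop) → Prop
  | 0, S => S PUnit.unit
  | d + 1, S => Thick d (fun z => Big fun t : M => S (z, t))

theorem Thick.mono : ∀ {d} {S T : Pw M d → Prop}, Thick d S → (∀ x, S x → T x) → Thick d T
  | 0, _, _, h, h' => h' _ h
  | d + 1, S, T, h, h' => Thick.mono (d := d) h fun z hz => Big.mono hz fun t => h' (z, t)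

theorem thick_succ {d : ℕ} {S : Pw M (d + 1) → Prop} :
    Thick (d + 1) S ↔ Thick d (fun z => Big fun t : M => S (z, t)) := Iff.rfl

theorem Thick.or : ∀ {d} {S T : Pw M d → Prop}, DP M S → Thick d (fun x => S x ∨ T x) →
    Thick d S ∨ Thick d T
  | 0, _, _, _, h => h
  | d + 1, S, T, hS, h => by
    obtain ⟨S, rfl⟩ : ∃ S' : Pw M d × M → Prop, S' = S := ⟨S, rfl⟩
    have hS' : DP M S := hS
    refine Thick.or (d := d) (DP.big hS') (Thick.mono (d := d) h fun z hz => ?_)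
    have h1 : DP M (fun t => S (z, t)) := dfb
    exact Big.or h1 hz

theorem Thick.exchange : ∀ {d} {R : Pw M d × M → Prop}, DP M R →
    Thick d (fun z => Big fun t => R (z, t)) → Big fun t => Thick d fun z => R (z, t)
  | 0, _, _, h => h
  | d + 1, R, hR, h => by
    obtain ⟨R, rfl⟩ : ∃ S' : (Pw M d × M) × M → Prop, S' = R := ⟨R, rfl⟩
    have hR' : DP M R := hR
    have hd : DP M (fun p : Pw M d × M => Big fun s : M => R ((p.1, s), p.2)) :=
      DP.big (R := fun q : (Pw M d × M) × M => R ((q.1.1, q.2), q.1.2)) (DP.comp hR' dfb)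
    refine Thick.exchange (d := d) hd ?_
    refine Thick.mono (d := d) h fun z hz => ?_
    have hd2 : DP M (fun p : M × M => R ((z, p.1), p.2)) := DP.comp hR' dfb
    exact fubini (R := fun p : M × M => R ((z, p.1), p.2)) hd2 hz

theorem DP.thick : ∀ {d} {R : X × Pw M d → Prop}, DP M R → DP M (fun x => Thick d fun z => R (x, z))
  | 0, R, hR => DP.comp hR (DM.pair DM.id (DM.const _))
  | d + 1, R, hR => by
    obtain ⟨R, rfl⟩ : ∃ S' : X × (Pw M d × M) → Prop, S' = R := ⟨R, rfl⟩
    have hR' : DP M R := hR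
    have hd : DP M (fun p : X × Pw M d => Big fun s : M => R (p.1, (p.2, s))) :=
      DP.big (R := fun q : (X × Pw M d) × M => R (q.1.1, (q.1.2, q.2))) (DP.comp hR' dfb)
    exact DP.thick (d := d) hd

/-- box neighbourhoods -/
def Nb : ∀ d, Pw M d → (Pw M d → Prop) → Prop
  | 0, x, S => S x
  | d + 1, x, S => ∃ a b : M, a < x.2 ∧ x.2 < b ∧ Nb d x.1 (fun z => ∀ t, a < t → t < b → S (z, t))

theorem Nb.mono : ∀ {d} {x : Pw M d} {S T : Pw M d → Prop}, Nb d x S → (∀ x, S x → T x) → Nb d x T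
  | 0, _, _, _, h, h' => h' _ h
  | d + 1, x, S, T, ⟨a, b, ha, hb, h⟩, h' => ⟨a, b, ha, hb, Nb.mono (d := d) h fun z hz t h1 h2 => h' _ (hz t h1 h2)⟩

theorem Nb.self : ∀ {d} {x : Pw M d} {S : Pw M d → Prop}, Nb d x S → S x
  | 0, _, _, h => h
  | d + 1, x, S, ⟨a, b, ha, hb, h⟩ => Nb.self (d := d) h x.2 ha hb

theorem Nb.and : ∀ {d} {x : Pw M d} {S T : Pw M d → Prop}, Nb d x S → Nb d x T →
    Nb d x (fun y => S y ∧ T y)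
  | 0, _, _, _, h, h' => ⟨h, h'⟩
  | d + 1, x, S, T, ⟨a, b, ha, hb, h⟩, ⟨a', b', ha', hb', h'⟩ =>
    ⟨max a a', min b b', max_lt ha ha', lt_min hb hb', Nb.mono (d := d) (Nb.and h h') fun z hz t h1 h2 =>
      ⟨hz.1 t ((le_max_left _ _).trans_lt h1) (h2.trans_le (min_le_left _ _)),
      hz.2 t ((le_max_right _ _).trans_lt h1) (h2.trans_le (min_le_right _ _))⟩⟩

theorem Nb.thick : ∀ {d} {x : Pw M d} {S : Pw M d → Prop}, Nb d x S → Thick d S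
  | 0, _, _, h => h
  | d + 1, x, S, ⟨a, b, ha, hb, h⟩ => Thick.mono (d := d) (Nb.thick h) fun z hz => ⟨a, b, ha.trans hb, hz⟩

theorem Nb.slice {d} {x : Pw M d} {t : M} {S : Pw M d × M → Prop} (h : Nb (d + 1) (x, t) S) :
    Nb d x (fun y => S (y, t)) := by
  obtain ⟨a, b, ha, hb, h⟩ := h
  exact h.mono fun z hz => hz t ha hb

theorem DP.nb : ∀ {d} {X : Type u} [Sp M X] {R : X × Pw M d → Prop}, DP M R →
    DP M (fun p : X × Pw M d => Nb d p.2 fun z => R (p.1, z))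
  | 0, X, _, R, hR => hR
  | d + 1, X, _, R, hR => by
    obtain ⟨R, rfl⟩ : ∃ S' : X × (Pw M d × M) → Prop, S' = R := ⟨R, rfl⟩
    have hR' : DP M R := hR
    have h1 : DP M (fun q : (X × (M × M)) × Pw M d =>
      ∀ t, q.1.2.1 < t → t < q.1.2.2 → R (q.1.1, (q.2, t))) := dfb
    have h2 := DP.nb (d := d) h1
    have h3 : DP M (fun p : X × (Pw M d × M) => ∃ a b, a < p.2.2 ∧ p.2.2 < b ∧
      (fun q : (X × (M × M)) × Pw M d => Nb d q.2 fun z => ∀ t, q.1.2.1 < t → t < q.1.2.2 → R (q.1.1, (z, t)))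
        ((p.1, (a, b)), p.2.1)) := by
      apply DP.ex2
      apply DP.ex2
      apply DP.and dfb
      apply DP.and dfb
      exact DP.comp h2 dfb
    exact h3

theorem DP.nb1 {d} {S : Pw M d → Prop} (hS : DP M S) : DP M (fun x => Nb d x S) := by
  have h1 : DP M (fun p : PUnit.{u+1} × Pw M d => S p.2) := dfb
  exact DP.comp (DP.nb h1) (f := fun x => (PUnit.unit, x)) dfb

theorem Thick.exists_nb : ∀ {d} {S : Pw M d → Prop}, DP M S → Thick d S → ∃ x, Nb d x S
  | 0, S, _, h => ⟨_, h⟩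
  | d + 1, S, hS, h => by
    obtain ⟨S, rfl⟩ : ∃ S' : Pw M d × M → Prop, S' = S := ⟨S, rfl⟩
    have hS' : DP M S := hS
    have hd : DP M (fun p : (Pw M d × M) × M => p.1.2 < p.2 ∧ ∀ t, p.1.2 < t → t < p.2 → S (p.1.1, t)) := dfb
    have h1 : Thick d (fun z => Big fun a : M => Big fun b : M => a < b ∧ ∀ t, a < t → t < b → S (z, t)) := by
      refine Thick.mono (d := d) h ?_
      rintro z ⟨p, q, hpq, hz⟩
      refine ⟨p, q, hpq, fun a ha1 ha2 => ⟨a, q, ha2, fun b hb1 hb2 => ⟨hb1, fun t h1 h2 => ?_⟩⟩⟩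
      exact hz t (ha1.trans h1) (h2.trans hb2)
    have h2 := Thick.exchange (DP.big hd) h1
    obtain ⟨a0, b0, hab, h2⟩ := h2
    obtain ⟨a, ha1, ha2⟩ := exists_between hab
    have hd2 : DP M (fun p : Pw M d × M => a < p.2 ∧ ∀ t, a < t → t < p.2 → S (p.1, t)) := dfb
    obtain ⟨a0, b0, hab, h3⟩ := Thick.exchange hd2 (h2 a ha1 ha2)
    obtain ⟨b, hb1, hb2⟩ := exists_between hab
    have hd3 : DP M (fun z : Pw M d => a < b ∧ ∀ t, a < t → t < b → S (z, t)) := dfb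
    obtain ⟨z, hz⟩ := Thick.exists_nb (d := d) hd3 (h3 b hb1 hb2)
    obtain ⟨t, ht1, ht2⟩ := exists_between hz.self.1
    exact ⟨(z, t), a, b, ht1, ht2, Nb.mono (d := d) hz fun w hw => hw.2⟩

/-- boundary points -/
def Bd (d : ℕ) (S : Pw M d → Prop) (x : Pw M d) : Prop := ¬ Nb d x S ∧ ¬ Nb d x (fun y => ¬ S y)

theorem DP.bd {d} {S : Pw M d → Prop} (hS : DP M S) : DP M (Bd d S) :=
  (DP.nb1 hS).not.and (DP.nb1 hS.not).not

theorem Bd.thin {d} {S : Pw M d → Prop} (hS : DP M S) : ¬ Thick d (Bd d S) := by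
  intro h
  have h1 : Thick d (fun x => (Bd d S x ∧ S x) ∨ (Bd d S x ∧ ¬ S x)) := h.mono fun x hx => by
    by_cases h : S x
    · exact Or.inl ⟨hx, h⟩
    · exact Or.inr ⟨hx, h⟩
  rcases Thick.or ((DP.bd hS).and hS) h1 with h1 | h1
  · obtain ⟨x, hx⟩ := Thick.exists_nb ((DP.bd hS).and hS) h1
    exact hx.self.1.1 (hx.mono fun _ h => h.2)
  · obtain ⟨x, hx⟩ := Thick.exists_nb ((DP.bd hS).and hS.not) h1
    exact hx.self.1.2 (hx.mono fun _ h => h.2)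

theorem not_bd {d} {S : Pw M d → Prop} {x : Pw M d} (h : ¬ Bd d S x) : Nb d x (fun y => S y ↔ S x) := by
  unfold Bd at h
  rw [not_and_or, not_not, not_not] at h
  rcases h with h | h
  · exact h.mono fun y hy => ⟨fun _ => h.self, fun _ => hy⟩
  · exact h.mono fun y hy => ⟨fun h' => absurd h' hy, fun h' => absurd h' h.self⟩

/-! counting -/
noncomputable def cnt (S : M → Prop) : ℕ := {t | S t}.ncard

theorem le_cnt_iff {S : M → Prop} (hS : {t | S t}.Finite) (k : ℕ) :
    k ≤ cnt S ↔ ∃ v : Fin k → M, (∀ i j, v i = v j → i = j) ∧ ∀ i, S (v i) := by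
  constructor
  · intro h
    obtain ⟨s, hs, hk⟩ := Set.exists_subset_card_eq h
    have hfin : s.Finite := hS.subset hs
    have := hfin.fintype
    have hc : Fintype.card s = k := by rw [← hk, Set.ncard_eq_toFinset_card', Set.toFinset_card]
    let e := Fintype.equivFinOfCardEq hc
    exact ⟨fun i => (e.symm i).1, fun i j h => e.symm.injective (Subtype.ext h), fun i => hs (e.symm i).2⟩
  · rintro ⟨v, hv, hS'⟩
    have h1 : (Set.range v).ncard = k := by
      rw [← Set.image_univ, Set.ncard_image_of_injective _ (fun i j h => hv i j h), Set.ncard_univ]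
      simp
    rw [← h1]
    refine Set.ncard_le_ncard ?_ hS
    rintro _ ⟨i, rfl⟩
    exact hS' i

theorem DP.le_cnt {A : X × M → Prop} (hA : DP M A) (hf : ∀ x, {t | A (x, t)}.Finite) (k : ℕ) :
    DP M (fun x => k ≤ cnt fun t => A (x, t)) := by
  have : DP M (fun x => ∃ v : Fin k → M, (∀ i j, v i = v j → i = j) ∧ ∀ i, A (x, v i)) := dfb
  exact this.congr fun x => le_cnt_iff (hf x) k

theorem DP.cnt_eq {A : X × M → Prop} (hA : DP M A) (hf : ∀ x, {t | A (x, t)}.Finite) (k : ℕ) :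
    DP M (fun x => (cnt fun t => A (x, t)) = k) :=
  ((DP.le_cnt hA hf k).and (DP.le_cnt hA hf (k + 1)).not).congr fun x => by omega

theorem cnt_mono {S T : M → Prop} (hT : {t | T t}.Finite) (h : ∀ t, S t → T t) : cnt S ≤ cnt T :=
  Set.ncard_le_ncard h hT

theorem cnt_add {S : M → Prop} (hS : {t | S t}.Finite) (Q : M → Prop) :
    cnt S = cnt (fun t => S t ∧ Q t) + cnt (fun t => S t ∧ ¬ Q t) := by
  unfold cnt
  rw [← Set.ncard_union_eq (s := {t | S t ∧ Q t}) (t := {t | S t ∧ ¬ Q t}) ?_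
    (hS.subset fun t h => h.1) (hS.subset fun t h => h.1)]
  · congr 1
    ext t
    simp only [Set.mem_ofPred_eq, Set.mem_union]
    tauto
  · rw [Set.disjoint_left]
    rintro t ⟨_, h⟩ ⟨_, h'⟩
    exact h' h

theorem cnt_eq_zero {S : M → Prop} (hS : {t | S t}.Finite) : cnt S = 0 ↔ ∀ t, ¬ S t := by
  unfold cnt
  rw [Set.ncard_eq_zero hS, Set.eq_empty_iff_forall_notMem]
  rfl

theorem cnt_eq_one {S : M → Prop} (hS : {t | S t}.Finite) :
    cnt S = 1 ↔ (∃ t, S t) ∧ ¬ ∃ t t', t < t' ∧ S t ∧ S t' := by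
  unfold cnt
  rw [Set.ncard_eq_one]
  constructor
  · rintro ⟨a, ha⟩
    have h : ∀ t, S t ↔ t = a := fun t => by
      have : t ∈ {t | S t} ↔ t ∈ ({a} : Set M) := by rw [ha]
      simpa using this
    refine ⟨⟨a, (h a).2 rfl⟩, ?_⟩
    rintro ⟨t, t', h1, h2, h3⟩
    rw [(h _).1 h2, (h _).1 h3] at h1
    exact lt_irrefl _ h1
  · rintro ⟨⟨a, ha⟩, h⟩
    refine ⟨a, Set.eq_singleton_iff_unique_mem.2 ⟨ha, fun b hb => ?_⟩⟩
    by_contra hne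
    rcases lt_or_gt_of_ne hne with h1 | h1
    · exact h ⟨b, a, h1, hb, ha⟩
    · exact h ⟨a, b, h1, ha, hb⟩
end

section
variable {M : Type u} [LinearOrder M] [OM M]
variable {X Y : Type u} [Sp M X] [Sp M Y]

theorem exists_not_of_not_big {S : M → Prop} (h : ¬ Big S) {a b : M} (hab : a < b) :
    ∃ t, a < t ∧ t < b ∧ ¬ S t := by
  by_contra hc
  push Not at hc
  exact h ⟨a, b, hab, hc⟩

theorem fin_right {S : M → Prop} (hf : {t | S t}.Finite) (y : M) :
    ∃ z, y < z ∧ ∀ w, y < w → w < z → ¬ S w := by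
  by_cases h : {t | S t ∧ y < t}.Nonempty
  · obtain ⟨z, hz, hmin⟩ := Set.exists_min_image {t | S t ∧ y < t} (fun x => x)
      (hf.subset fun t ht => ht.1) h
    exact ⟨z, hz.2, fun w h1 h2 h3 => absurd (hmin w ⟨h3, h1⟩) (not_le.2 h2)⟩
  · obtain ⟨z, hz⟩ := exists_gt y
    exact ⟨z, hz, fun w h1 h2 h3 => h ⟨w, h3, h1⟩⟩

theorem fin_bot {S : M → Prop} (hf : {t | S t}.Finite) : ∃ z, ∀ w, S w → z < w := by
  by_cases h : {t | S t}.Nonempty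
  · obtain ⟨z, hz, hmin⟩ := Set.exists_min_image {t | S t} (fun x => x) hf h
    obtain ⟨y, hy⟩ := exists_lt z
    exact ⟨y, fun w hw => hy.trans_le (hmin w hw)⟩
  · obtain ⟨z⟩ := (inferInstance : Nonempty M)
    exact ⟨z, fun w hw => absurd ⟨w, hw⟩ h⟩

theorem fin_first {S : M → Prop} (hf : {t | S t}.Finite) (h : ∃ t, S t) : ∃ z, S z ∧ ∀ w, S w → z ≤ w :=
  Set.exists_min_image {t | S t} (fun x => x) hf h

theorem cnt_congr {S T : M → Prop} (h : ∀ t, S t ↔ T t) : cnt S = cnt T := by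
  rw [show S = T from funext fun t => propext (h t)]

theorem cnt_split {S : M → Prop} (hS : {t | S t}.Finite) {t t' : M} (htt : t < t') (h : ¬ S t') :
    cnt (fun y => S y ∧ t < y) = cnt (fun y => S y ∧ t < y ∧ y < t') + cnt (fun y => S y ∧ t' < y) := by
  rw [cnt_add (S := fun y => S y ∧ t < y) (hS.subset fun y h => h.1) (fun y => y < t')]
  congr 1
  · exact cnt_congr fun y => by tauto
  · refine cnt_congr fun y => ⟨?_, ?_⟩
    · rintro ⟨⟨h1, h2⟩, h3⟩
      refine ⟨h1, lt_of_le_of_ne (not_lt.1 h3) ?_⟩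
      rintro rfl
      exact h h1
    · rintro ⟨h1, h2⟩
      exact ⟨⟨h1, htt.trans h2⟩, not_lt.2 h2.le⟩

theorem lc {n : ℕ} {A : Pw M n × M → Prop} (hA : DP M A) (hf : ∀ x, {t | A (x, t)}.Finite) :
    ∃ T : Pw M n → Prop, DP M T ∧ ¬ Thick n T ∧ ∀ x0, ¬ T x0 →
      (∀ p q : M, p < q → ∃ t, p < t ∧ t < q ∧ Nb n x0 (fun x => ¬ A (x, t) ∧
        (cnt fun y => A (x, y) ∧ t < y) = (cnt fun y => A (x0, y) ∧ t < y))) ∧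
      Nb n x0 (fun x => (cnt fun y => A (x, y)) = (cnt fun y => A (x0, y))) := by
  obtain ⟨S1, hS1⟩ : ∃ S1 : (Pw M n × M) × M → Prop, S1 = fun p => ∃ y, A (p.1.1, y) ∧ p.1.2 < y ∧ y < p.2 := ⟨_, rfl⟩
  obtain ⟨S2, hS2⟩ : ∃ S2 : (Pw M n × M) × M → Prop, S2 = fun p => ∃ y y', y < y' ∧ (A (p.1.1, y) ∧ p.1.2 < y ∧ y < p.2) ∧
    (A (p.1.1, y') ∧ p.1.2 < y' ∧ y' < p.2) := ⟨_, rfl⟩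
  obtain ⟨U, hU⟩ : ∃ U : Pw M n × M → Prop, U = fun p => ∃ y, A (p.1, y) ∧ p.2 < y := ⟨_, rfl⟩
  obtain ⟨V, hV⟩ : ∃ U : Pw M n × M → Prop, U = fun p => ∃ y, A (p.1, y) ∧ y < p.2 := ⟨_, rfl⟩
  have dS1 : DP M S1 := by rw [hS1]; exact dfb
  have dS2 : DP M S2 := by rw [hS2]; exact dfb
  have dU : DP M U := by rw [hU]; exact dfb
  have dV : DP M V := by rw [hV]; exact dfb
  obtain ⟨E, hE⟩ : ∃ E : (Pw M n × M) × M → Prop, E = fun p => Bd (n+2) S1 p ∨ Bd (n+2) S2 p := ⟨_, rfl⟩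
  obtain ⟨E1, hE1⟩ : ∃ E : Pw M n × M → Prop, E = fun p => Bd (n+1) U p ∨ Bd (n+1) V p ∨ Bd (n+1) A p := ⟨_, rfl⟩
  have dE : DP M E := by rw [hE]; exact (DP.bd (d := n+2) dS1).or (DP.bd (d := n+2) dS2)
  have dE1 : DP M E1 := by
    rw [hE1]; exact (DP.bd (d := n+1) dU).or ((DP.bd (d := n+1) dV).or (DP.bd (d := n+1) hA))
  have tE : ¬ Thick n (fun x => Big fun t : M => Big fun t' : M => E ((x, t), t')) := by
    intro h
    have h' : Thick (n+2) (fun p => Bd (n+2) S1 p ∨ Bd (n+2) S2 p) := by rw [hE] at h; exact h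
    rcases Thick.or (DP.bd (d := n+2) dS1) h' with h | h
    · exact Bd.thin (d := n+2) dS1 h
    · exact Bd.thin (d := n+2) dS2 h
  have tE1 : ¬ Thick n (fun x => Big fun t : M => E1 (x, t)) := by
    intro h
    have h' : Thick (n+1) (fun p => Bd (n+1) U p ∨ Bd (n+1) V p ∨ Bd (n+1) A p) := by rw [hE1] at h; exact h
    rcases Thick.or (DP.bd (d := n+1) dU) h' with h | h
    · exact Bd.thin (d := n+1) dU h
    rcases Thick.or (DP.bd (d := n+1) dV) h with h | h
    · exact Bd.thin (d := n+1) dV h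
    · exact Bd.thin (d := n+1) hA h
  have dB1 : DP M (fun x : Pw M n => Big fun t : M => Big fun t' : M => E ((x, t), t')) := by
    unfold Big; exact dfb
  have dB2 : DP M (fun x : Pw M n => Big fun t : M => E1 (x, t)) := by
    unfold Big; exact dfb
  refine ⟨fun x => (Big fun t : M => Big fun t' : M => E ((x, t), t')) ∨ Big fun t : M => E1 (x, t), dB1.or dB2, ?_, ?_⟩
  · intro h
    rcases Thick.or dB1 h with h | h
    · exact tE h
    · exact tE1 h
  intro x0 hx0
  rw [not_or] at hx0
  have hAb : ¬ Big (fun t => A (x0, t)) := (not_big (M := M) (S := fun t => A (x0, t)) dfb).2 (hf x0)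
  -- good
  obtain ⟨G, hG⟩ : ∃ G : M → Prop, G = fun t => ¬ (A (x0, t) ∨ E1 (x0, t) ∨ Big fun t' : M => E ((x0, t), t')) := ⟨_, rfl⟩
  have nG : ¬ Big (fun t => ¬ G t) := by
    rw [hG]
    simp only [not_not]
    intro h
    rcases Big.or (M := M) (S := fun t => A (x0, t)) dfb h with h | h
    · exact hAb h
    rcases Big.or (M := M) (S := fun t => E1 (x0, t)) dfb h with h | h
    · exact hx0.2 h
    · exact hx0.1 h
  have dG : DP M G := by rw [hG]; unfold Big; exact dfb
  have g1 : ∀ t, G t → ¬ A (x0, t) := fun t h h' => by rw [hG] at h; exact h (Or.inl h')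
  have g2 : ∀ t, G t → ¬ E1 (x0, t) := fun t h h' => by rw [hG] at h; exact h (Or.inr (Or.inl h'))
  have g3 : ∀ t, G t → ¬ Big fun t' => E ((x0, t), t') := fun t h h' => by rw [hG] at h; exact h (Or.inr (Or.inr h'))
  have nA : ∀ t, G t → Nb n x0 (fun x => ¬ A (x, t)) := by
    intro t ht
    have h1 : ¬ Bd (n+1) A (x0, t) := fun h => g2 t ht (by rw [hE1]; exact Or.inr (Or.inr h))
    exact (Nb.slice (not_bd h1)).mono fun x hx h => g1 t ht (hx.1 h)
  have nU : ∀ t, G t → Nb n x0 (fun x => U (x, t) ↔ U (x0, t)) := by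
    intro t ht
    have h1 : ¬ Bd (n+1) U (x0, t) := fun h => g2 t ht (by rw [hE1]; exact Or.inl h)
    exact Nb.slice (not_bd h1)
  have nV : ∀ t, G t → Nb n x0 (fun x => V (x, t) ↔ V (x0, t)) := by
    intro t ht
    have h1 : ¬ Bd (n+1) V (x0, t) := fun h => g2 t ht (by rw [hE1]; exact Or.inr (Or.inl h))
    exact Nb.slice (not_bd h1)
  have nS : ∀ t t', ¬ E ((x0, t), t') → Nb n x0 (fun x => (S1 ((x, t), t') ↔ S1 ((x0, t), t')) ∧
      (S2 ((x, t), t') ↔ S2 ((x0, t), t'))) := by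
    intro t t' h
    rw [hE, not_or] at h
    have a1 := Nb.slice (d := n) (Nb.slice (d := n+1) (not_bd h.1))
    have a2 := Nb.slice (d := n) (Nb.slice (d := n+1) (not_bd h.2))
    exact Nb.and a1 a2
  have key : ∀ r t, G t → (cnt fun y => A (x0, y) ∧ t < y) = r →
      Nb n x0 (fun x => (cnt fun y => A (x, y) ∧ t < y) = (cnt fun y => A (x0, y) ∧ t < y)) := by
    intro r
    induction r with
    | zero =>
      intro t ht h
      rw [h]
      rw [cnt_eq_zero ((hf x0).subset fun y h => h.1)] at h
      refine (nU t ht).mono fun x hx => ?_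
      rw [cnt_eq_zero ((hf x).subset fun y h => h.1)]
      intro y hy
      have : U (x, t) := by rw [hU]; exact ⟨y, hy⟩
      have := hx.1 this
      rw [hU] at this
      obtain ⟨y, hy⟩ := this
      exact h y hy
    | succ r ih =>
      intro t ht h
      have hex : ∃ y, A (x0, y) ∧ t < y := by
        by_contra hc
        push Not at hc
        rw [(cnt_eq_zero ((hf x0).subset fun y h => h.1)).2 (fun y hy => absurd hy.2 (not_lt.2 (hc y hy.1)))] at h
        omega
      obtain ⟨y1, hy1, hmin⟩ := fin_first (S := fun y => A (x0, y) ∧ t < y) ((hf x0).subset fun y h => h.1) hex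
      obtain ⟨z, hz, hz'⟩ := fin_right (hf x0) y1
      have hb : ¬ Big (fun t' => ¬ G t' ∨ E ((x0, t), t')) := by
        intro h
        rcases Big.or dG.not h with h | h
        · exact nG h
        · exact g3 t ht h
      obtain ⟨t', h1, h2, h3⟩ := exists_not_of_not_big hb hz
      rw [not_or, not_not] at h3
      obtain ⟨h3, h4⟩ := h3
      have ht' : t < t' := hy1.2.trans h1
      have hs1 : S1 ((x0, t), t') := by rw [hS1]; exact ⟨y1, hy1.1, hy1.2, h1⟩
      have hs2 : ¬ S2 ((x0, t), t') := by
        rw [hS2]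
        rintro ⟨y, y', h5, h6, h7⟩
        have h8 : y1 ≤ y := hmin y ⟨h6.1, h6.2.1⟩
        exact hz' y' (h8.trans_lt h5) (h7.2.2.trans h2) h7.1
      have hone : ∀ x, S1 ((x, t), t') → ¬ S2 ((x, t), t') → (cnt fun y => A (x, y) ∧ t < y ∧ y < t') = 1 := by
        intro x a1 a2
        rw [cnt_eq_one ((hf x).subset fun y h => h.1)]
        rw [hS1] at a1
        rw [hS2] at a2
        exact ⟨a1, a2⟩
      have e0 := cnt_split (hf x0) ht' (g1 t' h3)
      rw [hone x0 hs1 hs2] at e0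
      have ih' := ih t' h3 (by omega)
      refine ((ih'.and (nA t' h3)).and (nS t t' h4)).mono fun x hx => ?_
      have e1 := cnt_split (hf x) ht' hx.1.2
      rw [hone x (hx.2.1.2 hs1) (fun h => hs2 (hx.2.2.1 h))] at e1
      have := hx.1.1
      omega
  constructor
  · intro p q hpq
    obtain ⟨t, h1, h2, h3⟩ := exists_not_of_not_big nG hpq
    rw [not_not] at h3
    exact ⟨t, h1, h2, (nA t h3).and (key _ t h3 rfl)⟩
  · obtain ⟨b, hb⟩ := fin_bot (hf x0)
    obtain ⟨a, hab⟩ := exists_lt b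
    obtain ⟨t, h1, h2, h3⟩ := exists_not_of_not_big nG hab
    rw [not_not] at h3
    have hv : ¬ V (x0, t) := by
      rw [hV]; rintro ⟨y, hy, hy'⟩
      exact lt_irrefl _ ((hb y hy).trans (hy'.trans h2))
    have hall : ∀ x, ¬ A (x, t) → ¬ V (x, t) → (cnt fun y => A (x, y)) = cnt fun y => A (x, y) ∧ t < y := by
      intro x a1 a2
      refine cnt_congr fun y => ⟨fun h => ⟨h, ?_⟩, fun h => h.1⟩
      rcases lt_trichotomy t y with h5 | h5 | h5
      · exact h5
      · rw [h5] at a1; exact absurd h a1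
      · rw [hV] at a2; exact absurd ⟨y, h, h5⟩ a2
    refine (((nA t h3).and (key _ t h3 rfl)).and (nV t h3)).mono fun x hx => ?_
    rw [hall x hx.1.1 (fun h => hv (hx.2.1 h)), hall x0 (g1 t h3) hv]
    exact hx.1.2
end

section
variable {M : Type u} [LinearOrder M] [OM M]
variable {X Y : Type u} [Sp M X] [Sp M Y]

variable (M) in
/-- uniform finiteness over the parameter space `X` -/
def UF (X : Type u) [Sp M X] : Prop := ∀ A : X × M → Prop, DP M A → (∀ x, {t | A (x, t)}.Finite) →
  ∃ K, ∀ x, (cnt fun t => A (x, t)) ≤ K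

theorem UF.surj {f : X → Y} (hf : DM M f) (hs : Function.Surjective f) (h : UF M X) : UF M Y := by
  intro A hA hfin
  obtain ⟨K, hK⟩ := h (fun p => A (f p.1, p.2)) dfb (fun x => hfin (f x))
  refine ⟨K, fun y => ?_⟩
  obtain ⟨x, rfl⟩ := hs y
  exact hK x

theorem Thick.empty : ∀ {d}, ¬ Thick d (fun _ : Pw M d => False)
  | 0 => fun h => h
  | d + 1 => fun h => Thick.empty (d := d) (Thick.mono (d := d) h (by
      rintro z ⟨a, b, hab, h⟩
      obtain ⟨c, h1, h2⟩ := exists_between hab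
      exact h c h1 h2))

theorem Thick.finEx {d k : ℕ} {T : Fin k → Pw M d → Prop} (hT : ∀ i, DP M (T i)) (h : ∀ i, ¬ Thick d (T i)) :
    ¬ Thick d (fun x => ∃ i, T i x) := by
  induction k with
  | zero => exact fun h => Thick.empty (h.mono fun x ⟨i, _⟩ => i.elim0)
  | succ k ih =>
    intro h'
    have h2 : Thick d (fun x => T 0 x ∨ ∃ i : Fin k, T i.succ x) := h'.mono fun x ⟨i, hi⟩ => by
      revert hi
      refine Fin.cases ?_ ?_ i
      · exact Or.inl
      · exact fun i hi => Or.inr ⟨i, hi⟩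
    rcases Thick.or (hT 0) h2 with h3 | h3
    · exact h 0 h3
    · exact ih (fun i => hT i.succ) (fun i => h i.succ) h3

theorem const_of_loc {h : M → ℕ} (hd : ∀ c, DP M (fun t => h t = c)) {t t' : M} (htt : t ≤ t')
    (hl : ∀ s, t ≤ s → s ≤ t' → ∃ a b, a < s ∧ s < b ∧ ∀ s', a < s' → s' < b → h s' = h s) : h t' = h t := by
  by_contra hne
  have hD : DP M (fun s => t ≤ s ∧ s ≤ t' ∧ ¬ h s = h t) := by
    have := hd (h t)
    exact dfb
  obtain ⟨c, h1, h2⟩ := (OLine.tame _ hD).glb t' ⟨htt, le_rfl, hne⟩ t (fun y hy => hy.1)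
  have hct' : c ≤ t' := h1 t' ⟨htt, le_rfl, hne⟩
  have htc : t ≤ c := by
    by_contra hc
    obtain ⟨y, hy, hy'⟩ := h2 t (not_le.1 hc)
    exact absurd hy.1 (not_le.2 hy')
  obtain ⟨a, b, ha, hb, hc⟩ := hl c htc hct'
  by_cases he : h c = h t
  · obtain ⟨y, hy, hy'⟩ := h2 b hb
    exact hy.2.2 ((hc y (ha.trans_le (h1 y hy)) hy').trans he)
  · have htc' : t < c := lt_of_le_of_ne htc (by rintro rfl; exact he rfl)
    obtain ⟨y, hy, hy'⟩ := exists_between (max_lt ha htc')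
    have := h1 y ⟨((le_max_right _ _).trans_lt hy).le, hy'.le.trans hct', by
      rw [hc y ((le_max_left _ _).trans_lt hy) (hy'.trans hb)]; exact he⟩
    exact absurd this (not_le.2 hy')

theorem gap_exists {S : M → Prop} (hf : {t | S t}.Finite) : ∀ j i : ℕ, i + j = cnt S →
    ∃ t, ¬ S t ∧ (cnt fun y => S y ∧ t < y) = i := by
  intro j
  induction j with
  | zero =>
    intro i hi
    obtain ⟨z, hz⟩ := fin_bot hf
    refine ⟨z, fun h => lt_irrefl _ (hz z h), ?_⟩
    rw [Nat.add_zero] at hi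
    rw [hi]
    exact cnt_congr fun t => ⟨fun h => h.1, fun h => ⟨h, hz t h⟩⟩
  | succ j ih =>
    intro i hi
    obtain ⟨t, ht, hc⟩ := ih (i + 1) (by omega)
    have hfin : {y | S y ∧ t < y}.Finite := hf.subset fun y h => h.1
    have hex : ∃ y, S y ∧ t < y := by
      by_contra hcon
      rw [(cnt_eq_zero hfin).2 (fun y hy => hcon ⟨y, hy⟩)] at hc
      omega
    obtain ⟨y, hy, hmin⟩ := fin_first hfin hex
    obtain ⟨z, hz, hz'⟩ := fin_right hf y
    obtain ⟨t', h1, h2⟩ := exists_between hz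
    have hS : ¬ S t' := hz' t' h1 h2
    refine ⟨t', hS, ?_⟩
    have e := cnt_split hf (hy.2.trans h1) hS
    have : (cnt fun w => S w ∧ t < w ∧ w < t') = 1 := by
      rw [cnt_eq_one (hf.subset fun y h => h.1)]
      refine ⟨⟨y, hy.1, hy.2, h1⟩, ?_⟩
      rintro ⟨w, w', hw, h3, h4⟩
      exact hz' w' ((hmin w ⟨h3.1, h3.2.1⟩).trans_lt hw) (h4.2.2.trans h2) h4.1
    omega

variable (M) in
/-- locally constant functions are bounded off a thin set -/
def LB (n : ℕ) : Prop := ∀ h : Pw M n → ℕ, (∀ c, DP M (fun x => h x = c)) → ∀ T : Pw M n → Prop, DP M T →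
  ¬ Thick n T → (∀ x, ¬ T x → Nb n x (fun y => h y = h x)) →
  ∃ T' : Pw M n → Prop, DP M T' ∧ ¬ Thick n T' ∧ ∃ K, ∀ x, ¬ T' x → h x ≤ K

theorem LB.zero : LB M 0 := fun h _ _ _ _ _ =>
  ⟨fun _ => False, DP.false, Thick.empty, h PUnit.unit, fun x _ => le_rfl⟩

theorem LB.succ {n : ℕ} (hB : LB M n) (hU : UF M (Pw M n)) : LB M (n + 1) := by
  intro h hh T hT tT hl
  obtain ⟨h, rfl⟩ : ∃ h' : Pw M n × M → ℕ, h' = h := ⟨h, rfl⟩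
  obtain ⟨T, rfl⟩ : ∃ h' : Pw M n × M → Prop, h' = T := ⟨T, rfl⟩
  replace hh : ∀ c, DP M (fun x : Pw M n × M => h x = c) := hh
  replace hT : DP M T := hT
  obtain ⟨Z, hZ⟩ : ∃ Z : Pw M n → Prop, Z = fun x => Big fun t : M => T (x, t) := ⟨_, rfl⟩
  have dZ : DP M Z := by rw [hZ]; exact DP.big hT
  have tZ : ¬ Thick n Z := by rw [hZ]; exact tT
  obtain ⟨A, hA⟩ : ∃ A : Pw M n × M → Prop, A = fun p => T p ∧ ¬ Z p.1 := ⟨_, rfl⟩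
  have dA : DP M A := by rw [hA]; exact dfb
  have hAT : ∀ x t, ¬ Z x → ¬ A (x, t) → ¬ T (x, t) := by
    intro x t h1 h2 h3; apply h2; rw [hA]; exact ⟨h3, h1⟩
  have fA : ∀ x, {t | A (x, t)}.Finite := by
    intro x
    by_cases hx : Z x
    · convert Set.finite_empty
      ext t
      simp [hA, hx]
    · refine Set.Finite.subset (s := {t | T (x, t)}) ?_ (fun t ht => by rw [hA] at ht; exact ht.1)
      rw [hZ] at hx
      exact (not_big (M := M) (S := fun t => T (x, t)) dfb).1 hx
  obtain ⟨K0, hK0⟩ := hU A dA fA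
  obtain ⟨T1, dT1, tT1, hT1⟩ := lc dA fA
  obtain ⟨gap, hgap⟩ : ∃ gap : ℕ → Pw M n × M → Prop, gap = fun i p => ¬ A p ∧ (cnt fun y => A (p.1, y) ∧ p.2 < y) = i := ⟨_, rfl⟩
  have dgap : ∀ i, DP M (gap i) := by
    intro i
    rw [hgap]
    refine dA.not.and ?_
    exact DP.cnt_eq (A := fun q : (Pw M n × M) × M => A (q.1.1, q.2) ∧ q.1.2 < q.2) dfb
      (fun p => (fA p.1).subset fun t ht => ht.1) i
  have gap_const' : ∀ i x t t', ¬ Z x → gap i (x, t) → gap i (x, t') → t ≤ t' → h (x, t') = h (x, t) := by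
    intro i x t t' hx h1 h2 htt
    have hd : ∀ c, DP M (fun t => h (x, t) = c) := by
      intro c
      have := hh c
      exact DP.comp this (f := fun t => (x, t)) dfb
    refine const_of_loc hd htt ?_
    intro s hs hs'
    have hnA : ¬ A (x, s) := by
      intro hAs
      rw [hgap] at h1 h2
      have hs1 : t < s := lt_of_le_of_ne hs (by rintro rfl; exact h1.1 hAs)
      have hs2 : s < t' := lt_of_le_of_ne hs' (by rintro rfl; exact h2.1 hAs)
      have e := cnt_split (fA x) (hs1.trans hs2) h2.1
      have h3 : (cnt fun y => A (x, y) ∧ t < y) = i := h1.2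
      have h4 : (cnt fun y => A (x, y) ∧ t' < y) = i := h2.2
      have h5 : (cnt fun y => A (x, y) ∧ t < y ∧ y < t') = 0 := by omega
      rw [cnt_eq_zero ((fA x).subset fun y h => h.1)] at h5
      exact h5 s ⟨hAs, hs1, hs2⟩
    obtain ⟨a, b, ha, hb, hab⟩ := hl (x, s) (hAT x s hx hnA)
    exact ⟨a, b, ha, hb, hab.self⟩
  have gap_const : ∀ i x t t', ¬ Z x → gap i (x, t) → gap i (x, t') → h (x, t') = h (x, t) := by
    intro i x t t' hx h1 h2
    rcases le_total t t' with h3 | h3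
    · exact gap_const' i x t t' hx h1 h2 h3
    · exact (gap_const' i x t' t hx h2 h1 h3).symm
  classical
  obtain ⟨g, hg⟩ : ∃ g : ℕ → Pw M n → ℕ, g = fun i x => if hx : ¬ Z x ∧ ∃ t, gap i (x, t) then h (x, hx.2.choose) else 0 := ⟨_, rfl⟩
  have g1 : ∀ i x t, ¬ Z x → gap i (x, t) → g i x = h (x, t) := by
    intro i x t h1 h2
    have hx : ¬ Z x ∧ ∃ t, gap i (x, t) := ⟨h1, t, h2⟩
    rw [hg]
    simp only
    rw [dif_pos hx]
    exact gap_const i x _ _ h1 h2 hx.2.choose_spec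
  have g0 : ∀ i x, ¬ (¬ Z x ∧ ∃ t, gap i (x, t)) → g i x = 0 := by
    intro i x hx
    rw [hg]
    exact dif_neg hx
  have dg : ∀ i c, DP M (fun x => g i x = c) := by
    intro i c
    have h1 := hh c
    have h2 := dgap i
    have h3 : DP M (fun x => (¬ Z x ∧ ∃ t, gap i (x, t) ∧ h (x, t) = c) ∨ ((¬ (¬ Z x ∧ ∃ t, gap i (x, t))) ∧ 0 = c)) := by
      refine DP.or (dZ.not.and ?_) dfb
      apply DP.ex2
      exact h2.and h1
    refine h3.congr fun x => ?_
    by_cases hx : ¬ Z x ∧ ∃ t, gap i (x, t)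
    · obtain ⟨a, t, ht⟩ := hx
      rw [g1 i x t a ht]
      constructor
      · exact fun h => Or.inl ⟨a, t, ht, h⟩
      · rintro (⟨_, t', ht', h⟩ | ⟨h, _⟩)
        · rw [← h]; exact gap_const i x _ _ a ht' ht
        · exact absurd ⟨a, t, ht⟩ h
    · rw [g0 i x hx]
      constructor
      · exact fun h => Or.inr ⟨hx, h⟩
      · rintro (⟨h1, t, h2, _⟩ | ⟨_, h⟩)
        · exact absurd ⟨h1, t, h2⟩ hx
        · exact h
  have gl : ∀ i x0, ¬ (T1 x0 ∨ Z x0 ∨ Bd n Z x0) → Nb n x0 (fun x => g i x = g i x0) := by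
    intro i x0 hx0
    rw [not_or, not_or] at hx0
    obtain ⟨q1, q2, q3⟩ := hx0
    have nZ : Nb n x0 (fun x => ¬ Z x) := (not_bd q3).mono fun x hx h => q2 (hx.1 h)
    obtain ⟨la, lb⟩ := hT1 x0 q1
    by_cases hx : ∃ t, gap i (x0, t)
    · obtain ⟨t, ht⟩ := hx
      obtain ⟨z, hz, hz'⟩ := fin_right (fA x0) t
      obtain ⟨s, h1, h2, h3⟩ := la t z hz
      have hs : gap i (x0, s) := by
        have := h3.self.1
        rw [hgap] at ht ⊢
        refine ⟨this, ?_⟩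
        have e := cnt_split (fA x0) h1 this
        have h4 : (cnt fun y => A (x0, y) ∧ t < y) = i := ht.2
        have h5 : (cnt fun y => A (x0, y) ∧ t < y ∧ y < s) = 0 := by
          rw [cnt_eq_zero ((fA x0).subset fun y h => h.1)]
          rintro y ⟨a1, a2, a3⟩
          exact hz' y a2 (a3.trans h2) a1
        show (cnt fun y => A (x0, y) ∧ s < y) = i
        omega
      have hT0 : ¬ T (x0, s) := hAT x0 s q2 h3.self.1
      have h4 := Nb.slice (hl (x0, s) hT0)
      refine ((nZ.and h3).and h4).mono fun x hx => ?_
      have hgx : gap i (x, s) := by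
        rw [hgap] at hs ⊢
        exact ⟨hx.1.2.1, hx.1.2.2.trans hs.2⟩
      rw [g1 i x s hx.1.1 hgx, g1 i x0 s q2 hs]
      exact hx.2
    · refine lb.mono fun x hx' => ?_
      have hle : ∀ x, (∃ t, gap i (x, t)) ↔ i ≤ cnt fun y => A (x, y) := by
        intro x
        constructor
        · rintro ⟨t, ht⟩
          rw [hgap] at ht
          rw [← ht.2]
          exact cnt_mono (fA x) fun y h => h.1
        · intro hi
          obtain ⟨t, ht⟩ := gap_exists (fA x) ((cnt fun y => A (x, y)) - i) i (by omega)
          refine ⟨t, ?_⟩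
          rw [hgap]
          exact ht
      rw [g0 i x0 (fun h => hx h.2), g0 i x (fun h => hx ?_)]
      have h := h.2
      rw [hle] at h ⊢
      omega
  have tTg : ¬ Thick n (fun x => T1 x ∨ Z x ∨ Bd n Z x) := by
    intro h
    rcases Thick.or dT1 h with h | h
    · exact tT1 h
    rcases Thick.or dZ h with h | h
    · exact tZ h
    · exact Bd.thin dZ h
  have hBg := fun i => hB (g i) (dg i) _ (dT1.or (dZ.or (DP.bd dZ))) tTg (gl i)
  choose T' dT' tT' K hK using hBg
  refine ⟨fun p => T p ∨ (Z p.1 ∨ ∃ i : Fin (K0 + 1), T' i p.1), ?_, ?_, ∑ i ∈ Finset.range (K0 + 1), K i, ?_⟩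
  · have : ∀ i : Fin (K0+1), DP M (T' i) := fun i => dT' i
    have h1 : DP M (fun x => ∃ i : Fin (K0 + 1), T' i x) := DP.finEx this
    have h2 : DP M (fun x => Z x ∨ ∃ i : Fin (K0 + 1), T' i x) := dZ.or h1
    have h3 : DP M (fun p : Pw M n × M => T p ∨ (Z p.1 ∨ ∃ i : Fin (K0 + 1), T' i p.1)) := hT.or (DP.fst h2)
    exact h3
  · intro hth
    have hth' : Thick n (fun x => Z x ∨ (Z x ∨ ∃ i : Fin (K0 + 1), T' i x)) := by
      refine Thick.mono (d := n) hth fun x hx => ?_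
      by_cases hc : Z x ∨ ∃ i : Fin (K0 + 1), T' i x
      · exact Or.inr hc
      · left
        rw [hZ]
        exact hx.mono fun t ht => ht.resolve_right hc
    rcases Thick.or dZ hth' with h1 | h1
    · exact tZ h1
    rcases Thick.or dZ h1 with h1 | h1
    · exact tZ h1
    · exact Thick.finEx (fun i => dT' i) (fun i => tT' i) h1
  · rintro ⟨x, t⟩ hx
    rw [not_or, not_or] at hx
    obtain ⟨a1, a2, a3⟩ := hx
    push Not at a3
    have hA' : ¬ A (x, t) := by rw [hA]; exact fun h => a1 h.1
    have hle : (cnt fun y => A (x, y) ∧ t < y) ≤ K0 := (cnt_mono (fA x) fun y h => h.1).trans (hK0 x)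
    have hgx : gap (cnt fun y => A (x, y) ∧ t < y) (x, t) := by
      rw [hgap]; exact ⟨hA', rfl⟩
    rw [← g1 _ x t a2 hgx]
    refine (hK _ x (a3 ⟨_, Nat.lt_succ_of_le hle⟩)).trans ?_
    exact Finset.single_le_sum (f := K) (fun i _ => Nat.zero_le _) (Finset.mem_range.2 (Nat.lt_succ_of_le hle))

theorem pw_split (a : ℕ) : ∀ b, ∃ f : Pw M (a + b) → Pw M a × Pw M b, DM M f ∧ Function.Surjective f
  | 0 => ⟨fun x => (x, PUnit.unit), DM.pair DM.id (DM.const _), fun ⟨x, y⟩ => ⟨x, rfl⟩⟩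
  | b + 1 => by
    obtain ⟨f, hf, hs⟩ := pw_split a b
    have h1 : DM M (fun p : Pw M (a + b) × M => ((f p.1).1, ((f p.1).2, p.2))) :=
      DM.pair (DM.fst (DM.comp hf DM.fst')) (DM.pair (DM.snd (DM.comp hf DM.fst')) DM.snd')
    refine ⟨fun p : Pw M (a + b) × M => ((f p.1).1, ((f p.1).2, p.2)), h1, ?_⟩
    rintro ⟨x, y, t⟩
    obtain ⟨z, hz⟩ := hs (x, y)
    exact ⟨(z, t), congrArg (fun q : Pw M a × Pw M b => ((q.1, (q.2, t)) : Pw M a × (Pw M b × M))) hz⟩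

theorem UF.split {a b : ℕ} (h : UF M (Pw M (a + b))) : UF M (Pw M a × Pw M b) := by
  obtain ⟨f, hf, hs⟩ := pw_split (M := M) a b
  exact h.surj hf hs

theorem uf_tr : ∀ a b : ℕ, (∀ j < a + b, UF M (Pw M j)) → ∀ Z : Pw M a → Prop, DP M Z → ¬ Thick a Z →
    ∀ A : (Pw M a × Pw M b) × M → Prop, DP M A → (∀ p, {t | A (p, t)}.Finite) →
    ∃ K, ∀ z w, Z z → (cnt fun t => A ((z, w), t)) ≤ K
  | 0, b, _, Z, _, hZ, _, _, _ => ⟨0, fun z w h => absurd h hZ⟩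
  | a + 1, b, hU, Z, hZ, tZ, A, hA, fA => by
    obtain ⟨Z, rfl⟩ : ∃ h' : Pw M a × M → Prop, h' = Z := ⟨Z, rfl⟩
    obtain ⟨A, rfl⟩ : ∃ h' : ((Pw M a × M) × Pw M b) × M → Prop, h' = A := ⟨A, rfl⟩
    replace hZ : DP M Z := hZ
    replace hA : DP M A := hA
    obtain ⟨Y, hY⟩ : ∃ Y : Pw M a → Prop, Y = fun x => Big fun t : M => Z (x, t) := ⟨_, rfl⟩
    have dY : DP M Y := by rw [hY]; exact DP.big hZ
    have tY : ¬ Thick a Y := by rw [hY]; exact tZ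
    have d1 : DP M (fun p : (Pw M a × Pw M b) × M => ¬ Y p.1.1 ∧ ∃ s, Z (p.1.1, s) ∧ A (((p.1.1, s), p.1.2), p.2)) := dfb
    obtain ⟨K1, hK1⟩ := (hU (a + b) (by omega)).split _ d1 (by
      rintro ⟨x, w⟩
      by_cases hx : Y x
      · convert Set.finite_empty
        ext t
        simp [hx]
      · have hfin : {s | Z (x, s)}.Finite := by
          rw [hY] at hx
          exact (not_big (M := M) (S := fun t => Z (x, t)) dfb).1 hx
        refine (hfin.biUnion fun s _ => fA ((x, s), w)).subset ?_
        rintro t ⟨_, s, hs, ht⟩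
        exact Set.mem_biUnion (show s ∈ {s | Z (x, s)} from hs) ht)
    have d2 : DP M (fun p : (Pw M a × (Pw M b × M)) × M => A (((p.1.1, p.1.2.2), p.1.2.1), p.2)) := dfb
    obtain ⟨K2, hK2⟩ := uf_tr a (b + 1) (fun j hj => hU j (by omega)) Y dY tY
      (fun p : (Pw M a × (Pw M b × M)) × M => A (((p.1.1, p.1.2.2), p.1.2.1), p.2)) d2 (fun p => fA ((p.1, p.2.2), p.2.1))
    refine ⟨K1 + K2, ?_⟩
    rintro ⟨x, s⟩ w hz
    by_cases hx : Y x
    · exact (hK2 x (w, s) hx).trans (by omega)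
    · refine le_trans ?_ ((hK1 (x, w)).trans (by omega))
      refine cnt_mono ?_ fun t ht => ⟨hx, s, hz, ht⟩
      · have hfin : {s | Z (x, s)}.Finite := by
          rw [hY] at hx
          exact (not_big (M := M) (S := fun t => Z (x, t)) dfb).1 hx
        refine (hfin.biUnion fun s _ => fA ((x, s), w)).subset ?_
        rintro t ⟨_, s, hs, ht⟩
        exact Set.mem_biUnion (show s ∈ {s | Z (x, s)} from hs) ht

theorem uf_pw : ∀ n, UF M (Pw M n) := by
  intro n
  induction n using Nat.strong_induction_on with
  | _ n ih =>
    have hLB : ∀ j, j ≤ n → LB M j := by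
      intro j
      induction j with
      | zero => exact fun _ => LB.zero
      | succ j ihj => exact fun hj => LB.succ (ihj (by omega)) (ih j (by omega))
    intro A hA fA
    obtain ⟨T, dT, tT, hT⟩ := lc hA fA
    obtain ⟨T', dT', tT', K, hK⟩ := hLB n le_rfl (fun x => cnt fun y => A (x, y)) (fun c => DP.cnt_eq hA fA c) T dT tT
      (fun x hx => (hT x hx).2)
    obtain ⟨K2, hK2⟩ := uf_tr n 0 (fun j hj => ih j (by omega)) T' dT' tT' (fun p => A (p.1.1, p.2)) dfb (fun p => fA p.1)
    refine ⟨K + K2, fun x => ?_⟩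
    by_cases hx : T' x
    · exact (hK2 x PUnit.unit hx).trans (by omega)
    · exact (hK x hx).trans (by omega)

/-- coordinates -/
def Pw.toFin : ∀ n, Pw M n → Fin n → M
  | 0, _ => fun i => i.elim0
  | n + 1, x => Fin.snoc (α := fun _ => M) (Pw.toFin n x.1) x.2

def Pw.ofFin : ∀ n, (Fin n → M) → Pw M n
  | 0, _ => PUnit.unit
  | n + 1, v => (Pw.ofFin n (fun i => v i.castSucc), v (Fin.last n))

theorem Pw.toFin_ofFin : ∀ n (v : Fin n → M), Pw.toFin n (Pw.ofFin n v) = v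
  | 0, v => funext fun i => i.elim0
  | n + 1, v => by
    funext i
    refine Fin.lastCases ?_ (fun i => ?_) i
    · simp [Pw.toFin, Pw.ofFin]
    · simp [Pw.toFin, Pw.ofFin, Pw.toFin_ofFin n]

theorem Pw.ofFin_toFin : ∀ n (x : Pw M n), Pw.ofFin n (Pw.toFin n x) = x
  | 0, v => rfl
  | n + 1, (x, t) => by
    simp [Pw.toFin, Pw.ofFin, Pw.ofFin_toFin n]
    rfl

theorem DM.pwOfFin : ∀ n, DM M (Pw.ofFin (M := M) n)
  | 0 => DM.const _
  | n + 1 => by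
    have h := DM.pwOfFin n
    have h2 : DM M (fun v : Fin (n+1) → M => (fun i : Fin n => v i.castSucc)) := DM.lam fun i => DM.app DM.id _
    have h1 : DM M (fun v : Fin (n+1) → M => (Pw.ofFin n (fun i => v i.castSucc), v (Fin.last n))) :=
      DM.pair (DM.comp h h2) (DM.app DM.id _)
    exact h1

theorem DM.pwToFin (n : ℕ) : DM M (Pw.toFin (M := M) n) := by
  have : DP M (fun p : Pw M n × (Fin n → M) => p.1 = Pw.ofFin n p.2) := by
    have h := DM.pwOfFin (M := M) n
    exact DP.eq DM.fst' (DM.comp h DM.snd')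
  have h2 : DP M (fun p : Pw M n × (Fin n → M) => Pw.toFin n p.1 = p.2) := this.congr fun p => by
    constructor
    · intro h; rw [← h, Pw.ofFin_toFin]
    · intro h; rw [h, Pw.toFin_ofFin]
  unfold DM; exact h2

theorem exists_surj (X : Type u) [Sp M X] : ∃ n, ∃ f : (Fin n → M) → X, DM M f ∧ Function.Surjective f := by
  obtain ⟨n, ⟨e⟩⟩ := Finite.exists_equiv_fin (Sp.ι M X)
  refine ⟨n, fun v => (Sp.e (M := M)).symm (fun i => v (e i)), ?_, ?_⟩
  · have : DP M (fun p : (Fin n → M) × X => (Sp.e (M := M)).symm (fun i => p.1 (e i)) = p.2) := by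
      refine DP.pre (P := fun q : X × X => q.1 = q.2) (f := fun p : (Fin n → M) × X => ((Sp.e (M := M)).symm (fun i => p.1 (e i)), p.2))
        DP.eq' (Sum.elim (fun i => Sum.inl (e i, (0 : Fin 1))) Sum.inr) ?_
      rintro ⟨x, z⟩ (i | i)
      · simp [Sp.e, Equiv.sumArrowEquivProdArrow]
      · simp [Sp.e, Equiv.sumArrowEquivProdArrow]
    unfold DM; exact this
  · intro x
    refine ⟨fun i => Sp.e x (e.symm i), ?_⟩
    simp

theorem uf (X : Type u) [Sp M X] : UF M X := by
  obtain ⟨n, f, hf, hs⟩ := exists_surj (M := M) X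
  refine (uf_pw n).surj (f := fun x => f (Pw.toFin n x)) (DM.comp hf (DM.pwToFin n)) ?_
  intro x
  obtain ⟨v, rfl⟩ := hs x
  exact ⟨Pw.ofFin n v, congrArg f (Pw.toFin_ofFin n v)⟩
end

section
variable {M : Type u} [LinearOrder M] [OM M]
variable {X Y U : Type u} [Sp M X] [Sp M Y] [Sp M U]

/-- frontier points -/
def Fr (S : M → Prop) (t : M) : Prop := ¬ ∃ a b, a < t ∧ t < b ∧ ∀ s, a < s → s < b → (S s ↔ S t)

theorem DP.fr {R : X × M → Prop} (hR : DP M R) : DP M (fun p : X × M => Fr (fun t => R (p.1, t)) p.2) := by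
  unfold Fr
  exact dfb

theorem fr_finite {S : M → Prop} (hS : DP M S) : {t | Fr S t}.Finite := by
  have hd : DP M (Fr S) := by
    unfold Fr
    exact dfb
  rw [← not_big hd]
  rintro ⟨a, b, hab, h⟩
  obtain ⟨a', b', h1, h2, h3, h4⟩ := Big.or' (T := fun t => ¬ S t) hS hab (fun x _ _ => em _)
  obtain ⟨c, hc1, hc2⟩ := exists_between h3
  refine h c (h1.trans_lt hc1) (hc2.trans_le h2) ⟨a', b', hc1, hc2, fun s hs1 hs2 => ?_⟩
  rcases h4 with h4 | h4
  · exact ⟨fun _ => h4 c hc1 hc2, fun _ => h4 s hs1 hs2⟩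
  · exact ⟨fun h => absurd h (h4 s hs1 hs2), fun h => absurd h (h4 c hc1 hc2)⟩

theorem fr_const {S : M → Prop} (hS : DP M S) {t t' : M} (htt : t ≤ t')
    (h : ∀ s, t ≤ s → s ≤ t' → ¬ Fr S s) : S t ↔ S t' := by
  classical
  have := const_of_loc (h := fun t => if S t then 1 else 0) (fun c => by
    have : DP M (fun t => (S t ∧ 1 = c) ∨ (¬ S t ∧ 0 = c)) := dfb
    refine this.congr fun t => ?_
    by_cases h : S t <;> simp [h]) htt (fun s h1 h2 => by
      have h3 := h s h1 h2
      unfold Fr at h3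
      rw [not_not] at h3
      obtain ⟨a, b, ha, hb, hc⟩ := h3
      exact ⟨a, b, ha, hb, fun s' h1 h2 => by simp [hc s' h1 h2]⟩)
  by_cases h1 : S t <;> by_cases h2 : S t' <;> simp_all

theorem fr_const_Ioc {S : M → Prop} (hS : DP M S) {b t : M} (hbt : b < t)
    (h : ∀ s, b < s → s ≤ t → ¬ Fr S s) : S t ↔ EvR S b := by
  have key : ∀ {S : M → Prop}, DP M S → (∀ s, b < s → s ≤ t → ¬ Fr S s) → EvR S b → S t := by
    rintro S hS h ⟨c, hc, hc'⟩
    obtain ⟨s, h1, h2⟩ := exists_between (lt_min hbt hc)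
    exact (fr_const hS (h2.trans_le (min_le_left _ _)).le (fun r h3 h4 => h r (h1.trans_le h3) h4)).1
      (hc' s h1 (h2.trans_le (min_le_right _ _)))
  refine ⟨fun hS' => ?_, key hS h⟩
  rcases (OLine.tame S hS).right b with h1 | h1
  · exact h1
  · refine absurd hS' (key hS.not (fun s h2 h3 h4 => h s h2 h3 ?_) h1)
    unfold Fr at h4 ⊢
    simpa only [not_iff_not] using h4

/-- eventually at minus infinity -/
def EvB (S : M → Prop) : Prop := ∃ b, ∀ y, y < b → S y

theorem fr_const_Iic {S : M → Prop} (hS : DP M S) {t : M}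
    (h : ∀ s, s ≤ t → ¬ Fr S s) : S t ↔ EvB S := by
  have key : ∀ {S : M → Prop}, DP M S → (∀ s, s ≤ t → ¬ Fr S s) → EvB S → S t := by
    rintro S hS h ⟨c, hc⟩
    obtain ⟨s, h1⟩ := exists_lt (min t c)
    exact (fr_const hS (h1.trans_le (min_le_left _ _)).le (fun r h3 h4 => h r h4)).1
      (hc s (h1.trans_le (min_le_right _ _)))
  refine ⟨fun hS' => ?_, key hS h⟩
  obtain ⟨b, h1 | h1⟩ := (OLine.tame S hS).bot
  · exact ⟨b, h1⟩
  · refine absurd hS' (key hS.not (fun s h3 h4 => h s h3 ?_) ⟨b, h1⟩)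
    unfold Fr at h4 ⊢
    simpa only [not_iff_not] using h4

theorem rank_lt {S : M → Prop} (hf : {t | S t}.Finite) {b b' : M} (hb : S b) (h : b < b') :
    (cnt fun t => S t ∧ t < b) < cnt fun t => S t ∧ t < b' := by
  unfold cnt
  refine Set.ncard_lt_ncard ?_ (hf.subset fun t h => h.1)
  refine ⟨fun t ht => ⟨ht.1, ht.2.trans h⟩, fun hc => ?_⟩
  exact lt_irrefl _ (hc (show b ∈ {t | S t ∧ t < b'} from ⟨hb, h⟩)).2

theorem rank_lt_cnt {S : M → Prop} (hf : {t | S t}.Finite) {b : M} (hb : S b) :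
    (cnt fun t => S t ∧ t < b) < cnt S := by
  unfold cnt
  refine Set.ncard_lt_ncard ?_ hf
  refine ⟨fun t ht => ht.1, fun hc => ?_⟩
  exact lt_irrefl _ (hc (show b ∈ {t | S t} from hb)).2

theorem rank_inj {S : M → Prop} (hf : {t | S t}.Finite) {b b' : M} (hb : S b) (hb' : S b')
    (h : (cnt fun t => S t ∧ t < b) = cnt fun t => S t ∧ t < b') : b = b' := by
  rcases lt_trichotomy b b' with h1 | h1 | h1
  · exact absurd (rank_lt hf hb h1) (by omega)
  · exact h1
  · exact absurd (rank_lt hf hb' h1) (by omega)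

theorem DP.rank {A : X × M → Prop} (hA : DP M A) (hf : ∀ x, {t | A (x, t)}.Finite) (j : ℕ) :
    DP M (fun p : X × M => (cnt fun t => A (p.1, t) ∧ t < p.2) = j) :=
  DP.cnt_eq (A := fun q : (X × M) × M => A (q.1.1, q.2) ∧ q.2 < q.1.2) dfb
      (fun p => (hf p.1).subset fun t ht => ht.1) j

/-- traces -/
def Tr {s : ℕ} (u : Fin s → U) (φ : U × Y → Prop) (X : Y → Prop) : Set (Set (Fin s)) :=
  {σ | ∃ y, X y ∧ ∀ i, i ∈ σ ↔ φ (u i, y)}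

variable (M) in
/-- trace bound -/
def TBd (d : ℕ) (X : Y → Prop) : Prop := ∀ (U : Type u) [Sp M U] (φ : U × Y → Prop), DP M φ →
  ∃ C, ∀ (s : ℕ) (u : Fin s → U), (Tr u φ X).ncard * (s + 1) ≤ C * (s + 1) ^ d

theorem TBd.empty {d : ℕ} {X : Y → Prop} (h : ∀ y, ¬ X y) : TBd M d X := by
  intro U _ φ _
  refine ⟨0, fun s u => ?_⟩
  have : Tr u φ X = ∅ := by
    ext σ
    simp [Tr, h]
  rw [this]
  simp

theorem TBd.punit {d : ℕ} {X : PUnit.{u+1} → Prop} : TBd M (d + 1) X := by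
  intro U _ φ _
  refine ⟨1, fun s u => ?_⟩
  have : (Tr u φ X).ncard ≤ 1 := by
    rw [Set.ncard_le_one]
    rintro σ ⟨y, _, h1⟩ τ ⟨z, _, h2⟩
    ext i
    rw [h1, h2]
  calc _ ≤ 1 * (s + 1) := Nat.mul_le_mul_right _ this
    _ ≤ _ := Nat.mul_le_mul_left _ (Nat.le_self_pow (by omega) _)

theorem TBd.step {d : ℕ} {X : Y × M → Prop} (hX : DP M X) (h1 : TBd M (d + 1) fun y => ∃ t, X (y, t))
    (h2 : TBd M d fun y => Big fun t => X (y, t)) : TBd M (d + 1) X := by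
  classical
  intro U _ φ hφ
  -- finite part
  have dB : DP M (fun y => Big fun t => X (y, t)) := DP.big hX
  obtain ⟨A, hA⟩ : ∃ A : Y × M → Prop, A = fun p => X p ∧ ¬ Big fun t => X (p.1, t) := ⟨_, rfl⟩
  have dA : DP M A := by rw [hA]; exact hX.and (DP.fst dB.not)
  have fA : ∀ y, {t | A (y, t)}.Finite := by
    intro y
    by_cases hy : Big fun t => X (y, t)
    · convert Set.finite_empty
      ext t
      simp [hA, hy]
    · refine Set.Finite.subset (s := {t | X (y, t)}) ?_ (fun t ht => by rw [hA] at ht; exact ht.1)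
      exact (not_big (M := M) (S := fun t => X (y, t)) dfb).1 hy
  obtain ⟨K1, hK1⟩ := uf Y A dA fA
  have c1 : ∀ j : Fin K1, ∃ C, ∀ (s : ℕ) (u : Fin s → U),
      (Tr u (fun q : U × Y => ∃ t, (A (q.2, t) ∧ (cnt fun t' => A (q.2, t') ∧ t' < t) = j) ∧ φ (q.1, (q.2, t)))
        (fun y => ∃ t, X (y, t))).ncard * (s + 1) ≤ C * (s + 1) ^ (d + 1) := by
    intro j
    apply h1 U
    have hr := DP.rank dA fA j
    have hr' : DP M (fun p : Y × M => A p ∧ (cnt fun t' => A (p.1, t') ∧ t' < p.2) = j) := dA.and hr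
    apply DP.ex2
    refine DP.and ?_ dfb
    exact DP.comp hr' (f := fun q : (U × Y) × M => (q.1.2, q.2)) dfb
  choose C1 hC1 using c1
  -- infinite part
  obtain ⟨F, hF⟩ : ∃ F : (U × Y) × M → Prop, F = fun p => Fr (fun t => φ (p.1.1, (p.1.2, t))) p.2 := ⟨_, rfl⟩
  have dF : DP M F := by
    rw [hF]
    exact DP.fr (R := fun p : (U × Y) × M => φ (p.1.1, (p.1.2, p.2))) dfb
  have fF : ∀ p, {t | F (p, t)}.Finite := by
    intro p
    rw [hF]
    exact fr_finite (S := fun t => φ (p.1, (p.2, t))) dfb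
  obtain ⟨K2, hK2⟩ := uf (U × Y) F dF fF
  obtain ⟨ψ, hψ⟩ : ∃ ψ : Fin K2 × Bool → (U × U) × Y → Prop, ψ = fun j q =>
    ∃ b, (F ((q.1.1, q.2), b) ∧ (cnt fun t' => F ((q.1.1, q.2), t') ∧ t' < b) = j.1) ∧
      ((j.2 = true ∧ φ (q.1.2, (q.2, b))) ∨ (j.2 = false ∧ EvR (fun t => φ (q.1.2, (q.2, t))) b)) := ⟨_, rfl⟩
  have c2 : ∀ j : Fin K2 × Bool, ∃ C, ∀ (s : ℕ) (u : Fin s → U × U),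
      (Tr u (ψ j) (fun y => Big fun t => X (y, t))).ncard * (s + 1) ≤ C * (s + 1) ^ d := by
    intro j
    apply h2 (U × U)
    have hr := DP.rank dF fF j.1
    have hr' : DP M (fun p : (U × Y) × M => F p ∧ (cnt fun t' => F (p.1, t') ∧ t' < p.2) = j.1) := dF.and hr
    rw [hψ]
    apply DP.ex2
    refine DP.and ?_ ?_
    · exact DP.comp hr' (f := fun q : ((U × U) × Y) × M => ((q.1.1.1, q.1.2), q.2)) dfb
    · unfold EvR
      exact dfb
  choose C2 hC2 using c2
  have dE : DP M (fun q : U × Y => EvB fun t => φ (q.1, (q.2, t))) := by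
    unfold EvB; exact dfb
  obtain ⟨C3, hC3⟩ := h2 U _ dE
  refine ⟨(∑ j, C1 j) + (∑ j, C2 j) + C3, fun s u => ?_⟩
  -- covering
  have hcov : Tr u φ X ⊆ (⋃ j : Fin K1, Tr u (fun q : U × Y => ∃ t, (A (q.2, t) ∧ (cnt fun t' => A (q.2, t') ∧ t' < t) = j) ∧ φ (q.1, (q.2, t)))
        (fun y => ∃ t, X (y, t))) ∪ ((⋃ i : Fin s, ⋃ j : Fin K2 × Bool, Tr (fun i' => (u i, u i')) (ψ j) (fun y => Big fun t => X (y, t))) ∪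
        Tr u (fun q : U × Y => EvB fun t => φ (q.1, (q.2, t))) (fun y => Big fun t => X (y, t))) := by
    rintro σ ⟨⟨y, t⟩, hx, hσ⟩
    by_cases hy : Big fun t => X (y, t)
    · right
      have hfin : {b | (∃ i, F ((u i, y), b)) ∧ b ≤ t}.Finite := by
        refine (Set.finite_iUnion fun i => fF (u i, y)).subset ?_
        rintro b ⟨⟨i, hi⟩, _⟩
        exact Set.mem_iUnion.2 ⟨i, hi⟩
      by_cases hne : {b | (∃ i, F ((u i, y), b)) ∧ b ≤ t}.Nonempty
      · left
        obtain ⟨b, ⟨⟨i, hi⟩, hbt⟩, hmax⟩ := Set.exists_max_image _ (fun x => x) hfin hne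
        have hj : (cnt fun t' => F ((u i, y), t') ∧ t' < b) < K2 := (rank_lt_cnt (fF (u i, y)) hi).trans_le (hK2 (u i, y))
        have huniq : ∀ b', (F ((u i, y), b') ∧ (cnt fun t' => F ((u i, y), t') ∧ t' < b') = (cnt fun t' => F ((u i, y), t') ∧ t' < b)) → b' = b :=
          fun b' h => rank_inj (fF (u i, y)) h.1 hi h.2
        rw [Set.mem_iUnion]
        refine ⟨i, ?_⟩
        rw [Set.mem_iUnion]
        rcases eq_or_lt_of_le hbt with he | hlt
        · refine ⟨(⟨_, hj⟩, true), y, hy, fun i' => ?_⟩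
          rw [hσ, hψ]
          constructor
          · intro h
            exact ⟨b, ⟨hi, rfl⟩, Or.inl ⟨rfl, by rw [he]; exact h⟩⟩
          · rintro ⟨b', hb', ⟨_, h⟩ | ⟨h, _⟩⟩
            · rw [huniq b' hb', he] at h; exact h
            · exact absurd h (by simp)
        · refine ⟨(⟨_, hj⟩, false), y, hy, fun i' => ?_⟩
          have hk := fr_const_Ioc (S := fun t => φ (u i', (y, t))) dfb hlt (fun s h1 h2 h3 => by
            have := hmax s ⟨⟨i', by rw [hF]; exact h3⟩, h2⟩
            exact absurd h1 (not_lt.2 this))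
          rw [hσ, hψ, hk]
          constructor
          · intro h
            exact ⟨b, ⟨hi, rfl⟩, Or.inr ⟨rfl, h⟩⟩
          · rintro ⟨b', hb', ⟨h, _⟩ | ⟨_, h⟩⟩
            · exact absurd h (by simp)
            · rw [huniq b' hb'] at h; exact h
      · right
        refine ⟨y, hy, fun i' => ?_⟩
        rw [hσ]
        exact fr_const_Iic (S := fun t => φ (u i', (y, t))) dfb (fun s h1 h2 => hne ⟨s, ⟨i', by rw [hF]; exact h2⟩, h1⟩)
    · left
      have hAt : A (y, t) := by rw [hA]; exact ⟨hx, hy⟩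
      rw [Set.mem_iUnion]
      refine ⟨⟨_, (rank_lt_cnt (fA y) hAt).trans_le (hK1 y)⟩, y, ⟨t, hx⟩, fun i => ?_⟩
      rw [hσ]
      constructor
      · exact fun h => ⟨t, ⟨hAt, rfl⟩, h⟩
      · rintro ⟨t', ht', h⟩
        rwa [rank_inj (fA y) ht'.1 hAt ht'.2] at h
  have hc := (Set.ncard_le_ncard hcov (Set.toFinite _)).trans ((Set.ncard_union_le _ _).trans
    (Nat.add_le_add (Set.ncard_iUnion_le_of_fintype _) ((Set.ncard_union_le _ _).trans (Nat.add_le_add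
      ((Set.ncard_iUnion_le_of_fintype _).trans (Finset.sum_le_sum fun i _ => Set.ncard_iUnion_le_of_fintype _)) le_rfl))))
  have e1 : (∑ j : Fin K1, (Tr u (fun q : U × Y => ∃ t, (A (q.2, t) ∧ (cnt fun t' => A (q.2, t') ∧ t' < t) = j) ∧ φ (q.1, (q.2, t)))
        (fun y => ∃ t, X (y, t))).ncard) * (s + 1) ≤ (∑ j, C1 j) * (s + 1) ^ (d + 1) := by
    rw [Finset.sum_mul, Finset.sum_mul]
    exact Finset.sum_le_sum fun j _ => hC1 j s u
  have e2 : (∑ i : Fin s, ∑ j : Fin K2 × Bool, (Tr (fun i' => (u i, u i')) (ψ j) (fun y => Big fun t => X (y, t))).ncard) * (s + 1)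
      ≤ s * ((∑ j, C2 j) * (s + 1) ^ d) := by
    rw [Finset.sum_mul]
    refine (Finset.sum_le_card_nsmul Finset.univ _ ((∑ j, C2 j) * (s + 1) ^ d) fun i _ => ?_).trans (by simp)
    rw [Finset.sum_mul, Finset.sum_mul]
    exact Finset.sum_le_sum fun j _ => hC2 j s _
  have e3 := hC3 s u
  refine (Nat.mul_le_mul_right (s + 1) hc).trans ?_
  rw [add_mul, add_mul]
  have hp : (s + 1) ^ (d + 1) = (s + 1) * (s + 1) ^ d := by ring
  rw [hp] at e1 ⊢
  have h4 : 0 ≤ (∑ j, C2 j) * (s + 1) ^ d := Nat.zero_le _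
  have h5 : 0 ≤ s * (C3 * (s + 1) ^ d) := Nat.zero_le _
  nlinarith

/-- small dimension -/
def SM : ∀ (k d : ℕ), (Pw M k → Prop) → Prop
  | 0, 0, X => ∀ x, ¬ X x
  | 0, _ + 1, _ => True
  | _ + 1, 0, X => ∀ x, ¬ X x
  | k + 1, d + 1, X => SM k (d + 1) (fun y => ∃ t : M, X (y, t)) ∧ SM k d (fun y => Big fun t : M => X (y, t))

theorem SM.tbd : ∀ (k d : ℕ) (X : Pw M k → Prop), DP M X → SM k d X → TBd M d X
  | 0, 0, X, _, h => TBd.empty h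
  | 0, d + 1, X, _, _ => TBd.punit
  | k + 1, 0, X, _, h => TBd.empty h
  | k + 1, d + 1, X, hX, h => by
    obtain ⟨X, rfl⟩ : ∃ h' : Pw M k × M → Prop, h' = X := ⟨X, rfl⟩
    exact TBd.step hX (SM.tbd k (d + 1) _ (DP.ex hX) h.1) (SM.tbd k d _ (DP.big hX) h.2)

theorem SM.thick : ∀ (k d : ℕ) (X : Pw M k → Prop), ¬ SM k d X → ∃ ι : Fin d → Fin k, Function.Injective ι ∧
    Thick d (fun z => ∃ x, X x ∧ ∀ i, Pw.toFin k x (ι i) = Pw.toFin d z i)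
  | 0, 0, X, h => by
    unfold SM at h
    push Not at h
    obtain ⟨x, hx⟩ := h
    exact ⟨fun i => i.elim0, fun i => i.elim0, x, hx, fun i => i.elim0⟩
  | 0, d + 1, X, h => absurd trivial h
  | k + 1, 0, X, h => by
    unfold SM at h
    push Not at h
    obtain ⟨x, hx⟩ := h
    exact ⟨fun i => i.elim0, fun i => i.elim0, x, hx, fun i => i.elim0⟩
  | k + 1, d + 1, X, h => by
    unfold SM at h
    rw [not_and_or] at h
    rcases h with h | h
    · obtain ⟨ι, hι, ht⟩ := SM.thick k (d + 1) _ h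
      refine ⟨fun i => (ι i).castSucc, fun i j h => hι (Fin.castSucc_injective _ h), ht.mono ?_⟩
      rintro z ⟨x, ⟨t, hx⟩, hz⟩
      refine ⟨(x, t), hx, fun i => ?_⟩
      rw [← hz]
      simp [Pw.toFin]
    · obtain ⟨ι, hι, ht⟩ := SM.thick k d _ h
      refine ⟨Fin.snoc (α := fun _ => Fin (k + 1)) (fun i => (ι i).castSucc) (Fin.last k), ?_, ?_⟩
      · intro i j
        refine Fin.lastCases ?_ (fun i => ?_) i
        · refine Fin.lastCases ?_ (fun j => ?_) j
          · simp
          · simp only [Fin.snoc_last, Fin.snoc_castSucc]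
            exact fun h => absurd h.symm (Fin.castSucc_lt_last _).ne
        · refine Fin.lastCases ?_ (fun j => ?_) j
          · simp only [Fin.snoc_last, Fin.snoc_castSucc]
            exact fun h => absurd h (Fin.castSucc_lt_last _).ne
          · simp only [Fin.snoc_castSucc]
            exact fun h => congrArg _ (hι (Fin.castSucc_injective _ h))
      · refine Thick.mono (d := d) ht ?_
        rintro z ⟨x, hx, hz⟩
        refine hx.mono fun t ht => ⟨(x, t), ht, fun i => ?_⟩
        refine Fin.lastCases ?_ (fun i => ?_) i
        · simp [Pw.toFin]
        · simp [Pw.toFin, hz]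
end

theorem extend_inj {A B α : Type*} {e : A → B} (he : Function.Injective e) {w w' : B → α} {v v' : A → α}
    (h1 : w ∘ e = w' ∘ e) (h2 : Function.extend e v w = Function.extend e v' w') : w = w' ∧ v = v' := by
  constructor
  · funext b
    by_cases hb : ∃ a, e a = b
    · obtain ⟨a, rfl⟩ := hb
      exact congrFun h1 a
    · have := congrFun h2 b
      rwa [Function.extend_apply' _ _ _ hb, Function.extend_apply' _ _ _ hb] at this
  · funext a
    have := congrFun h2 (e a)
    rwa [he.extend_apply, he.extend_apply] at this

theorem frac1 {α : Type} [Finite α] [Nonempty α] {n m : ℕ} (J : Set (Fin n → α))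
    (h : ∀ w : Fin m → α, ∃ e : Fin n ↪ Fin m, w ∘ e ∈ J) :
    Nat.card α ^ n ≤ Nat.card (Fin n ↪ Fin m) * Nat.card J := by
  choose e he using h
  have hinj : Function.Injective (fun p : (Fin m → α) × (Fin n → α) =>
      ((e p.1, (⟨p.1 ∘ e p.1, he p.1⟩ : J), Function.extend (e p.1) p.2 p.1) : (Fin n ↪ Fin m) × J × (Fin m → α))) := by
    rintro ⟨w, v⟩ ⟨w', v'⟩ h
    simp only [Prod.mk.injEq, Subtype.mk.injEq] at h
    obtain ⟨h1, h2, h3⟩ := h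
    rw [h1] at h2 h3
    obtain ⟨h4, h5⟩ := extend_inj (e w').injective h2 h3
    rw [h4, h5]
  have := Nat.card_le_card_of_injective _ hinj
  rw [Nat.card_prod, Nat.card_prod, Nat.card_prod, Nat.card_fun, Nat.card_fun] at this
  simp only [Nat.card_eq_fintype_card, Fintype.card_fin] at this ⊢
  have hpos : 0 < Nat.card α ^ m := pow_pos Nat.card_pos _
  refine Nat.le_of_mul_le_mul_left ?_ hpos
  calc _ ≤ _ := this
    _ = _ := by ring

theorem frac_deg {α : Type} [Finite α] [Nonempty α] {s : ℕ} (P : α → Prop) (p : Fin s) :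
    Nat.card {g : Fin s → α // P (g p)} * Nat.card α ≤ Nat.card {a // P a} * Nat.card α ^ s := by
  have hinj : Function.Injective (fun x : {g : Fin s → α // P (g p)} × α =>
      (((⟨x.1.1 p, x.1.2⟩ : {a // P a}), Function.update x.1.1 p x.2) : {a // P a} × (Fin s → α))) := by
    rintro ⟨⟨g, hg⟩, a⟩ ⟨⟨g', hg'⟩, a'⟩ h
    simp only [Prod.mk.injEq, Subtype.mk.injEq] at h ⊢
    obtain ⟨h1, h2⟩ := h
    constructor
    · funext i
      by_cases hi : i = p
      · rw [hi, h1]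
      · have := congrFun h2 i
        simpa [hi] using this
    · have := congrFun h2 p
      simpa using this
  have := Nat.card_le_card_of_injective _ hinj
  rw [Nat.card_prod, Nat.card_prod, Nat.card_fun] at this
  simpa using this

theorem frac_half {α : Type} [Finite α] [Nonempty α] {s : ℕ} (P : α → Prop) (I : Fin s → Prop)
    (h : 2 * s * Nat.card {a // P a} ≤ Nat.card α) :
    Nat.card α ^ s ≤ 2 * Nat.card {g : Fin s → α // ∀ p, I p → ¬ P (g p)} := by
  classical
  have hbad : Nat.card {g : Fin s → α // ∃ p, P (g p)} ≤ ∑ p : Fin s, Nat.card {g : Fin s → α // P (g p)} := by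
    have := Set.ncard_iUnion_le_of_fintype (fun p : Fin s => {g : Fin s → α | P (g p)})
    have e : (⋃ p : Fin s, {g : Fin s → α | P (g p)}) = {g | ∃ p, P (g p)} := by ext g; simp
    rw [e] at this
    exact this
  have hpos : 0 < Nat.card α := Nat.card_pos
  have h2 : 2 * Nat.card {g : Fin s → α // ∃ p, P (g p)} ≤ Nat.card α ^ s := by
    refine Nat.le_of_mul_le_mul_right ?_ hpos
    calc 2 * Nat.card {g : Fin s → α // ∃ p, P (g p)} * Nat.card α
        ≤ 2 * (∑ p : Fin s, Nat.card {g : Fin s → α // P (g p)}) * Nat.card α := by gcongr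
      _ = 2 * ∑ p : Fin s, (Nat.card {g : Fin s → α // P (g p)} * Nat.card α) := by
        rw [mul_assoc, Finset.sum_mul]
      _ ≤ 2 * ∑ p : Fin s, (Nat.card {a // P a} * Nat.card α ^ s) := by
        exact Nat.mul_le_mul_left _ (Finset.sum_le_sum fun p _ => frac_deg P p)
      _ = (2 * s * Nat.card {a // P a}) * Nat.card α ^ s := by simp; ring
      _ ≤ Nat.card α * Nat.card α ^ s := by gcongr
      _ = _ := by ring
  have h3 : Nat.card α ^ s ≤ Nat.card {g : Fin s → α // ∃ p, P (g p)} + Nat.card {g : Fin s → α // ∀ p, I p → ¬ P (g p)} := by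
    have : Nat.card (Fin s → α) = Nat.card α ^ s := by rw [Nat.card_fun]; simp
    rw [← this]
    have hu : (Set.univ : Set (Fin s → α)) ⊆ {g | ∃ p, P (g p)} ∪ {g | ∀ p, I p → ¬ P (g p)} := by
      intro g _
      by_cases hg : ∃ p, P (g p)
      · exact Or.inl hg
      · exact Or.inr fun p _ hp => hg ⟨p, hp⟩
    have h4 := (Set.ncard_le_ncard hu (Set.toFinite _)).trans (Set.ncard_union_le _ _)
    rw [Set.ncard_univ] at h4
    exact h4
  omega

theorem frac2 {α Y : Type*} [Finite α] [Nonempty α] {n s : ℕ} {Φ : Type} [Finite Φ] (P : α → Y → Prop)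
    (X : Y → Prop) (e : Φ → Fin n ↪ Fin s) (he : ∀ f f', Set.range (e f) = Set.range (e f') → f = f')
    (hX : ∀ a y, P a y → X y) (hn : 0 < n) (R : ℕ)
    (hR : ∀ g : Fin s → α, {σ : Set (Fin s) | ∃ y, X y ∧ ∀ i, i ∈ σ ↔ P (g i) y}.ncard ≤ R)
    (J : Set (Fin n → α)) (hJ : ∀ h ∈ J, ∃ y, ∀ j, P (h j) y)
    (hhalf : ∀ (f : Φ) (y : Y), Nat.card α ^ s ≤ 2 * Nat.card {g : Fin s → α // ∀ p, p ∉ Set.range (e f) → ¬ P (g p) y}) :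
    Nat.card Φ * Nat.card J ≤ 2 * R * Nat.card α ^ n := by
  classical
  have hJ' : ∀ h : J, ∃ y, ∀ j, P (h.1 j) y := fun h => hJ h.1 h.2
  choose Yh hY using hJ'
  let T := Σ x : Φ × J, {g : Fin s → α // ∀ p, p ∉ Set.range (e x.1) → ¬ P (g p) (Yh x.2)}
  have hlow : Nat.card Φ * Nat.card J * Nat.card α ^ s ≤ 2 * Nat.card T := by
    have := Fintype.ofFinite Φ
    have := Fintype.ofFinite J
    rw [Nat.card_sigma, Finset.mul_sum]
    refine le_trans ?_ (Finset.card_nsmul_le_sum Finset.univ _ (Nat.card α ^ s) fun x _ => hhalf x.1 (Yh x.2))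
    simp [Nat.card_eq_fintype_card]
  let Q := Σ g : Fin s → α, {σ : Set (Fin s) | ∃ y, X y ∧ ∀ i, i ∈ σ ↔ P (g i) y}
  have hQ : Nat.card Q ≤ Nat.card α ^ s * R := by
    have := Fintype.ofFinite α
    rw [Nat.card_sigma]
    refine (Finset.sum_le_card_nsmul Finset.univ _ R fun g _ => hR g).trans ?_
    simp [Nat.card_eq_fintype_card]
  have key : ∀ x : T, ∀ i, i ∈ Set.range (e x.1.1) ↔ P (Function.extend (e x.1.1) x.1.2.1 x.2.1 i) (Yh x.1.2) := by
    rintro ⟨⟨f, h⟩, g⟩ i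
    by_cases hi : i ∈ Set.range (e f)
    · obtain ⟨j, rfl⟩ := hi
      simp only [Set.mem_range_self, true_iff]
      rw [(e f).injective.extend_apply]
      exact hY h j
    · constructor
      · intro h'; exact absurd h' hi
      · intro h'
        exfalso
        have := g.2 i hi
        rw [Function.extend_apply' _ _ _ (fun ⟨a, ha⟩ => hi ⟨a, ha⟩)] at h'
        exact this h'
  have hinj : Function.Injective (fun x : T => ((⟨Function.extend (e x.1.1) x.1.2.1 x.2.1,
      ⟨Set.range (e x.1.1), Yh x.1.2, hX _ _ (hY x.1.2 ⟨0, hn⟩), key x⟩⟩, x.2.1 ∘ e x.1.1) : Q × (Fin n → α))) := by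
    rintro ⟨⟨f, h⟩, g⟩ ⟨⟨f', h'⟩, g'⟩ hh
    simp only [Prod.mk.injEq] at hh
    obtain ⟨h1, h2⟩ := hh
    have h3 := congrArg Sigma.fst h1
    have h4 : Set.range (e f) = Set.range (e f') := congrArg (fun q : Q => (q.2.1 : Set (Fin s))) h1
    obtain rfl := he _ _ h4
    obtain ⟨h5, h6⟩ := extend_inj (e f).injective h2 h3
    have : h = h' := Subtype.ext h6
    subst this
    have : g = g' := Subtype.ext h5
    rw [this]
  have hup := Nat.card_le_card_of_injective _ hinj
  rw [Nat.card_prod, Nat.card_fun] at hup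
  simp only [Nat.card_eq_fintype_card (α := Fin n), Fintype.card_fin] at hup
  have hpos : 0 < Nat.card α ^ s := pow_pos Nat.card_pos _
  refine Nat.le_of_mul_le_mul_right ?_ hpos
  calc _ ≤ _ := hlow
    _ ≤ 2 * (Nat.card Q * Nat.card α ^ n) := by gcongr
    _ ≤ 2 * (Nat.card α ^ s * R * Nat.card α ^ n) := by gcongr
    _ = _ := by ring

theorem frac {U Y : Type u} (Ω : U → Prop) (φ : U × Y → Prop) (X : Y → Prop) (hX : ∀ u y, Ω u → φ (u, y) → X y)
    {n m C : ℕ} (hn : 0 < n) (hC : ∀ (s : ℕ) (u : Fin s → U), (Tr u φ X).ncard * (s + 1) ≤ C * (s + 1) ^ n)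
    (hm : ∀ w : Fin m → U, (∀ i, Ω (w i)) → ∃ e : Fin n ↪ Fin m, ∃ y, ∀ j, φ (w (e j), y)) :
    ∃ c : ℕ, ∀ (N : ℕ) (u : Fin N → U), 0 < N → (∀ i, Ω (u i)) → ∃ y, N ≤ c * Nat.card {i // φ (u i, y)} := by
  classical
  obtain ⟨E, hE⟩ : ∃ E, E = Nat.card (Fin n ↪ Fin m) := ⟨_, rfl⟩
  obtain ⟨q, hq⟩ : ∃ q, q = 2 * E * C * (n + 1) ^ n + 1 := ⟨_, rfl⟩
  refine ⟨2 * (n * q), fun N u hN hu => ?_⟩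
  by_contra hcon
  push Not at hcon
  have : Nonempty (Fin N) := ⟨⟨0, hN⟩⟩
  have h1 := frac1 (α := Fin N) (n := n) (m := m) {h | ∃ y, ∀ j, φ (u (h j), y)} (fun w => hm (fun i => u (w i)) (fun i => hu _))
  let e : (Fin n → Fin q) → Fin n ↪ Fin (n * q) := fun f => ⟨fun j => finProdFinEquiv (j, f j), fun j j' h => by
    have := finProdFinEquiv.injective h
    exact (Prod.mk.inj this).1⟩
  have he : ∀ f f', Set.range (e f) = Set.range (e f') → f = f' := by
    intro f f' h
    funext j
    have : e f j ∈ Set.range (e f') := h ▸ Set.mem_range_self j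
    obtain ⟨j', hj'⟩ := this
    have := finProdFinEquiv.injective hj'
    simp only [Prod.mk.injEq] at this
    rw [← this.2, this.1]
  let R := Finset.univ.sup (fun g : Fin (n * q) → Fin N => (Tr (u ∘ g) φ X).ncard)
  have hR : ∀ g : Fin (n * q) → Fin N, (Tr (u ∘ g) φ X).ncard ≤ R := fun g =>
    Finset.le_sup (f := fun g : Fin (n * q) → Fin N => (Tr (u ∘ g) φ X).ncard) (Finset.mem_univ g)
  have hRC : R * (n * q + 1) ≤ C * (n * q + 1) ^ n := by
    obtain ⟨g, _, hg⟩ := Finset.exists_mem_eq_sup (Finset.univ : Finset (Fin (n * q) → Fin N)) Finset.univ_nonempty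
      (fun g => (Tr (u ∘ g) φ X).ncard)
    have : R = (Tr (u ∘ g) φ X).ncard := hg
    rw [this]
    exact hC _ _
  have h2 := frac2 (α := Fin N) (fun a y => φ (u a, y)) X e he (fun a y h => hX _ _ (hu a) h) hn R hR
    {h | ∃ y, ∀ j, φ (u (h j), y)} (fun h hh => hh) (fun f y => frac_half _ _ (by
      rw [Nat.card_eq_fintype_card (α := Fin N), Fintype.card_fin]
      exact (hcon y).le))
  rw [← hE] at h1
  rw [Nat.card_fun] at h2
  simp only [Nat.card_eq_fintype_card (α := Fin _), Fintype.card_fin] at h1 h2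
  set J := Nat.card ↑{h : Fin n → Fin N | ∃ y, ∀ j, φ (u (h j), y)} with hJ
  have hJpos : 0 < J := by
    rcases Nat.eq_zero_or_pos J with h | h
    · rw [h] at h1
      have : 0 < N ^ n := pow_pos hN _
      omega
    · exact h
  have hq1 : 1 ≤ q := by omega
  have h3 : q ^ n ≤ 2 * R * E := by
    refine Nat.le_of_mul_le_mul_right ?_ hJpos
    calc q ^ n * J ≤ _ := h2
      _ ≤ 2 * R * (E * J) := by gcongr
      _ = _ := by ring
  have h4 : q ^ n * (n * q + 1) ≤ (2 * E * C * (n + 1) ^ n) * q ^ n := by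
    calc q ^ n * (n * q + 1) ≤ 2 * R * E * (n * q + 1) := by gcongr
      _ = 2 * E * (R * (n * q + 1)) := by ring
      _ ≤ 2 * E * (C * (n * q + 1) ^ n) := by gcongr
      _ ≤ 2 * E * (C * ((n + 1) * q) ^ n) := by
        gcongr
        nlinarith
      _ = _ := by rw [mul_pow]; ring
  have h5 : n * q + 1 ≤ 2 * E * C * (n + 1) ^ n := by
    have hp : 0 < q ^ n := pow_pos hq1 _
    refine Nat.le_of_mul_le_mul_left ?_ hp
    calc _ ≤ _ := h4
      _ = _ := by ring
  have h6 : q ≤ n * q := Nat.le_mul_of_pos_left q hn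
  omega

section
variable {M : Type u} [LinearOrder M] [OM M]
variable {X Y U : Type u} [Sp M X] [Sp M Y] [Sp M U]

/-- rank with respect to frontier points -/
theorem rank_exists (R : X × M → Prop) (hR : DP M R) : ∃ (K : ℕ) (rk : X × M → ℕ), (∀ p, rk p < K) ∧
    (∀ r, DP M (fun p => rk p = r)) ∧ (∀ x t t', t ≤ t' → rk (x, t) ≤ rk (x, t')) ∧
    (∀ x t t', rk (x, t) = rk (x, t') → (R (x, t) ↔ R (x, t'))) := by
  obtain ⟨F, hF⟩ : ∃ F : X × M → Prop, F = fun p => Fr (fun t => R (p.1, t)) p.2 := ⟨_, rfl⟩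
  have dF : DP M F := by
    rw [hF]
    exact DP.fr hR
  have fF : ∀ p, {t | F (p, t)}.Finite := by
    intro p
    rw [hF]
    exact fr_finite (S := fun t => R (p, t)) dfb
  obtain ⟨K, hK⟩ := uf X F dF fF
  have f1 : ∀ p : X × M, {t | F (p.1, t) ∧ t < p.2}.Finite := fun p => (fF p.1).subset fun t h => h.1
  have f2 : ∀ p : X × M, {t | F (p.1, t) ∧ t ≤ p.2}.Finite := fun p => (fF p.1).subset fun t h => h.1
  have d1 : ∀ r, DP M (fun p : X × M => (cnt fun t => F (p.1, t) ∧ t < p.2) = r) := fun r =>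
    DP.cnt_eq (A := fun q : (X × M) × M => F (q.1.1, q.2) ∧ q.2 < q.1.2) dfb f1 r
  have d2 : ∀ r, DP M (fun p : X × M => (cnt fun t => F (p.1, t) ∧ t ≤ p.2) = r) := fun r =>
    DP.cnt_eq (A := fun q : (X × M) × M => F (q.1.1, q.2) ∧ q.2 ≤ q.1.2) dfb f2 r
  have b1 : ∀ p : X × M, (cnt fun t => F (p.1, t) ∧ t < p.2) ≤ K := fun p =>
    le_trans (Set.ncard_le_ncard (fun t h => h.1) (fF p.1)) (hK p.1)
  have b2 : ∀ p : X × M, (cnt fun t => F (p.1, t) ∧ t ≤ p.2) ≤ K := fun p =>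
    le_trans (Set.ncard_le_ncard (fun t h => h.1) (fF p.1)) (hK p.1)
  have m1 : ∀ x t t', t ≤ t' → (cnt fun s => F (x, s) ∧ s < t) ≤ (cnt fun s => F (x, s) ∧ s < t') :=
    fun x t t' h => Set.ncard_le_ncard (fun s hs => ⟨hs.1, hs.2.trans_le h⟩) (f1 (x, t'))
  have m2 : ∀ x t t', t ≤ t' → (cnt fun s => F (x, s) ∧ s ≤ t) ≤ (cnt fun s => F (x, s) ∧ s ≤ t') :=
    fun x t t' h => Set.ncard_le_ncard (fun s hs => ⟨hs.1, hs.2.trans h⟩) (f2 (x, t'))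
  refine ⟨2 * K + 1, fun p => (cnt fun t => F (p.1, t) ∧ t < p.2) + (cnt fun t => F (p.1, t) ∧ t ≤ p.2), ?_, ?_, ?_, ?_⟩
  · intro p
    have := b1 p
    have := b2 p
    dsimp only
    omega
  · intro r
    have : DP M (fun p : X × M => ∃ i : Fin (r + 1), (cnt fun t => F (p.1, t) ∧ t < p.2) = i.1 ∧
      (cnt fun t => F (p.1, t) ∧ t ≤ p.2) = r - i.1) := DP.finEx fun i => (d1 i.1).and (d2 (r - i.1))
    refine this.congr fun p => ?_
    dsimp only
    constructor
    · intro h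
      refine ⟨⟨cnt fun t => F (p.1, t) ∧ t < p.2, by omega⟩, rfl, by dsimp only; omega⟩
    · rintro ⟨i, h1, h2⟩
      rw [h1, h2]
      omega
  · intro x t t' h
    exact Nat.add_le_add (m1 x t t' h) (m2 x t t' h)
  · have key : ∀ x t t', t < t' → (cnt fun s => F (x, s) ∧ s < t) + (cnt fun s => F (x, s) ∧ s ≤ t) =
        (cnt fun s => F (x, s) ∧ s < t') + (cnt fun s => F (x, s) ∧ s ≤ t') → (R (x, t) ↔ R (x, t')) := by
      intro x t t' htt h
      have h1 := m1 x t t' htt.le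
      have h2 := m2 x t t' htt.le
      have e1 : (cnt fun s => F (x, s) ∧ s < t) = (cnt fun s => F (x, s) ∧ s < t') := by omega
      have e2 : (cnt fun s => F (x, s) ∧ s ≤ t) = (cnt fun s => F (x, s) ∧ s ≤ t') := by omega
      have s1 := Set.eq_of_subset_of_ncard_le (fun s (hs : F (x, s) ∧ s < t) => (⟨hs.1, hs.2.trans_le htt.le⟩ : F (x, s) ∧ s < t')) e1.ge (f1 (x, t'))
      have s2 := Set.eq_of_subset_of_ncard_le (fun s (hs : F (x, s) ∧ s ≤ t) => (⟨hs.1, hs.2.trans htt.le⟩ : F (x, s) ∧ s ≤ t')) e2.ge (f2 (x, t'))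
      refine fr_const (S := fun t => R (x, t)) dfb htt.le fun s h3 h4 h5 => ?_
      have hs : F (x, s) := by rw [hF]; exact h5
      rcases h3.eq_or_lt with h6 | h6
      · have : s ∈ {s | F (x, s) ∧ s < t'} := ⟨hs, h6 ▸ htt⟩
        have h7 : s ∈ {s | F (x, s) ∧ s < t} := by rw [show {s | F (x, s) ∧ s < t} = _ from s1]; exact this
        exact absurd h7.2 (not_lt.2 h6.le)
      · have : s ∈ {s | F (x, s) ∧ s ≤ t'} := ⟨hs, h4⟩
        have h7 : s ∈ {s | F (x, s) ∧ s ≤ t} := by rw [show {s | F (x, s) ∧ s ≤ t} = _ from s2]; exact this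
        exact absurd h7.2 (not_le.2 h6)
    intro x t t' h
    rcases lt_trichotomy t t' with h1 | h1 | h1
    · exact key x t t' h1 h
    · rw [h1]
    · exact (key x t' t h1 h.symm).symm

variable (M Y) in
/-- A definable type on `Y`. -/
structure DT where
  F : Filter Y
  ne : F.NeBot
  dec : ∀ P : Y → Prop, DP M P → (∀ᶠ y in F, P y) ∨ (∀ᶠ y in F, ¬ P y)
  defn : ∀ (U : Type u) [Sp M U] (P : U × Y → Prop), DP M P → DP M (fun u => ∀ᶠ y in F, P (u, y))

/-- lower families -/
def Low (A : Y × M → Prop) : Prop := ∀ y t t', t ≤ t' → A (y, t') → A (y, t)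

variable (p : DT M Y)

/-- fibrewise almost everywhere inclusion -/
def DT.le (A B : Y × M → Prop) : Prop := ∀ᶠ y in p.F, ∀ t, A (y, t) → B (y, t)

theorem DT.le_or {A B : Y × M → Prop} (hA : DP M A) (hB : DP M B) (lA : Low A) (lB : Low B) :
    p.le A B ∨ p.le B A := by
  rcases p.dec (fun y => ∀ t, A (y, t) → B (y, t)) dfb with h | h
  · exact Or.inl h
  · refine Or.inr (h.mono fun y hy t ht => ?_)
    by_contra hA'
    refine hy fun s hs => ?_
    rcases le_total s t with h1 | h1
    · exact lB y s t h1 ht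
    · exact absurd (lA y t s h1 hs) hA'

theorem DT.le_trans {A B C : Y × M → Prop} (h : p.le A B) (h' : p.le B C) : p.le A C := by
  filter_upwards [h, h'] with y h1 h2 t ht using h2 t (h1 t ht)

theorem DT.le_of {A B : Y × M → Prop} (h : ∀ y t, A (y, t) → B (y, t)) : p.le A B :=
  Filter.Eventually.of_forall h

theorem DT.dp_le {A B : U × (Y × M) → Prop} (hA : DP M A) (hB : DP M B) :
    DP M (fun u => p.le (fun z => A (u, z)) (fun z => B (u, z))) :=
  p.defn U (fun q => ∀ t, A (q.1, (q.2, t)) → B (q.1, (q.2, t))) dfb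

/-- cut data -/
structure Cut (D : (Y × M → Prop) → Prop) : Prop where
  mono : ∀ A B, DP M A → DP M B → Low A → Low B → p.le A B → D B → D A
  bot : D (fun _ => False)
  top : ¬ D (fun _ => True)
  defn : ∀ (U : Type u) [Sp M U] (A : U × (Y × M) → Prop), DP M A → (∀ u, Low (fun z => A (u, z))) →
    DP M (fun u => D (fun z => A (u, z)))

variable {p}

/-- the filter of a cut -/
def Cut.filter {D : (Y × M → Prop) → Prop} (hD : Cut p D) : Filter (Y × M) where
  sets := {s | ∃ A B, (DP M A ∧ Low A ∧ D A) ∧ (DP M B ∧ Low B ∧ ¬ D B) ∧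
    ∀ᶠ y in p.F, ∀ t, B (y, t) → ¬ A (y, t) → (y, t) ∈ s}
  univ_sets := ⟨fun _ => False, fun _ => True, ⟨DP.false, fun _ _ _ _ h => h, hD.bot⟩,
    ⟨DP.true, fun _ _ _ _ h => h, hD.top⟩, Filter.Eventually.of_forall fun _ _ _ _ => trivial⟩
  sets_of_superset := by
    rintro s s' ⟨A, B, hA, hB, h⟩ hss
    exact ⟨A, B, hA, hB, h.mono fun y hy t h1 h2 => hss (hy t h1 h2)⟩
  inter_sets := by
    rintro s s' ⟨A, B, ⟨hA, lA, DA⟩, ⟨hB, lB, DB⟩, h⟩ ⟨A', B', ⟨hA', lA', DA'⟩, ⟨hB', lB', DB'⟩, h'⟩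
    have dAA : DP M (fun z => A z ∨ A' z) := dfb
    have dBB : DP M (fun z => B z ∧ B' z) := dfb
    have lAA : Low (fun z => A z ∨ A' z) := fun y t t' h h' => h'.imp (lA y t t' h) (lA' y t t' h)
    have lBB : Low (fun z => B z ∧ B' z) := fun y t t' h h' => ⟨lB y t t' h h'.1, lB' y t t' h h'.2⟩
    refine ⟨fun z => A z ∨ A' z, fun z => B z ∧ B' z, ⟨dAA, lAA, ?_⟩, ⟨dBB, lBB, fun hc => ?_⟩, ?_⟩
    · rcases p.le_or hA hA' lA lA' with h | h
      · refine hD.mono _ _ dAA hA' lAA lA' ?_ DA'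
        exact h.mono fun y hy t ht => ht.elim (hy t) id
      · refine hD.mono _ _ dAA hA lAA lA ?_ DA
        exact h.mono fun y hy t ht => ht.elim id (hy t)
    · rcases p.le_or hB hB' lB lB' with h | h
      · refine DB (hD.mono _ _ hB dBB lB lBB ?_ hc)
        exact h.mono fun y hy t ht => ⟨ht, hy t ht⟩
      · refine DB' (hD.mono _ _ hB' dBB lB' lBB ?_ hc)
        exact h.mono fun y hy t ht => ⟨hy t ht, ht⟩
    · filter_upwards [h, h'] with y h1 h2 t h3 h4
      exact ⟨h1 t h3.1 fun h => h4 (Or.inl h), h2 t h3.2 fun h => h4 (Or.inr h)⟩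

theorem Cut.mem {D : (Y × M → Prop) → Prop} (hD : Cut p D) {P : Y × M → Prop} :
    (∀ᶠ z in hD.filter, P z) ↔ ∃ A B, (DP M A ∧ Low A ∧ D A) ∧ (DP M B ∧ Low B ∧ ¬ D B) ∧
    ∀ᶠ y in p.F, ∀ t, B (y, t) → ¬ A (y, t) → P (y, t) := Iff.rfl

theorem Cut.ne {D : (Y × M → Prop) → Prop} (hD : Cut p D) : hD.filter.NeBot := by
  rw [← Filter.eventually_false_iff_eq_bot.not.trans Filter.neBot_iff.symm]
  rw [hD.mem]
  rintro ⟨A, B, ⟨hA, lA, DA⟩, ⟨hB, lB, DB⟩, h⟩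
  refine DB (hD.mono _ _ hB hA lB lA ?_ DA)
  exact h.mono fun y hy t ht => by_contra fun h => hy t ht h

theorem Cut.slice {D : (Y × M → Prop) → Prop} (hD : Cut p D) (P : U × (Y × M) → Prop) (hP : DP M P) :
    ∃ (K : ℕ) (rk : (U × Y) × M → ℕ), (∀ r, DP M (fun p => rk p = r)) ∧ (∀ u r, DP M (fun z : Y × M => rk ((u, z.1), z.2) < r)) ∧
      (∀ r, DP M (fun z : (U × Y) × M => rk z < r)) ∧
      (∀ u r, Low (fun z : Y × M => rk ((u, z.1), z.2) < r)) ∧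
      ∀ u, ∃ r : Fin K, (D (fun z => rk ((u, z.1), z.2) < r.1) ∧ ¬ D (fun z => rk ((u, z.1), z.2) < r.1 + 1)) ∧
        ((∀ᶠ y in p.F, ∀ t, rk ((u, y), t) = r.1 → P (u, (y, t))) ∨
          (∀ᶠ y in p.F, ∀ t, rk ((u, y), t) = r.1 → ¬ P (u, (y, t)))) := by
  obtain ⟨K, rk, h1, h2, h3, h4⟩ := rank_exists (X := U × Y) (fun q => P (q.1.1, (q.1.2, q.2))) dfb
  have h2' : ∀ r, DP M (fun p => rk p < r) := by
    intro r
    have : DP M (fun p => ∃ i : Fin r, rk p = i.1) := DP.finEx fun i => h2 i.1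
    refine this.congr fun p => ⟨fun h => ⟨⟨_, h⟩, rfl⟩, ?_⟩
    rintro ⟨i, h⟩
    rw [h]
    exact i.2
  have dl : ∀ u r, DP M (fun z : Y × M => rk ((u, z.1), z.2) < r) := fun u r =>
    DP.comp (h2' r) (f := fun z : Y × M => ((u, z.1), z.2)) dfb
  have de : ∀ u r, DP M (fun z : Y × M => rk ((u, z.1), z.2) = r) := fun u r =>
    DP.comp (h2 r) (f := fun z : Y × M => ((u, z.1), z.2)) dfb
  refine ⟨K, rk, h2, dl, h2', fun u r y t t' h h' => lt_of_le_of_lt (h3 _ _ _ h) h', fun u => ?_⟩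
  have hex : ∃ r, ¬ D (fun z => rk ((u, z.1), z.2) < r) := by
    refine ⟨K, ?_⟩
    have : (fun z : Y × M => rk ((u, z.1), z.2) < K) = fun _ => True := by
      funext z
      simp [h1]
    rw [this]
    exact hD.top
  classical
  obtain ⟨r, hr⟩ : ∃ r, Nat.find hex = r + 1 := by
    refine Nat.exists_eq_succ_of_ne_zero fun h => ?_
    rw [Nat.find_eq_zero] at h
    refine h ?_
    have : (fun z : Y × M => rk ((u, z.1), z.2) < 0) = fun _ => False := by
      funext z
      simp
    rw [this]
    exact hD.bot
  have hrK : r < K := by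
    have : Nat.find hex ≤ K := Nat.find_min' hex (by
      have : (fun z : Y × M => rk ((u, z.1), z.2) < K) = fun _ => True := by
        funext z
        simp [h1]
      rw [this]
      exact hD.top)
    omega
  refine ⟨⟨r, hrK⟩, ⟨?_, ?_⟩, ?_⟩
  · exact not_not.1 (Nat.find_min hex (m := r) (by omega))
  · have := Nat.find_spec hex
    rw [hr] at this
    exact this
  · have de' := de u r
    obtain ⟨E, hE⟩ : ∃ E : Y × M → Prop, E = fun z : Y × M => rk ((u, z.1), z.2) = r := ⟨_, rfl⟩
    rw [← hE] at de'
    rcases p.dec (fun y => ∃ t, E (y, t) ∧ P (u, (y, t))) dfb with h | h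
    · refine Or.inl (h.mono ?_)
      rintro y ⟨t, ht, hP'⟩ t' ht'
      rw [hE] at ht
      exact (h4 (u, y) t t' (ht.trans ht'.symm)).1 hP'
    · refine Or.inr (h.mono ?_)
      rintro y hy t ht hP'
      exact hy ⟨t, by rw [hE]; exact ht, hP'⟩

def Cut.dt {D : (Y × M → Prop) → Prop} (hD : Cut p D) : DT M (Y × M) where
  F := hD.filter
  ne := hD.ne
  dec P hP := by
    obtain ⟨K, rk, h1, h2, h3, h4, h5⟩ := hD.slice (U := M) (fun q => P q.2) dfb
    obtain ⟨r, ⟨h6, h7⟩, h8⟩ := h5 (Classical.arbitrary M)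
    rcases h8 with h8 | h8
    · refine Or.inl (hD.mem.2 ⟨_, _, ⟨h2 _ _, h4 _ _, h6⟩, ⟨h2 _ _, h4 _ _, h7⟩, h8.mono fun y hy t ha hb => hy t ?_⟩)
      dsimp only at ha hb
      omega
    · refine Or.inr (hD.mem.2 ⟨_, _, ⟨h2 _ _, h4 _ _, h6⟩, ⟨h2 _ _, h4 _ _, h7⟩, h8.mono fun y hy t ha hb => hy t ?_⟩)
      dsimp only at ha hb
      omega
  defn U _ P hP := by
    obtain ⟨K, rk, h1, h2, h3, h4, h5⟩ := hD.slice P hP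
    have key : ∀ r : Fin K, DP M (fun u => (D (fun z => rk ((u, z.1), z.2) < r.1) ∧ ¬ D (fun z => rk ((u, z.1), z.2) < r.1 + 1)) ∧
        (∀ᶠ y in p.F, ∀ t, rk ((u, y), t) = r.1 → P (u, (y, t)))) := by
      intro r
      have d3 : ∀ r, DP M (fun q : U × (Y × M) => rk ((q.1, q.2.1), q.2.2) < r) := fun r =>
        DP.comp (h3 r) (f := fun q : U × (Y × M) => ((q.1, q.2.1), q.2.2)) dfb
      refine DP.and (DP.and ?_ (DP.not ?_)) ?_
      · exact hD.defn U (fun q => rk ((q.1, q.2.1), q.2.2) < r.1) (d3 _) (fun u => h4 u _)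
      · exact hD.defn U (fun q => rk ((q.1, q.2.1), q.2.2) < r.1 + 1) (d3 _) (fun u => h4 u _)
      · have h1 := h1 r
        obtain ⟨E, hE⟩ : ∃ E : (U × Y) × M → Prop, E = fun z => rk z = r := ⟨_, rfl⟩
        rw [← hE] at h1
        have := p.defn U (fun q => ∀ t, E (q, t) → P (q.1, (q.2, t))) dfb
        rw [hE] at this
        exact this
    refine (DP.finEx key).congr fun u => ?_
    constructor
    · intro h
      obtain ⟨r, ⟨h6, h7⟩, h8⟩ := h5 u
      refine ⟨r, ⟨h6, h7⟩, ?_⟩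
      rcases h8 with h8 | h8
      · exact h8
      · exfalso
        have hn : ∀ᶠ z in hD.filter, ¬ P (u, z) := by
          refine hD.mem.2 ⟨_, _, ⟨h2 _ _, h4 _ _, h6⟩, ⟨h2 _ _, h4 _ _, h7⟩, h8.mono fun y hy t ha hb => hy t ?_⟩
          dsimp only at ha hb
          omega
        have := hD.ne
        obtain ⟨z, hz, hz'⟩ := (h.and hn).exists
        exact hz' hz
    · rintro ⟨r, ⟨h6, h7⟩, h8⟩
      refine hD.mem.2 ⟨_, _, ⟨h2 _ _, h4 _ _, h6⟩, ⟨h2 _ _, h4 _ _, h7⟩, h8.mono fun y hy t ha hb => hy t ?_⟩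
      dsimp only at ha hb
      omega
end

section
variable {M : Type u} [LinearOrder M] [OM M]
variable {X Y U : Type u} [Sp M X] [Sp M Y] [Sp M U]

/-- below all of `C u` -/
def Lo (C : U × (Y × M) → Prop) (u : U) (z : Y × M) : Prop := ∀ s, C (u, (z.1, s)) → z.2 < s
/-- below some of `C u` -/
def Le (C : U × (Y × M) → Prop) (u : U) (z : Y × M) : Prop := ∃ s, C (u, (z.1, s)) ∧ z.2 ≤ s

theorem Lo.low (C : U × (Y × M) → Prop) (u : U) : Low (Lo C u) := fun y t t' h h' s hs => h.trans_lt (h' s hs)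
theorem Le.low (C : U × (Y × M) → Prop) (u : U) : Low (Le C u) := fun y t t' h ⟨s, hs, h'⟩ => ⟨s, hs, h.trans h'⟩
theorem DP.lo {C : U × (Y × M) → Prop} (hC : DP M C) : DP M (fun q : U × (Y × M) => Lo C q.1 q.2) := by
  unfold Lo
  exact dfb
theorem DP.lE {C : U × (Y × M) → Prop} (hC : DP M C) : DP M (fun q : U × (Y × M) => Le C q.1 q.2) := by
  unfold Le
  exact dfb
theorem DP.lo1 {C : U × (Y × M) → Prop} (hC : DP M C) (u : U) : DP M (Lo C u) := by
  unfold Lo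
  exact dfb
theorem DP.le1 {C : U × (Y × M) → Prop} (hC : DP M C) (u : U) : DP M (Le C u) := by
  unfold Le
  exact dfb

/-- a track -/
structure Track (q : Ultrafilter U) (p : DT M Y) (C : U × (Y × M) → Prop) : Prop where
  dp : DP M C
  cvx : ∀ u y t t' t'', t ≤ t' → t' ≤ t'' → C (u, (y, t)) → C (u, (y, t'')) → C (u, (y, t'))
  q1 : ∀ P : DT M (Y × M), ∀ᶠ v in q, ¬ ∀ᶠ z in P.F, C (v, z)

/-- almost everywhere disjoint -/
def Dj (p : DT M Y) (A B : Y × M → Prop) : Prop := ∀ᶠ y in p.F, ∀ t, ¬ (A (y, t) ∧ B (y, t))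

theorem Dj.symm {p : DT M Y} {A B : Y × M → Prop} (h : Dj p A B) : Dj p B A :=
  h.mono fun y hy t ht => hy t ⟨ht.2, ht.1⟩

theorem DP.dj (p : DT M Y) {A B : X × (Y × M) → Prop} (hA : DP M A) (hB : DP M B) :
    DP M (fun x => Dj p (fun z => A (x, z)) (fun z => B (x, z))) :=
  p.defn X (fun q => ∀ t, ¬ (A (q.1, (q.2, t)) ∧ B (q.1, (q.2, t)))) dfb

variable {q : Ultrafilter U} {p : DT M Y} {C : U × (Y × M) → Prop}

theorem Track.cut (h : Track q p C) {D : (Y × M → Prop) → Prop} (hD : Cut p D) :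
    ∀ᶠ v in q, ¬ D (Lo C v) ∨ D (Le C v) := by
  refine (h.q1 hD.dt).mono fun v hv => ?_
  by_contra hc
  push Not at hc
  refine hv (hD.mem.2 ⟨Lo C v, Le C v, ⟨DP.lo1 h.dp v, Lo.low C v, hc.1⟩, ⟨DP.le1 h.dp v, Le.low C v, hc.2⟩,
    Filter.Eventually.of_forall ?_⟩)
  rintro y t ⟨s, hs, hts⟩ hlo
  unfold Lo at hlo
  push Not at hlo
  obtain ⟨s', hs', h'⟩ := hlo
  exact h.cvx v y s' t s h' hts hs' hs

theorem Track.q2 (h : Track q p C) {A : Y × M → Prop} (hA : DP M A) (lA : Low A) :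
    ∀ᶠ v in q, p.le (fun z => C (v, z)) A ∨ Dj p (fun z => C (v, z)) A := by
  by_cases h0 : p.le A (fun _ => False)
  · refine Filter.Eventually.of_forall fun v => Or.inr ?_
    exact h0.mono fun y hy t ht => hy t ht.2
  have hD : Cut p (fun B => p.le B A ∧ ¬ p.le A B) := by
    refine ⟨?_, ?_, ?_, ?_⟩
    · rintro B B' _ _ _ _ h1 ⟨h2, h3⟩
      exact ⟨p.le_trans h1 h2, fun h4 => h3 (p.le_trans h4 h1)⟩
    · exact ⟨p.le_of fun _ _ h => h.elim, h0⟩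
    · rintro ⟨_, h2⟩
      exact h2 (p.le_of fun _ _ _ => trivial)
    · intro V _ B hB lB
      have hA' : DP M (fun q : V × (Y × M) => A q.2) := dfb
      exact (p.dp_le hB hA').and (p.dp_le hA' hB).not
  refine (h.cut hD).mono ?_
  rintro v (hv | hv)
  · right
    have hle : p.le A (Lo C v) := by
      rcases p.le_or hA (DP.lo1 h.dp v) lA (Lo.low C v) with h1 | h1
      · exact h1
      · by_contra h2
        exact hv ⟨h1, h2⟩
    exact hle.mono fun y hy t ht => lt_irrefl _ (hy t ht.2 t ht.1)
  · left
    exact hv.1.mono fun y hy t ht => hy t ⟨t, ht, le_rfl⟩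

theorem Track.dj_lo (v w : U) (h : p.le (fun z => C (w, z)) (Lo C v)) :
    Dj p (fun z => C (v, z)) (fun z => C (w, z)) :=
  h.mono fun y hy t ht => lt_irrefl _ (hy t ht.2 t ht.1)

theorem Track.dj_le (v w : U) (h : Dj p (fun z => C (w, z)) (Le C v)) :
    Dj p (fun z => C (v, z)) (fun z => C (w, z)) :=
  h.mono fun y hy t ht => hy t ⟨ht.2, ⟨t, ht.1, le_rfl⟩⟩

theorem Track.q3 (h : Track q p C) (u : U) :
    ∀ᶠ v in q, p.le (fun z => C (v, z)) (fun z => C (u, z)) ∨ Dj p (fun z => C (u, z)) (fun z => C (v, z)) := by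
  filter_upwards [h.q2 (DP.lo1 h.dp u) (Lo.low C u), h.q2 (DP.le1 h.dp u) (Le.low C u)] with v h1 h2
  rcases h1 with h1 | h1
  · exact Or.inr (Track.dj_lo u v h1)
  rcases h2 with h2 | h2
  · left
    filter_upwards [h1, h2] with y h3 h4 t ht
    obtain ⟨s, hs, hts⟩ := h4 t ht
    have h5 : ¬ Lo C u (y, t) := fun h => h3 t ⟨ht, h⟩
    unfold Lo at h5
    push Not at h5
    obtain ⟨s', hs', h'⟩ := h5
    exact h.cvx u y s' t s h' hts hs' hs
  · exact Or.inr (Track.dj_le u v h2)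

variable {T : Type} {pp : T → DT M Y} {CC : T → U × (Y × M) → Prop}

/-- disjoint on all tracks of `J` -/
def DJ (pp : T → DT M Y) (CC : T → U × (Y × M) → Prop) (J : Finset T) (u v : U) : Prop :=
  ∀ τ : J, Dj (pp τ) (fun z => CC τ (u, z)) (fun z => CC τ (v, z))

theorem DP.dJ (hC : ∀ τ, DP M (CC τ)) (J : Finset T) {f g : X → U} (hf : DM M f) (hg : DM M g) :
    DP M (fun x => DJ pp CC J (f x) (g x)) := by
  refine DP.finAll fun τ => ?_
  have := hC τ
  exact DP.dj (X := X) (pp τ) (A := fun q => CC τ (f q.1, q.2)) (B := fun q => CC τ (g q.1, q.2)) dfb dfb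

/-- the main claim -/
def Clm (q : Ultrafilter U) (pp : T → DT M Y) (CC : T → U × (Y × M) → Prop) (J : Finset T) : Prop :=
  ∀ Q : U → Prop, DP M Q → (∀ᶠ v in q, Q v) → ∃ u, Q u ∧ ∀ᶠ v in q, DJ pp CC J u v

theorem Clm.seq (hC : ∀ τ, DP M (CC τ)) {J : Finset T} (h : Clm q pp CC J) (N : ℕ) :
    ∀ Q : U → Prop, DP M Q → (∀ᶠ v in q, Q v) → ∃ u : Fin N → U, (∀ i, Q (u i)) ∧
      ∀ i j, i < j → DJ pp CC J (u i) (u j) := by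
  induction N with
  | zero => exact fun Q _ _ => ⟨Fin.elim0, fun i => i.elim0, fun i => i.elim0⟩
  | succ N ih =>
    intro Q hQ hQ'
    obtain ⟨u0, h0, h1⟩ := h Q hQ hQ'
    obtain ⟨u, h2, h3⟩ := ih (fun v => Q v ∧ DJ pp CC J u0 v) (hQ.and (DP.dJ hC J (DM.const _) DM.id)) (hQ'.and h1)
    refine ⟨Fin.cons u0 u, fun i => ?_, fun i j => ?_⟩
    · refine Fin.cases ?_ (fun i => ?_) i
      · exact h0
      · exact (h2 i).1
    · refine Fin.cases ?_ (fun i => ?_) i <;> refine Fin.cases ?_ (fun j => ?_) j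
      · intro h; exact absurd h (lt_irrefl _)
      · intro _; exact (h2 j).2
      · intro h; exact absurd h (by simp)
      · intro h; exact h3 i j (Fin.succ_lt_succ_iff.1 h)

/-- pigeonhole step -/
theorem Clm.pigeon (hT : ∀ τ, Track q (pp τ) (CC τ)) {J : Finset T} {N : ℕ} (hN : J.card < N) (u : Fin N → U)
    (h : ∀ i j, i < j → DJ pp CC J (u i) (u j)) : ∃ l, ∀ᶠ v in q, DJ pp CC J (u l) v := by
  by_contra hc
  push Not at hc
  have hc' : ∀ l, ∃ τ : J, ¬ ∀ᶠ v in q, Dj (pp τ) (fun z => CC τ (u l, z)) (fun z => CC τ (v, z)) := by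
    intro l
    by_contra h'
    push Not at h'
    exact Ultrafilter.eventually_not.1 (hc l) (Filter.eventually_all.2 h')
  choose τ hτ using hc'
  obtain ⟨i, j, hij, he⟩ := Fintype.exists_ne_map_eq_of_card_lt τ (by simpa using hN)
  have hsub : ∀ l, ∀ᶠ v in q, (pp (τ l)).le (fun z => CC (τ l) (v, z)) (fun z => CC (τ l) (u l, z)) := by
    intro l
    rcases Ultrafilter.eventually_or.1 ((hT (τ l)).q3 (u l)) with h1 | h1
    · exact h1
    · exact absurd h1 (hτ l)
  have hd : Dj (pp (τ i)) (fun z => CC (τ i) (u i, z)) (fun z => CC (τ i) (u j, z)) := by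
    rcases lt_or_gt_of_ne hij with h1 | h1
    · exact h i j h1 (τ i)
    · exact (h j i h1 (τ i)).symm
  have hj := hsub j
  rw [← he] at hj
  refine hτ i ?_
  filter_upwards [hsub i, hj] with v h1 h2
  filter_upwards [hd, h1, h2] with y h3 h4 h5 t ht
  exact h3 t ⟨h4 t ht.2, h5 t ht.2⟩

theorem Clm.step [DecidableEq T] (hT : ∀ τ, Track q (pp τ) (CC τ)) {J : Finset T} (h : Clm q pp CC J) (κ : T) :
    Clm q pp CC (insert κ J) := by
  have hC : ∀ τ, DP M (CC τ) := fun τ => (hT τ).dp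
  have hκ := hC κ
  intro Q hQ hQ'
  suffices hs : ∃ u, Q u ∧ (∀ᶠ v in q, DJ pp CC J u v) ∧
      ∀ᶠ v in q, Dj (pp κ) (fun z => CC κ (u, z)) (fun z => CC κ (v, z)) by
    obtain ⟨u, h1, h2, h3⟩ := hs
    refine ⟨u, h1, ?_⟩
    filter_upwards [h2, h3] with v h4 h5
    rintro ⟨τ, hτ⟩
    rcases Finset.mem_insert.1 hτ with rfl | hτ'
    · exact h5
    · exact h4 ⟨τ, hτ'⟩
  have dE : DP M (fun v => (pp κ).le (fun z => CC κ (v, z)) (fun _ => False)) :=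
    (pp κ).dp_le hκ (B := fun _ => False) dfb
  by_cases hE : ∀ᶠ v in q, (pp κ).le (fun z => CC κ (v, z)) (fun _ => False)
  · obtain ⟨u, h1, h2⟩ := h (fun v => Q v ∧ (pp κ).le (fun z => CC κ (v, z)) (fun _ => False)) (hQ.and dE) (hQ'.and hE)
    exact ⟨u, h1.1, h2, Filter.Eventually.of_forall fun v => h1.2.mono fun y hy t ht => hy t ht.1⟩
  rw [← Ultrafilter.eventually_not] at hE
  obtain ⟨Q1, hQ1⟩ : ∃ Q1 : U → Prop, Q1 = fun v => Q v ∧ ¬ (pp κ).le (fun z => CC κ (v, z)) (fun _ => False) := ⟨_, rfl⟩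
  have dQ1 : DP M Q1 := by rw [hQ1]; exact hQ.and dE.not
  have eQ1 : ∀ᶠ v in q, Q1 v := by rw [hQ1]; exact hQ'.and hE
  suffices hs : ∃ u : Fin (J.card + 1) → U, (∀ i, Q1 (u i)) ∧ (∀ i j, i < j → DJ pp CC J (u i) (u j)) ∧
      ∀ i, ∀ᶠ v in q, Dj (pp κ) (fun z => CC κ (u i, z)) (fun z => CC κ (v, z)) by
    obtain ⟨u, h1, h2, h3⟩ := hs
    obtain ⟨l, hl⟩ := Clm.pigeon hT (Nat.lt_succ_self _) u h2
    have := h1 l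
    rw [hQ1] at this
    exact ⟨u l, this.1, hl, h3 l⟩
  obtain ⟨D, hDdef⟩ : ∃ D : (Y × M → Prop) → Prop, D = fun A => ∃ u : Fin (J.card + 1) → U, (∀ i, Q1 (u i)) ∧
    (∀ i j, i < j → DJ pp CC J (u i) (u j)) ∧ ∀ i, Dj (pp κ) (fun z => CC κ (u i, z)) A := ⟨_, rfl⟩
  have hD : Cut (pp κ) D := by
    rw [hDdef]
    refine ⟨?_, ?_, ?_, ?_⟩
    · rintro A B _ _ _ _ hAB ⟨u, h1, h2, h3⟩
      refine ⟨u, h1, h2, fun i => ?_⟩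
      filter_upwards [hAB, h3 i] with y h4 h5 t ht
      exact h5 t ⟨ht.1, h4 t ht.2⟩
    · obtain ⟨u, h1, h2⟩ := Clm.seq hC h (J.card + 1) Q1 dQ1 eQ1
      exact ⟨u, h1, h2, fun i => Filter.Eventually.of_forall fun y t ht => ht.2⟩
    · rintro ⟨u, h1, h2, h3⟩
      have := h1 0
      rw [hQ1] at this
      refine this.2 ((h3 0).mono fun y hy t ht => hy t ⟨ht, trivial⟩)
    · intro V _ A hA lA
      apply DP.ex2
      refine DP.and dfb (DP.and ?_ ?_)
      · refine DP.finAll fun i => DP.finAll fun j => DP.imp dfb ?_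
        exact DP.dJ hC J dfb dfb
      · refine DP.finAll fun i => ?_
        exact DP.dj (X := V × (Fin (J.card + 1) → U)) (pp κ) (A := fun r => CC κ (r.1.2 i, r.2)) (B := fun r => A (r.1.1, r.2)) dfb dfb
  by_cases hDL : ∀ A, DP M A → Low A → D A → ∀ᶠ v in q, Dj (pp κ) (fun z => CC κ (v, z)) A
  · obtain ⟨u, h1, h2⟩ := Clm.seq hC h (J.card + 1) (fun v => Q1 v ∧ (¬ D (Lo (CC κ) v) ∨ D (Le (CC κ) v)))
      (dQ1.and ((hD.defn U _ (DP.lo hκ) (fun u => Lo.low _ u)).not.or (hD.defn U _ (DP.lE hκ) (fun u => Le.low _ u))))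
      (eQ1.and ((hT κ).cut hD))
    refine ⟨u, fun i => (h1 i).1, h2, fun i => ?_⟩
    rcases (h1 i).2 with h3 | h3
    · rcases Ultrafilter.eventually_or.1 ((hT κ).q2 (DP.lo1 hκ (u i)) (Lo.low _ (u i))) with h4 | h4
      · exact h4.mono fun v hv => Track.dj_lo (u i) v hv
      · exfalso
        apply h3
        obtain ⟨u', h5, h6⟩ := Clm.seq hC h (J.card + 1) (fun v => Q1 v ∧ Dj (pp κ) (fun z => CC κ (v, z)) (Lo (CC κ) (u i)))
          (dQ1.and (DP.dj (pp κ) hκ (B := fun r => Lo (CC κ) (u i) r.2) (DP.snd (DP.lo1 hκ (u i))))) (eQ1.and h4)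
        rw [hDdef]
        exact ⟨u', fun i => (h5 i).1, h6, fun i => (h5 i).2⟩
    · exact (hDL _ (DP.le1 hκ (u i)) (Le.low _ (u i)) h3).mono fun v hv => Track.dj_le (u i) v hv
  · push Not at hDL
    obtain ⟨A, hA, lA, DA, hn⟩ := hDL
    rw [hDdef] at DA
    obtain ⟨u, h1, h2, h3⟩ := DA
    refine ⟨u, h1, h2, fun i => ?_⟩
    rcases Ultrafilter.eventually_or.1 ((hT κ).q2 hA lA) with h4 | h4
    · refine h4.mono fun v hv => ?_
      filter_upwards [h3 i, hv] with y h5 h6 t ht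
      exact h5 t ⟨ht.1, h6 t ht.2⟩
    · exact absurd h4 (Ultrafilter.eventually_not.1 hn)

theorem Clm.all (hT : ∀ τ, Track q (pp τ) (CC τ)) (J : Finset T) : Clm q pp CC J := by
  classical
  induction J using Finset.induction_on with
  | empty =>
    intro Q hQ hQ'
    obtain ⟨u, hu⟩ := hQ'.exists
    exact ⟨u, hu, Filter.Eventually.of_forall fun v τ => absurd τ.2 (Finset.notMem_empty _)⟩
  | insert κ J _ ih => exact Clm.step hT ih κ
end

theorem frac_tuple {U Z : Type u} (Ω : U → Prop) (φ : U × Z → Prop) {c n : ℕ} (hc : 0 < c) (hn : 0 < n)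
    (h : ∀ (N : ℕ) (u : Fin N → U), 0 < N → (∀ i, Ω (u i)) → ∃ y, N ≤ c * Nat.card {i // φ (u i, y)})
    {m : ℕ} (hm : m = 2 * c * n) (N : ℕ) (u : Fin N → Fin m → U) (hN : 0 < N) (hu : ∀ a i, Ω (u a i)) :
    ∃ z, N ≤ 2 * c * Nat.card {a // ∃ e : Fin n ↪ Fin m, ∀ j, φ (u a (e j), z)} := by
  classical
  have hmpos : 0 < m := by rw [hm]; positivity
  obtain ⟨z, hz⟩ := h (N * m) (fun k => u (finProdFinEquiv.symm k).1 (finProdFinEquiv.symm k).2)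
    (by positivity) (fun k => hu _ _)
  refine ⟨z, ?_⟩
  have e1 : Nat.card {k : Fin (N * m) // φ (u (finProdFinEquiv.symm k).1 (finProdFinEquiv.symm k).2, z)} =
      ∑ a, Nat.card {i // φ (u a i, z)} := by
    rw [← Nat.card_sigma]
    refine Nat.card_congr ((Equiv.subtypeEquiv (q := fun x : Fin N × Fin m => φ (u x.1 x.2, z)) finProdFinEquiv.symm (fun _ => Iff.rfl)).trans
      (Equiv.subtypeProdEquivSigmaSubtype (fun a i => φ (u a i, z))))
  rw [e1] at hz
  let G := Finset.univ.filter fun a => ∃ e : Fin n ↪ Fin m, ∀ j, φ (u a (e j), z)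
  have hG : Nat.card {a // ∃ e : Fin n ↪ Fin m, ∀ j, φ (u a (e j), z)} = G.card := by
    rw [Nat.card_eq_fintype_card, Fintype.card_subtype]
  have e2 : ∑ a, Nat.card {i // φ (u a i, z)} ≤ G.card * m + N * n := by
    calc _ ≤ ∑ a, ((if a ∈ G then m else 0) + n) := by
          refine Finset.sum_le_sum fun a _ => ?_
          by_cases ha : a ∈ G
          · rw [if_pos ha]
            have : Nat.card {i // φ (u a i, z)} ≤ Nat.card (Fin m) := Nat.card_le_card_of_injective _ Subtype.val_injective
            rw [Nat.card_eq_fintype_card (α := Fin m), Fintype.card_fin] at this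
            omega
          · rw [if_neg ha, zero_add]
            by_contra hlt
            push Not at hlt
            refine ha (Finset.mem_filter.2 ⟨Finset.mem_univ _, ?_⟩)
            rw [Nat.card_eq_fintype_card] at hlt
            obtain ⟨f⟩ := Function.Embedding.nonempty_of_card_le (α := Fin n) (β := {i // φ (u a i, z)}) (by simpa using hlt.le)
            exact ⟨f.trans (Function.Embedding.subtype _), fun j => (f j).2⟩
      _ = _ := by
          rw [Finset.sum_add_distrib]
          simp [Finset.sum_ite_mem]
  rw [hG]
  have h3 : N * m ≤ c * (G.card * m + N * n) := hz.trans (Nat.mul_le_mul_left _ e2)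
  have h4 : N * (c * n) ≤ (2 * c * G.card) * (c * n) := by
    rw [hm] at h3
    nlinarith
  exact Nat.le_of_mul_le_mul_right h4 (by positivity)

section
variable {M : Type u} [LinearOrder M] [OM M]

variable (M) in
/-- transversal property of a space -/
def TT (Y : Type u) [Sp M Y] : Prop := ∀ (U : Type u) [Sp M U] (Ω : U → Prop) (φ : U × Y → Prop) (c : ℕ),
  DP M Ω → DP M φ → 
  (∀ (N : ℕ) (u : Fin N → U), 0 < N → (∀ i, Ω (u i)) → ∃ y, N ≤ c * Nat.card {i // φ (u i, y)}) →
  ∃ (s : ℕ) (p : Fin s → DT M Y), ∀ u, Ω u → ∃ i, ∀ᶠ y in (p i).F, φ (u, y)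

theorem TT.punit : TT M PUnit.{u+1} := by
  intro U _ Ω φ c hΩ hφ h
  have p : DT M PUnit.{u+1} := 
    { F := ⊤
      ne := inferInstance
      dec := fun P hP => by
        by_cases h : P PUnit.unit
        · exact Or.inl (Filter.eventually_top.2 fun _ => h)
        · exact Or.inr (Filter.eventually_top.2 fun _ => h)
      defn := fun U _ P hP => by
        have : DP M (fun u => P (u, PUnit.unit)) := dfb
        exact this.congr fun u => by
          rw [Filter.eventually_top]
          exact ⟨fun h => h _, fun h _ => h⟩ }
  refine ⟨1, fun _ => p, fun u hu => ⟨0, ?_⟩⟩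
  obtain ⟨y, hy⟩ := h 1 (fun _ => u) one_pos (fun _ => hu)
  have hc : Nat.card {i : Fin 1 // φ (u, y)} ≠ 0 := by
    intro h
    rw [h] at hy
    omega
  have := (Nat.card_ne_zero.1 hc).1
  obtain ⟨i, hi⟩ := this
  exact Filter.Eventually.of_forall fun _ => hi

theorem TT.step {Y : Type u} [Sp M Y] (hY : TT M Y) : TT M (Y × M) := by
  classical
  intro U _ Ω φ c hΩ hφ h
  by_contra hcon
  -- ultrafilter
  have hcov : ∀ S : Finset (DT M (Y × M)), ∃ u, Ω u ∧ ∀ P ∈ S, ¬ ∀ᶠ z in P.F, φ (u, z) := by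
    intro S
    by_contra hS
    push Not at hS
    refine hcon ⟨S.card, fun i => (S.equivFin.symm i).1, fun u hu => ?_⟩
    obtain ⟨P, hP, h1⟩ := hS u hu
    refine ⟨S.equivFin ⟨P, hP⟩, ?_⟩
    simpa using h1
  let F0 : Filter U := ⨅ S : Finset (DT M (Y × M)), Filter.principal {u | Ω u ∧ ∀ P ∈ S, ¬ ∀ᶠ z in P.F, φ (u, z)}
  have hF0 : F0.NeBot := by
    refine Filter.iInf_neBot_of_directed' ?_ ?_
    · intro S S'
      refine ⟨S ∪ S', ?_, ?_⟩
      · refine Filter.principal_mono.2 fun u hu => ⟨hu.1, fun P hP => hu.2 P (Finset.mem_union_left _ hP)⟩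
      · refine Filter.principal_mono.2 fun u hu => ⟨hu.1, fun P hP => hu.2 P (Finset.mem_union_right _ hP)⟩
    · intro S
      rw [Filter.principal_neBot_iff]
      exact hcov S
  let q : Ultrafilter U := Ultrafilter.of F0
  have hq : ∀ S : Finset (DT M (Y × M)), ∀ᶠ u in q, Ω u ∧ ∀ P ∈ S, ¬ ∀ᶠ z in P.F, φ (u, z) := fun S =>
    Ultrafilter.of_le F0 (Filter.mem_iInf_of_mem S (Filter.mem_principal_self _))
  have hqΩ : ∀ᶠ u in q, Ω u := (hq ∅).mono fun u hu => hu.1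
  have hqP : ∀ P : DT M (Y × M), ∀ᶠ u in q, ¬ ∀ᶠ z in P.F, φ (u, z) := fun P =>
    (hq {P}).mono fun u hu => hu.2 P (Finset.mem_singleton_self _)
  -- pieces
  obtain ⟨K, rk, h1, h2, h3, h4⟩ := rank_exists (X := U × Y) (fun r => φ (r.1.1, (r.1.2, r.2))) dfb
  -- base
  obtain ⟨m, hm⟩ : ∃ m, m = 2 * (c + 1) * (K + 1) := ⟨_, rfl⟩
  obtain ⟨s, p, hp⟩ := hY (Fin m → U) (fun w => ∀ i, Ω (w i))
    (fun r => ∃ t, ∃ e : Fin (K + 1) ↪ Fin m, ∀ j, φ (r.1 (e j), (r.2, t))) (2 * (c + 1)) dfb dfb (by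
      intro N u hN hu
      obtain ⟨⟨y, t⟩, hz⟩ := frac_tuple Ω φ (c := c + 1) (n := K + 1) (Nat.succ_pos _) (Nat.succ_pos _) (by
        intro N u hN hu
        obtain ⟨y, hy⟩ := h N u hN hu
        exact ⟨y, hy.trans (Nat.mul_le_mul_right _ (Nat.le_succ _))⟩) hm N u hN hu
      refine ⟨y, hz.trans (Nat.mul_le_mul_left _ ?_)⟩
      refine Nat.card_le_card_of_injective (fun a => ⟨a.1, t, a.2⟩) ?_
      intro a b hab
      exact Subtype.ext (Subtype.mk.inj hab))
  -- tracks
  let CC : Fin s × Fin K → U × (Y × M) → Prop := fun τ r => φ r ∧ rk ((r.1, r.2.1), r.2.2) = τ.2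
  have hT : ∀ τ : Fin s × Fin K, Track q (p τ.1) (CC τ) := by
    intro τ
    refine ⟨?_, ?_, ?_⟩
    · exact hφ.and (DP.comp (h2 τ.2) (f := fun r : U × (Y × M) => ((r.1, r.2.1), r.2.2)) dfb)
    · rintro u y t t' t'' h5 h6 ⟨h7, h8⟩ ⟨h9, h10⟩
      have e : rk ((u, y), t') = τ.2 := by
        have a1 := h3 (u, y) t t' h5
        have a2 := h3 (u, y) t' t'' h6
        dsimp only at h8 h10
        omega
      exact ⟨(h4 (u, y) t t' (h8.trans e.symm)).1 h7, e⟩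
    · intro P
      refine (hqP P).mono fun v hv hv' => hv (hv'.mono fun z hz => hz.1)
  obtain ⟨u, hu1, hu2⟩ := Clm.seq (CC := CC) (pp := fun τ => p τ.1) (fun τ => (hT τ).dp) (Clm.all (CC := CC) (pp := fun τ => p τ.1) hT Finset.univ) m Ω hΩ hqΩ
  obtain ⟨b, hb⟩ := hp u hu1
  have hall : ∀ᶠ y in (p b).F, ∀ i j, i < j → ∀ r : Fin K, ∀ t, ¬ (CC (b, r) (u i, (y, t)) ∧ CC (b, r) (u j, (y, t))) := by
    refine Filter.eventually_all.2 fun i => Filter.eventually_all.2 fun j => ?_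
    by_cases hij : i < j
    · refine Filter.Eventually.mono (Filter.eventually_all.2 fun r : Fin K => hu2 i j hij ⟨(b, r), Finset.mem_univ _⟩) ?_
      intro y hy _
      exact hy
    · exact Filter.Eventually.of_forall fun y h => absurd h hij
  have := (p b).ne
  obtain ⟨y, ⟨t, e, he⟩, hy⟩ := (hb.and hall).exists
  obtain ⟨j, j', hjj, hr⟩ := Fintype.exists_ne_map_eq_of_card_lt (fun j : Fin (K + 1) => (⟨rk ((u (e j), y), t), h1 _⟩ : Fin K)) (by simp)
  have key : ∀ j j', e j < e j' → (⟨rk ((u (e j), y), t), h1 _⟩ : Fin K) = ⟨rk ((u (e j'), y), t), h1 _⟩ → False := by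
    intro j j' hlt hr
    exact hy (e j) (e j') hlt ⟨rk ((u (e j), y), t), h1 _⟩ t ⟨⟨he j, rfl⟩, ⟨he j', (congrArg Fin.val hr).symm⟩⟩
  have hne : e j ≠ e j' := fun h => hjj (e.injective h)
  rcases lt_or_gt_of_ne hne with h5 | h5
  · exact key j j' h5 hr
  · exact key j' j h5 hr.symm

theorem TT.pw : ∀ k : ℕ, TT M (Pw M k)
  | 0 => TT.punit
  | k + 1 => TT.step (TT.pw k)
end

theorem mn_index {α U : Type*} (f : U → Set α) (S : Set (Set α)) {m n : ℕ} (hn : 0 < n) (hnm : n ≤ m)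
    (h : HasMNProperty S m n) (hne : ∀ X ∈ S, X.Nonempty) (w : Fin (m * n) → U) (hw : ∀ i, f (w i) ∈ S) :
    ∃ e : Fin n ↪ Fin (m * n), ∃ y, ∀ j, y ∈ f (w (e j)) := by
  classical
  let I := Finset.univ.image (fun i => f (w i))
  have hI : ∀ X ∈ I, ∃ i, f (w i) = X := by
    intro X hX
    obtain ⟨i, _, hi⟩ := Finset.mem_image.1 hX
    exact ⟨i, hi⟩
  by_cases hc : m ≤ I.card
  · obtain ⟨F, hF, hFc⟩ := Finset.exists_subset_card_eq hc
    obtain ⟨G, hG, hGc, y, hy⟩ := h F (fun X hX => by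
      obtain ⟨i, hi⟩ := hI X (hF hX)
      rw [← hi]
      exact hw i) hFc
    have hG' : ∀ X : G, ∃ i, f (w i) = X.1 := fun X => hI X.1 (hF (hG X.2))
    choose g hg using hG'
    let e0 : Fin n ≃ G := (finCongr hGc.symm).trans G.equivFin.symm
    refine ⟨⟨fun j => g (e0 j), ?_⟩, y, fun j => ?_⟩
    · intro j j' hjj
      have : (e0 j).1 = (e0 j').1 := by rw [← hg, ← hg]; exact congrArg (fun i => f (w i)) hjj
      exact e0.injective (Subtype.ext this)
    · change y ∈ f (w (g (e0 j)))
      rw [hg]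
      exact hy _ (e0 j).2
  · have hpos : 0 < m * n := Nat.mul_pos (by omega) hn
    obtain ⟨X, hX, hXc⟩ := Finset.exists_le_card_fiber_of_mul_le_card_of_maps_to (s := (Finset.univ : Finset (Fin (m * n))))
      (t := I) (f := fun i => f (w i)) (n := n) (fun i _ => Finset.mem_image_of_mem _ (Finset.mem_univ _))
      ⟨f (w ⟨0, hpos⟩), Finset.mem_image_of_mem _ (Finset.mem_univ _)⟩
      (by rw [Finset.card_univ, Fintype.card_fin]; exact Nat.mul_le_mul_right _ (by omega))
    obtain ⟨G, hG, hGc⟩ := Finset.exists_subset_card_eq hXc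
    let e0 : Fin n ≃ G := (finCongr hGc.symm).trans G.equivFin.symm
    obtain ⟨i, hi⟩ := hI X hX
    obtain ⟨y, hy⟩ := hne X (hi ▸ hw i)
    refine ⟨e0.toEmbedding.trans (Function.Embedding.subtype _), y, fun j => ?_⟩
    have := (Finset.mem_filter.1 (hG (e0 j).2)).2
    change y ∈ f (w (e0 j).1)
    rw [this]
    exact hy

theorem ftt_mn {L : FirstOrder.Language} {M : Type*} [L.Structure M] {k n : ℕ} (hn : 0 < n) {S : Set (Set (Fin k → M))}
    (h : HasFTT L k S) : ∃ m, n ≤ m ∧ HasMNProperty S m n := by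
  classical
  obtain ⟨N, p, hp, hS⟩ := h
  refine ⟨N * n + n, by omega, fun F hF hFc => ?_⟩
  have hS' : ∀ X, ∃ i : Fin N, X ∈ F → X ∈ p i := by
    have hFne : F.Nonempty := Finset.card_pos.1 (by omega)
    obtain ⟨X0, hX0⟩ := hFne
    obtain ⟨i0, _⟩ := hS X0 (hF hX0)
    intro X
    by_cases hX : X ∈ F
    · obtain ⟨i, hi⟩ := hS X (hF hX)
      exact ⟨i, fun _ => hi⟩
    · exact ⟨i0, fun h => absurd h hX⟩
  choose g hg using hS'
  obtain ⟨X0, hX0⟩ : F.Nonempty := Finset.card_pos.1 (by omega)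
  obtain ⟨i, _, hi⟩ := Finset.exists_le_card_fiber_of_mul_le_card_of_maps_to (s := F)
      (t := Finset.univ) (f := g) (n := n) (fun i _ => Finset.mem_univ _)
      ⟨g X0, Finset.mem_univ _⟩
      (by rw [Finset.card_univ, Fintype.card_fin]; omega)
  obtain ⟨G, hG, hGc⟩ := Finset.exists_subset_card_eq hi
  refine ⟨G, fun X hX => (Finset.mem_filter.1 (hG hX)).1, hGc, ?_⟩
  obtain ⟨⟨t1, t2, t3, t4, t5⟩, _⟩ := hp i
  have hu : (Set.univ : Set (Fin k → M)) ∈ p i := by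
    rcases t5 Set.univ Set.definable_univ with h | h
    · exact h
    · rw [Set.compl_univ] at h
      exact absurd h t2
  have hmem : ∀ G' : Finset (Set (Fin k → M)), (∀ X ∈ G', X ∈ p i) → ⋂₀ (G' : Set (Set (Fin k → M))) ∈ p i := by
    intro G'
    induction G' using Finset.induction_on with
    | empty => intro _; simpa using hu
    | insert a s _ ih =>
      intro h
      rw [Finset.coe_insert, Set.sInter_insert]
      exact t3 _ (h a (Finset.mem_insert_self _ _)) _ (ih fun X hX => h X (Finset.mem_insert_of_mem hX))
  have h1 := hmem G (fun X hX => by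
    obtain ⟨h1, h2⟩ := Finset.mem_filter.1 (hG hX)
    exact h2 ▸ hg X h1)
  rw [Set.nonempty_iff_ne_empty]
  intro he
  rw [he] at h1
  exact t2 h1

section
variable {M : Type u} [LinearOrder M] [OM M]

theorem DP.ofDf {k : ℕ} {s : Set (Fin k → M)} (h : OM.Df s) : DP M (fun v : Fin k → M => v ∈ s) := by
  unfold DP
  exact OM.pre' (κ := Fin k × Fin 1) (fun i => (i, 0)) h

theorem DP.toDf {k : ℕ} {s : Set (Fin k → M)} (h : DP M (fun v : Fin k → M => v ∈ s)) : OM.Df s := by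
  unfold DP at h
  exact OM.pre' (ι := Fin k × Fin 1) (κ := Fin k) (fun i => i.1) h

theorem DP.ofDf2 {d k : ℕ} {s : Set (Fin d ⊕ Fin k → M)} (h : OM.Df s) :
    DP M (fun p : (Fin d → M) × (Fin k → M) => Sum.elim p.1 p.2 ∈ s) := by
  unfold DP
  have := OM.pre' (κ := (Fin d × Fin 1) ⊕ (Fin k × Fin 1)) (Sum.map (fun i => (i, 0)) (fun i => (i, 0))) h
  refine (congrArg (OM.Df (M := M)) ?_).mp this
  ext v
  have : v ∘ Sum.map (fun i : Fin d => (i, (0 : Fin 1))) (fun i : Fin k => (i, (0 : Fin 1))) =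
    Sum.elim (fun i => v (Sum.inl (i, 0))) (fun i => v (Sum.inr (i, 0))) := by
    funext i
    rcases i with i | i <;> rfl
  change _ ∈ s ↔ _ ∈ s
  dsimp only
  rw [this]
  rfl

theorem Nb.box : ∀ (d : ℕ) (x : Pw M d) (S : Pw M d → Prop), Nb d x S → ∃ a b : Fin d → M,
    (∀ i, a i < Pw.toFin d x i ∧ Pw.toFin d x i < b i) ∧ ∀ w, (∀ i, a i < Pw.toFin d w i ∧ Pw.toFin d w i < b i) → S w
  | 0, x, S, h => ⟨fun i => i.elim0, fun i => i.elim0, fun i => i.elim0, fun w _ => h⟩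
  | d + 1, (x, t), S, ⟨a, b, ha, hb, h⟩ => by
    obtain ⟨a', b', h1, h2⟩ := Nb.box d x _ h
    refine ⟨Fin.snoc (α := fun _ => M) a' a, Fin.snoc (α := fun _ => M) b' b, fun i => ?_, ?_⟩
    · refine Fin.lastCases ?_ (fun i => ?_) i
      · simpa [Pw.toFin] using ⟨ha, hb⟩
      · simpa [Pw.toFin] using h1 i
    · rintro ⟨w, s⟩ hw
      have hl := hw (Fin.last d)
      simp only [Pw.toFin, Fin.snoc_last] at hl
      refine h2 w (fun i => ?_) s hl.1 hl.2
      have := hw i.castSucc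
      simpa only [Pw.toFin, Fin.snoc_castSucc] using this

theorem oDim_sm {k n : ℕ} {Z : Set (Fin k → M)} (X : Pw M k → Prop) (hX : DP M X) (hZ : ∀ x, X x → Pw.toFin k x ∈ Z)
    (h : oDim Z < n) : SM k n X := by
  by_contra hc
  obtain ⟨ι, hι, ht⟩ := SM.thick k n X hc
  have dk := DM.pwToFin (M := M) k
  have dn := DM.pwToFin (M := M) n
  have hd : DP M (fun z => ∃ x, X x ∧ ∀ i, Pw.toFin k x (ι i) = Pw.toFin n z i) := by
    apply DP.ex2
    refine DP.and dfb (DP.finAll fun i => ?_)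
    exact DP.eq (DM.app (DM.comp dk DM.snd') _) (DM.app (DM.comp dn DM.fst') _)
  obtain ⟨x, hx⟩ := Thick.exists_nb hd ht
  obtain ⟨a, b, h1, h2⟩ := Nb.box n x _ hx
  refine absurd h (not_lt.2 ?_)
  letI : TopologicalSpace M := Preorder.topology M
  haveI : OrderTopology M := ⟨rfl⟩
  unfold oDim
  refine le_csSup ⟨k, ?_⟩ ⟨ι, hι, Pw.toFin n x, ?_⟩
  · rintro d ⟨ι, hι, _⟩
    simpa using Fintype.card_le_of_injective ι hι
  · rw [mem_interior]
    refine ⟨Set.pi Set.univ fun i => Set.Ioo (a i) (b i), ?_, isOpen_set_pi Set.finite_univ fun i _ => isOpen_Ioo, fun i _ => h1 i⟩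
    intro w hw
    obtain ⟨y, hy, hy'⟩ := h2 (Pw.ofFin n w) (fun i => by rw [Pw.toFin_ofFin]; exact hw i (Set.mem_univ _))
    refine ⟨Pw.toFin k y, hZ y hy, ?_⟩
    funext i
    rw [Pw.toFin_ofFin] at hy'
    exact hy' i

theorem mn_tt {k n m d : ℕ} (Ω : Set (Fin d → M)) (D : Set (Fin d ⊕ Fin k → M)) (hΩ : OM.Df Ω) (hD : OM.Df D)
    (hne : ∀ X ∈ famFiber D '' Ω, X.Nonempty) (hn : oDim (⋃₀ (famFiber D '' Ω)) < n) (hnm : n ≤ m)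
    (h : HasMNProperty (famFiber D '' Ω) m n) :
    ∃ (s : ℕ) (p : Fin s → DT M (Pw M k)), ∀ u ∈ Ω, ∃ i, ∀ᶠ y in (p i).F, Pw.toFin k y ∈ famFiber D u := by
  have dΩ := DP.ofDf hΩ
  have dD := DP.ofDf2 hD
  have dk := DM.pwToFin (M := M) k
  obtain ⟨φ, hφ⟩ : ∃ φ : (Fin d → M) × Pw M k → Prop, φ = fun q => Sum.elim q.1 (Pw.toFin k q.2) ∈ D := ⟨_, rfl⟩
  have dφ : DP M φ := by
    rw [hφ]
    exact DP.comp dD (f := fun q : (Fin d → M) × Pw M k => (q.1, Pw.toFin k q.2)) (DM.pair DM.fst' (DM.comp dk DM.snd'))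
  obtain ⟨Om, hOm⟩ : ∃ Om : (Fin d → M) → Prop, Om = fun u => u ∈ Ω := ⟨_, rfl⟩
  rw [← hOm] at dΩ
  have dX : DP M (fun y : Pw M k => ∃ u, Om u ∧ φ (u, y)) := dfb
  have hSM := oDim_sm _ dX (Z := ⋃₀ (famFiber D '' Ω)) (by
    rintro x ⟨u, hu, hx⟩
    rw [hφ] at hx
    rw [hOm] at hu
    exact ⟨famFiber D u, ⟨u, hu, rfl⟩, hx⟩) hn
  obtain ⟨C, hC⟩ := SM.tbd k n _ dX hSM (Fin d → M) φ dφ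
  obtain ⟨c, hc⟩ := frac Om φ _ (fun u y hu hy => ⟨u, hu, hy⟩) (by omega) hC (m := m * n) (by
    intro w hw
    obtain ⟨e, y, hy⟩ := mn_index (famFiber D) _ (by omega) hnm h hne w (fun i => ⟨w i, by have := hw i; rwa [hOm] at this, rfl⟩)
    refine ⟨e, Pw.ofFin k y, fun j => ?_⟩
    rw [hφ]
    dsimp only
    rw [Pw.toFin_ofFin]
    exact hy j)
  obtain ⟨s, p, hp⟩ := TT.pw k (Fin d → M) Om φ c dΩ dφ hc
  refine ⟨s, p, fun u hu => ?_⟩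
  obtain ⟨i, hi⟩ := hp u (by rw [hOm]; exact hu)
  rw [hφ] at hi
  exact ⟨i, hi⟩
end

/-- the abstract structure attached to an o-minimal structure -/
@[reducible] def omOf {L : FirstOrder.Language} {M : Type u} [L.Structure M] [LinearOrder M] (hM : IsOMinimal L M) : OM M where
  Df s := Set.Definable (Set.univ : Set M) L s
  inter' h h' := h.inter h'
  compl' h := h.compl
  pre' f s h := h.preimage_comp f
  ex' := by
    intro ι κ _ _ s h
    have := h.image_comp (Sum.inl : ι → ι ⊕ κ)
    convert this using 1
    ext v
    constructor
    · rintro ⟨w, hw⟩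
      exact ⟨_, hw, funext fun i => rfl⟩
    · rintro ⟨w, hw, rfl⟩
      refine ⟨w ∘ Sum.inr, ?_⟩
      have : Sum.elim (w ∘ Sum.inl) (w ∘ Sum.inr) = w := Sum.elim_comp_inl_inr w
      dsimp only
      rwa [this]
  const' c := Set.Definable.singleton_of_mem L (Set.mem_univ c)
  diag' := Set.Definable.diagonal L Set.univ
  lt' := hM.2.2.2.2.1.mono (Set.empty_subset _)
  ne' := hM.1
  dense' := hM.2.1
  nomin' := hM.2.2.1
  nomax' := hM.2.2.2.1
  omin' s hs := hM.2.2.2.2.2 s hs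

theorem dt_type {L : FirstOrder.Language} {M : Type u} [L.Structure M] [LinearOrder M] (hM : IsOMinimal L M) {k : ℕ}
    (p : @DT M _ (omOf hM) (Pw M k) _) :
    IsTypeOn L k {s | Set.Definable (Set.univ : Set M) L s ∧ ∀ᶠ y in (@DT.F M _ (omOf hM) (Pw M k) _ p), Pw.toFin k y ∈ s} ∧
    IsDefTypeOver L (Set.univ : Set M) k {s | Set.Definable (Set.univ : Set M) L s ∧ ∀ᶠ y in (@DT.F M _ (omOf hM) (Pw M k) _ p), Pw.toFin k y ∈ s} := by
  letI := omOf hM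
  have dk := DM.pwToFin (M := M) k
  have hne := p.ne
  refine ⟨⟨fun X h => h.1, ?_, ?_, ?_, ?_⟩, ?_⟩
  · rintro ⟨_, h⟩
    obtain ⟨y, hy⟩ := h.exists
    exact hy
  · rintro X ⟨h1, h2⟩ Y ⟨h3, h4⟩
    exact ⟨h1.inter h3, h2.and h4⟩
  · rintro X ⟨h1, h2⟩ Y hY hXY
    exact ⟨hY, h2.mono fun y hy => hXY hy⟩
  · intro X hX
    have hX' : DP M (fun v : Fin k → M => v ∈ X) := DP.ofDf hX
    rcases p.dec (fun y => Pw.toFin k y ∈ X) (DP.comp hX' dk) with h | h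
    · exact Or.inl ⟨hX, h⟩
    · exact Or.inr ⟨hX.compl, h⟩
  · intro m D hD
    have hD' : Set.Definable (Set.univ : Set M) L D := hD.mono (Set.empty_subset _)
    have dD := DP.ofDf2 (M := M) hD'
    have h1 : ∀ u, Set.Definable (Set.univ : Set M) L (famFiber D u) := by
      intro u
      refine DP.toDf (M := M) ?_
      exact DP.comp dD (f := fun v : Fin k → M => (u, v)) (DM.pair (DM.const _) DM.id)
    have h2 := p.defn (Fin m → M) (fun q => Sum.elim q.1 (Pw.toFin k q.2) ∈ D)
      (DP.comp dD (f := fun q : (Fin m → M) × Pw M k => (q.1, Pw.toFin k q.2)) (DM.pair DM.fst' (DM.comp dk DM.snd')))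
    have h3 := DP.toDf (M := M) (s := {u | ∀ᶠ y in p.F, Sum.elim u (Pw.toFin k y) ∈ D}) h2
    refine (congrArg (Set.Definable (Set.univ : Set M) L) ?_).mp h3
    ext u
    exact ⟨fun h => ⟨h1 u, h⟩, fun h => h.2⟩

/-- Theorem B: for a definable family `S` of nonempty subsets of `M^k` and
`n > dim ∪S`, `S` has the `(m,n)`-property for some `m ≥ n` if and only if `S` has a finite
tame transversal. -/
theorem statement8 (L : FirstOrder.Language) (M : Type*) [L.Structure M] [LinearOrder M]
    (hM : IsOMinimal L M) (k : ℕ) (S : Set (Set (Fin k → M)))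
    (hS : IsDefFamily L (Set.univ : Set M) k S) (hne : ∀ X ∈ S, X.Nonempty)
    (n : ℕ) (hn : oDim (⋃₀ S) < n) :
    (∃ m, n ≤ m ∧ HasMNProperty S m n) ↔ HasFTT L k S := by
  refine ⟨?_, ftt_mn (by omega)⟩
  rintro ⟨m, hnm, h⟩
  letI := omOf hM
  obtain ⟨d, Ω, D, hΩ, hD, rfl⟩ := hS
  obtain ⟨s, p, hp⟩ := mn_tt (M := M) Ω D hΩ hD hne hn hnm h
  refine ⟨s, fun i => {s | Set.Definable (Set.univ : Set M) L s ∧ ∀ᶠ y in (p i).F, Pw.toFin k y ∈ s}, fun i => dt_type hM (p i), ?_⟩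
  rintro X ⟨u, hu, rfl⟩
  obtain ⟨i, hi⟩ := hp u hu
  refine ⟨i, ?_, hi⟩
  refine DP.toDf (M := M) ?_
  exact DP.comp (DP.ofDf2 (M := M) hD) (f := fun v : Fin k → M => (u, v)) (DM.pair (DM.const _) DM.id)
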